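/- arXiv:2209.00066 — 3 statements merged into one kernel-verified Lean document; each statement's English description precedes it below -/
import Mathlib

section
/- Let W be the Weyl group of a reduced crystallographic root system Φ of rank n. A set {t_1, …, t_n} of n reflections of W is a good generating set for W (i.e., generates W) if and only if det(⟨ρ_{t_i}, ρ̌_{t_j}⟩)_{i,j=1}^n = I(W), where ρ_{t_i} is a root associated to the reflection t_i and ρ̌_{t_j} the corresponding coroot. (This determinant is independent of the choices of signs of the roots ρ_{t_i}.) -/
open Module
open scoped RealInnerProductSpace

namespace WRoot

variable {V : Type*} [NormedAddCommGroup V] [InnerProductSpace ℝ V]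

/-- The coroot associated to a root `α`. -/
noncomputable def coroot (α : V) : V := (2 / ⟪α, α⟫) • α

/-- The reflection associated to `α`, as a linear map: `v ↦ v - ⟪v, α̌⟫ α`. -/
noncomputable def reflLM (α : V) : V →ₗ[ℝ] V where
  toFun v := v - ⟪v, coroot α⟫ • α
  map_add' x y := by
    simp only [inner_add_left, add_smul]
    abel
  map_smul' c x := by
    simp only [real_inner_smul_left, RingHom.id_apply, smul_sub, smul_smul]

/-- The set of reflections `s_α`, `α ∈ Φ`, viewed inside the group of linear
automorphisms of `V`. -/
def reflSet (Φ : Finset V) : Set (V →ₗ[ℝ] V)ˣ :=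
  {w | ∃ α ∈ Φ, (w : V →ₗ[ℝ] V) = reflLM α}

/-- The Weyl group of `Φ`: the subgroup generated by the reflections `s_α`, `α ∈ Φ`. -/
def weylGroup (Φ : Finset V) : Subgroup (V →ₗ[ℝ] V)ˣ :=
  Subgroup.closure (reflSet Φ)

/-- The determinant of the matrix of pairings `⟪ρ i, (ρ j)̌ ⟫` of a family of
roots with the coroots of the family. -/
noncomputable def pairingDet {n : ℕ} (ρ : Fin n → V) : ℝ :=
  Matrix.det (Matrix.of fun i j => ⟪ρ i, coroot (ρ j)⟫)


/-! ### Basic facts on reflections -/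

lemma reflLM_apply (α v : V) : reflLM α v = v - ⟪v, coroot α⟫ • α := rfl

lemma inner_coroot (v α : V) : ⟪v, coroot α⟫ = 2 * ⟪v, α⟫ / ⟪α, α⟫ := by
  simp only [coroot, real_inner_smul_right]; ring

lemma inner_self_pos' {α : V} (h : α ≠ 0) : 0 < ⟪α, α⟫ := real_inner_self_pos.2 h

lemma inner_coroot_self {α : V} (h : α ≠ 0) : ⟪α, coroot α⟫ = 2 := by
  rw [inner_coroot, mul_div_assoc, div_self (inner_self_pos' h).ne', mul_one]

lemma reflLM_apply' (α v : V) : reflLM α v = v - ⟪v, α⟫ • coroot α := by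
  rw [reflLM_apply, inner_coroot, coroot, smul_smul]
  congr 2; ring

lemma reflLM_self {α : V} (h : α ≠ 0) : reflLM α α = -α := by
  rw [reflLM_apply, inner_coroot_self h, two_smul]; abel

lemma reflLM_neg (α : V) : reflLM (-α) = reflLM α := by
  ext v
  rw [reflLM_apply', reflLM_apply']
  simp [coroot]

lemma reflLM_invol {α : V} (h : α ≠ 0) (v : V) : reflLM α (reflLM α v) = v := by
  conv_lhs => rw [reflLM_apply α v, map_sub, map_smul, reflLM_self h, reflLM_apply]
  simp

lemma inner_reflLM {α : V} (h : α ≠ 0) (x y : V) :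
    ⟪reflLM α x, y⟫ = ⟪x, reflLM α y⟫ := by
  simp only [reflLM_apply, inner_sub_left, inner_sub_right, real_inner_smul_left,
    real_inner_smul_right, inner_coroot]
  rw [real_inner_comm α y]; ring

lemma inner_reflLM_reflLM {α : V} (h : α ≠ 0) (x y : V) :
    ⟪reflLM α x, reflLM α y⟫ = ⟪x, y⟫ := by
  rw [inner_reflLM h, reflLM_invol h]

lemma coroot_reflLM {α : V} (h : α ≠ 0) (β : V) :
    coroot (reflLM α β) = reflLM α (coroot β) := by
  rw [coroot, inner_reflLM_reflLM h, coroot, map_smul]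

lemma reflLM_reflLM {α : V} (h : α ≠ 0) (β v : V) :
    reflLM (reflLM α β) v = reflLM α (reflLM β (reflLM α v)) := by
  rw [reflLM_apply, coroot_reflLM h, ← inner_reflLM h, reflLM_apply β, map_sub, map_smul,
    reflLM_invol h]

/-- The reflection as a unit. -/
noncomputable def reflU (α : V) (h : α ≠ 0) : (V →ₗ[ℝ] V)ˣ where
  val := reflLM α
  inv := reflLM α
  val_inv := by ext v; exact reflLM_invol h v
  inv_val := by ext v; exact reflLM_invol h v

/-- A (finite, reduced, crystallographic) root system, not necessarily spanning. -/
structure RS (Ψ : Set V) : Prop where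
  fin : Ψ.Finite
  ne0 : ∀ α ∈ Ψ, α ≠ 0
  red : ∀ α ∈ Ψ, ∀ c : ℝ, c • α ∈ Ψ → c = 1 ∨ c = -1
  crys : ∀ α ∈ Ψ, ∀ β ∈ Ψ, ∃ z : ℤ, ⟪α, coroot β⟫ = (z : ℝ)
  inv : ∀ α ∈ Ψ, ∀ β ∈ Ψ, reflLM α β ∈ Ψ

lemma RS.neg {Ψ : Set V} (h : RS Ψ) {α : V} (hα : α ∈ Ψ) : -α ∈ Ψ := by
  rw [← reflLM_self (h.ne0 α hα)]; exact h.inv α hα α hα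

/-- A base, with real coefficients. -/
structure IsB {ι : Type*} (Ψ : Set V) (b : Basis ι ℝ V) : Prop where
  mem : ∀ i, b i ∈ Ψ
  sgn : ∀ α ∈ Ψ, (∀ i, 0 ≤ b.repr α i) ∨ (∀ i, b.repr α i ≤ 0)

lemma repr_refl_ne {ι : Type*} (b : Basis ι ℝ V) (α : V) {i j : ι} (h : i ≠ j) :
    b.repr (reflLM (b j) α) i = b.repr α i := by
  classical
  rw [reflLM_apply, map_sub, map_smul]
  simp [Finsupp.single_apply, h.symm]

lemma repr_refl_eq {ι : Type*} (b : Basis ι ℝ V) (α : V) (j : ι) :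
    b.repr (reflLM (b j) α) j = b.repr α j - ⟪α, coroot (b j)⟫ := by
  rw [reflLM_apply, map_sub, map_smul]
  simp

lemma exists_pos {ι : Type*} [Fintype ι] (b : Basis ι ℝ V) {α : V} (hα : α ≠ 0)
    (hs : ∀ i, 0 ≤ b.repr α i) : ∃ i, 0 < b.repr α i ∧ 0 < ⟪α, b i⟫ := by
  by_contra! hc
  have h1 : ⟪α, α⟫ = ∑ i, b.repr α i * ⟪α, b i⟫ := by
    conv_lhs => rw [← b.sum_repr α]
    rw [b.sum_repr, ← b.sum_repr α, inner_sum, b.sum_repr]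
    simp only [real_inner_smul_right]
  have h2 : ∑ i, b.repr α i * ⟪α, b i⟫ ≤ 0 := by
    apply Finset.sum_nonpos
    intro i _
    rcases (hs i).eq_or_lt with h | h
    · rw [← h]; simp
    · exact mul_nonpos_of_nonneg_of_nonpos h.le (hc i h)
  have := inner_self_pos' hα
  linarith

lemma base_induction {ι : Type*} [Fintype ι] {Ψ : Set V} (h : RS Ψ) {b : Basis ι ℝ V}
    (hb : IsB Ψ b) (P : V → Prop) (h1 : ∀ i, P (b i))
    (h2 : ∀ α ∈ Ψ, ∀ i, P α → P (reflLM (b i) α)) : ∀ α ∈ Ψ, P α := by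
  classical
  let f : V → ℝ := fun v => ∑ i, b.repr v i
  have key : ∀ α ∈ Ψ, (∀ i, 0 ≤ b.repr α i) → P α ∧ P (-α) := by
    by_contra! hc
    let T : Set V := {α | α ∈ Ψ ∧ (∀ i, 0 ≤ b.repr α i) ∧ ¬ (P α ∧ P (-α))}
    have hT : T.Finite := h.fin.subset fun x hx => hx.1
    have hTn : T.Nonempty := by
      obtain ⟨α, h1, h2, h3⟩ := hc
      exact ⟨α, h1, h2, fun h => h3 h.1 h.2⟩
    obtain ⟨α, ⟨hα, hpos, hbad⟩, hmin⟩ := Set.exists_min_image T f hT hTn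
    obtain ⟨i, hi, hin⟩ := exists_pos b (h.ne0 α hα) hpos
    have hk : 0 < ⟪α, coroot (b i)⟫ := by
      rw [inner_coroot]
      have := inner_self_pos' (h.ne0 _ (hb.mem i))
      positivity
    have hb0 := h.ne0 _ (hb.mem i)
    have hα' := h.inv _ (hb.mem i) α hα
    rcases hb.sgn _ hα' with hs | hs
    · have hlt : f (reflLM (b i) α) < f α := by
        apply Finset.sum_lt_sum
        · intro j _
          by_cases hj : j = i
          · subst hj; rw [repr_refl_eq]; linarith
          · rw [repr_refl_ne b α hj]
        · exact ⟨i, Finset.mem_univ _, by rw [repr_refl_eq]; linarith⟩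
      have hgood : P (reflLM (b i) α) ∧ P (-(reflLM (b i) α)) := by
        by_contra hcon
        exact absurd (hmin _ ⟨hα', hs, hcon⟩) (not_le.2 hlt)
      apply hbad
      constructor
      · have := h2 _ hα' i hgood.1
        rwa [reflLM_invol hb0] at this
      · have := h2 _ (h.neg hα') i hgood.2
        rwa [map_neg, reflLM_invol hb0] at this
    · have hα2 : α = b.repr α i • b i := by
        conv_lhs => rw [← b.sum_repr α]
        apply Finset.sum_eq_single i
        · intro j _ hj
          have := hs j
          rw [repr_refl_ne b α hj] at this
          rw [le_antisymm this (hpos j), zero_smul]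
        · simp
      have hα3 : α = b i := by
        rcases h.red _ (hb.mem i) _ (hα2 ▸ hα) with h | h
        · rw [h, one_smul] at hα2; exact hα2
        · linarith
      apply hbad
      rw [hα3]
      refine ⟨h1 i, ?_⟩
      rw [← reflLM_self hb0]
      exact h2 _ (hb.mem i) i (h1 i)
  intro α hα
  rcases hb.sgn α hα with hs | hs
  · exact (key α hα hs).1
  · have := (key (-α) (h.neg hα) (fun i => by simpa using hs i)).2
    rwa [neg_neg] at this

lemma base_int {ι : Type*} [Fintype ι] {Ψ : Set V} (h : RS Ψ) {b : Basis ι ℝ V}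
    (hb : IsB Ψ b) : ∀ α ∈ Ψ, ∀ i, ∃ z : ℤ, b.repr α i = z := by
  classical
  apply base_induction h hb
  · intro i j
    exact ⟨if i = j then 1 else 0, by simp [Finsupp.single_apply]⟩
  · intro α hα i hP j
    obtain ⟨z, hz⟩ := hP j
    by_cases hj : j = i
    · subst hj
      obtain ⟨k, hk⟩ := h.crys α hα _ (hb.mem j)
      exact ⟨z - k, by rw [repr_refl_eq, hz, hk]; push_cast; rfl⟩
    · exact ⟨z, by rw [repr_refl_ne b α hj, hz]⟩

lemma base_int' {ι : Type*} [Fintype ι] {Ψ : Set V} (h : RS Ψ) {b : Basis ι ℝ V}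
    (hb : IsB Ψ b) : ∀ α ∈ Ψ, ∀ i, ∃ z : ℤ, b.repr α i * (⟪b i, b i⟫ / ⟪α, α⟫) = z := by
  classical
  apply base_induction h hb
  · intro i j
    have := (inner_self_pos' (h.ne0 _ (hb.mem i))).ne'
    by_cases hij : i = j
    · subst hij
      exact ⟨1, by rw [div_self this]; simp⟩
    · exact ⟨0, by simp [Finsupp.single_apply, hij]⟩
  · intro α hα i hP j
    obtain ⟨z, hz⟩ := hP j
    rw [inner_reflLM_reflLM (h.ne0 _ (hb.mem i))]
    by_cases hj : j = i
    · subst hj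
      obtain ⟨k, hk⟩ := h.crys _ (hb.mem j) α hα
      refine ⟨z - k, ?_⟩
      rw [repr_refl_eq, sub_mul, hz, inner_coroot]
      rw [inner_coroot, real_inner_comm] at hk
      have h1 := (inner_self_pos' (h.ne0 _ (hb.mem j))).ne'
      push_cast
      rw [← hk]
      field_simp
    · exact ⟨z, by rw [repr_refl_ne b α hj, hz]⟩

/-! ### The positivity argument -/

lemma even_sum_symm {ι : Type*} [Fintype ι] (F : ι → ι → ℤ) (hs : ∀ i j, F i j = F j i)
    (hd : ∀ i, Even (F i i)) : Even (∑ i, ∑ j, F i j) := by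
  classical
  rw [← Fintype.sum_prod_type', ← ZMod.intCast_eq_zero_iff_even, Int.cast_sum]
  apply Finset.sum_involution (fun (p : ι × ι) _ => p.swap)
  · rintro ⟨i, j⟩ _
    simp only [Prod.swap]
    rw [hs j i]
    exact CharTwo.add_self_eq_zero _
  · rintro ⟨i, j⟩ _ hne heq
    simp only [Prod.swap, Prod.mk.injEq] at heq
    obtain ⟨rfl, _⟩ := heq
    exact hne ((ZMod.intCast_eq_zero_iff_even).2 (hd _))
  · simp
  · simp

lemma base_obtuse {ι : Type*} {Ψ : Set V} (h : RS Ψ) {b : Basis ι ℝ V}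
    (hb : IsB Ψ b) {i j : ι} (hij : i ≠ j) : ⟪b i, b j⟫ ≤ 0 := by
  classical
  by_contra! hc
  have hk : 0 < ⟪b i, coroot (b j)⟫ := by
    rw [inner_coroot]
    have := inner_self_pos' (h.ne0 _ (hb.mem j))
    positivity
  have e1 := repr_refl_ne b (b i) hij
  have e2 := repr_refl_eq b (b i) j
  simp [Finsupp.single_apply, hij] at e1 e2
  rcases hb.sgn _ (h.inv _ (hb.mem j) _ (hb.mem i)) with hs | hs
  · have := hs j; linarith
  · have := hs i; linarith

/-- norm of a nonnegative part is an integer multiple of the norm of the root -/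
lemma part_norm {ι : Type*} [Fintype ι] (b : Basis ι ℝ V) (hb0 : ∀ i, b i ≠ 0)
    (hcr : ∀ i j, ∃ z : ℤ, ⟪b i, coroot (b j)⟫ = (z : ℝ)) {N : ℝ} (hN : 0 < N) (p : ι → ℝ)
    (hp : ∀ i, ∃ z : ℤ, p i = z) (hp' : ∀ i, ∃ z : ℤ, p i * (⟪b i, b i⟫ / N) = z)
    (hne : ∑ i, p i • b i ≠ 0) :
    N ≤ ⟪∑ i, p i • b i, ∑ i, p i • b i⟫ := by
  choose n hn using hcr
  choose c hc using hp
  choose d hd using hp'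
  have hterm : ∀ i j, p i * p j * ⟪b i, b j⟫ = N / 2 * ((c i * n i j * d j : ℤ) : ℝ) := by
    intro i j
    have h1 := (inner_self_pos' (hb0 j)).ne'
    push_cast
    rw [← hn, ← hc, ← hd, inner_coroot]
    field_simp
  have hsum : ⟪∑ i, p i • b i, ∑ i, p i • b i⟫
      = N / 2 * ((∑ i, ∑ j, c i * n i j * d j : ℤ) : ℝ) := by
    rw [sum_inner, Int.cast_sum, Finset.mul_sum]
    apply Finset.sum_congr rfl
    intro i _
    rw [inner_sum, Int.cast_sum, Finset.mul_sum]
    apply Finset.sum_congr rfl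
    intro j _
    rw [← hterm, real_inner_smul_left, real_inner_smul_right]; ring
  have hev : Even (∑ i, ∑ j, c i * n i j * d j) := by
    apply even_sum_symm
    · intro i j
      have h1 := hterm i j
      have h2 := hterm j i
      rw [real_inner_comm, mul_comm (p i)] at h1
      have h3 : N / 2 ≠ 0 := by positivity
      have := mul_left_cancel₀ h3 (h1.symm.trans h2)
      exact_mod_cast this
    · intro i
      have : n i i = 2 := by
        have := hn i i
        rw [inner_coroot_self (hb0 i)] at this
        exact_mod_cast this.symm
      rw [this]
      exact ⟨c i * d i, by ring⟩
  obtain ⟨m, hm⟩ := hev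
  have hpos := inner_self_pos' hne
  rw [hsum, hm] at hpos ⊢
  push_cast at hpos ⊢
  have hm0 : 0 < (m : ℝ) := by
    by_contra! hcon
    nlinarith
  have hm1 : (1 : ℝ) ≤ m := by exact_mod_cast (by exact_mod_cast hm0 : 0 < m)
  nlinarith

lemma sgn_of_int {ι : Type*} [Fintype ι] (b : Basis ι ℝ V)
    (hcr : ∀ i j, ∃ z : ℤ, ⟪b i, coroot (b j)⟫ = (z : ℝ))
    (hob : ∀ i j, i ≠ j → ⟪b i, b j⟫ ≤ 0) {α : V} (hα : α ≠ 0)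
    (h1 : ∀ i, ∃ z : ℤ, b.repr α i = z)
    (h2 : ∀ i, ∃ z : ℤ, b.repr α i * (⟪b i, b i⟫ / ⟪α, α⟫) = z) :
    (∀ i, 0 ≤ b.repr α i) ∨ (∀ i, b.repr α i ≤ 0) := by
  have hN := inner_self_pos' hα
  have hb0 : ∀ i, b i ≠ 0 := fun i => b.ne_zero i
  have hmax : ∀ r s : ℝ, 0 < s → (∃ z : ℤ, r * s = z) → ∃ z : ℤ, max r 0 * s = z := by
    rintro r s hs ⟨z, hz⟩
    refine ⟨max z 0, ?_⟩
    rw [max_mul_of_nonneg _ _ hs.le, hz]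
    simp
  have hmax' : ∀ r : ℝ, (∃ z : ℤ, r = z) → ∃ z : ℤ, max r 0 = z := by
    rintro r ⟨z, hz⟩
    exact ⟨max z 0, by rw [hz]; simp⟩
  have hneg : ∀ r : ℝ, (∃ z : ℤ, r = z) → ∃ z : ℤ, -r = z := by
    rintro r ⟨z, hz⟩
    exact ⟨-z, by rw [hz]; simp⟩
  set p : ι → ℝ := fun i => max (b.repr α i) 0 with hp
  set q : ι → ℝ := fun i => max (-b.repr α i) 0 with hq
  have hs : ∀ i, 0 < ⟪b i, b i⟫ / ⟪α, α⟫ := fun i => div_pos (inner_self_pos' (hb0 i)) hN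
  have hpi : ∀ i, ∃ z : ℤ, p i = z := fun i => hmax' _ (h1 i)
  have hqi : ∀ i, ∃ z : ℤ, q i = z := fun i => hmax' _ (hneg _ (h1 i))
  have hpi' : ∀ i, ∃ z : ℤ, p i * (⟪b i, b i⟫ / ⟪α, α⟫) = z := fun i => hmax _ _ (hs i) (h2 i)
  have hqi' : ∀ i, ∃ z : ℤ, q i * (⟪b i, b i⟫ / ⟪α, α⟫) = z := fun i =>
    hmax _ _ (hs i) (by simpa only [neg_mul] using hneg _ (h2 i))
  have hpq : ∀ i, p i - q i = b.repr α i := by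
    intro i
    simp only [hp, hq]
    rcases le_total 0 (b.repr α i) with h | h
    · rw [max_eq_left h, max_eq_right (by linarith)]; simp
    · rw [max_eq_right h, max_eq_left (by linarith)]; simp
  have hpq0 : ∀ i, p i * q i = 0 := by
    intro i
    simp only [hp, hq]
    rcases le_total 0 (b.repr α i) with h | h
    · rw [max_eq_right (a := -b.repr α i) (by linarith)]; simp
    · rw [max_eq_right h]; simp
  have hp0 : ∀ i, 0 ≤ p i := fun i => le_max_right _ _
  have hq0 : ∀ i, 0 ≤ q i := fun i => le_max_right _ _
  set x := ∑ i, p i • b i with hx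
  set y := ∑ i, q i • b i with hy
  have hxy : α = x - y := by
    rw [hx, hy, ← Finset.sum_sub_distrib]
    conv_lhs => rw [← b.sum_repr α]
    apply Finset.sum_congr rfl
    intro i _
    rw [← sub_smul, hpq]
  have hin : ⟪x, y⟫ ≤ 0 := by
    rw [hx, hy, sum_inner]
    apply Finset.sum_nonpos
    intro i _
    rw [inner_sum]
    apply Finset.sum_nonpos
    intro j _
    rw [real_inner_smul_left, real_inner_smul_right, ← mul_assoc]
    by_cases hij : i = j
    · subst hij; rw [hpq0]; simp
    · exact mul_nonpos_of_nonneg_of_nonpos (mul_nonneg (hp0 i) (hq0 j)) (hob i j hij)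
  have hzero : x = 0 ∨ y = 0 := by
    by_contra! hc
    have e1 := part_norm b hb0 hcr hN p hpi hpi' hc.1
    have e2 := part_norm b hb0 hcr hN q hqi hqi' hc.2
    have e3 : ⟪α, α⟫ = ⟪x, x⟫ - 2 * ⟪x, y⟫ + ⟪y, y⟫ := by
      rw [hxy]
      simp only [inner_sub_left, inner_sub_right]
      rw [real_inner_comm x y]; ring
    rw [← hx] at e1
    rw [← hy] at e2
    linarith
  have hli := Fintype.linearIndependent_iff.1 b.linearIndependent
  rcases hzero with h | h
  · right
    intro i
    have := hli p h i
    rw [← hpq, this]; linarith [hq0 i]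
  · left
    intro i
    have := hli q h i
    rw [← hpq, this]; linarith [hp0 i]

/-! ### Existence of a base -/

open scoped NNReal in
lemma exists_base {Ψ : Set V} (h : RS Ψ) (hsp : Submodule.span ℝ Ψ = ⊤) (f : V →ₗ[ℝ] ℝ)
    (hf : ∀ α ∈ Ψ, f α ≠ 0) :
    ∃ (B : Finset V) (b : Basis B ℝ V), IsB Ψ b := by
  classical
  let Pos : Set V := {α | α ∈ Ψ ∧ 0 < f α}
  have hPf : Pos.Finite := h.fin.subset fun x hx => hx.1
  let good : Set (Finset V) := {B | (B : Set V) ⊆ Pos ∧ Pos ⊆ Submodule.span ℝ≥0 (B : Set V)}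
  have hgn : good.Nonempty := ⟨hPf.toFinset, by simp, by
    rw [hPf.coe_toFinset]; exact Submodule.subset_span⟩
  have hgf : good.Finite := by
    apply (Finset.finite_toSet hPf.toFinset.powerset).subset
    intro B hB
    simp only [Finset.coe_powerset, Set.mem_preimage, Set.mem_powerset_iff, Set.Finite.coe_toFinset]
    exact hB.1
  obtain ⟨B, ⟨hB1, hB2⟩, hmin⟩ := Set.exists_min_image good Finset.card hgf hgn
  have hnn : ∀ S : Set V, S ⊆ Pos → ∀ x ∈ Submodule.span ℝ≥0 S, 0 ≤ f x := by
    intro S hS x hx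
    induction hx using Submodule.span_induction with
    | mem x hx => exact (hS hx).2.le
    | zero => simp
    | add x y _ _ hx hy => rw [map_add]; positivity
    | smul a x _ hx => rw [NNReal.smul_def, map_smul, smul_eq_mul]; exact mul_nonneg a.2 hx
  have hno : ∀ β ∈ B, β ∉ Submodule.span ℝ≥0 ((B.erase β : Finset V) : Set V) := by
    intro β hβ hmem
    have hle : Submodule.span ℝ≥0 (B : Set V)
        ≤ Submodule.span ℝ≥0 ((B.erase β : Finset V) : Set V) := by
      rw [Submodule.span_le]
      intro x hx
      by_cases hxβ : x = β
      · rw [hxβ]; exact hmem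
      · exact Submodule.subset_span (by simpa [hxβ] using hx)
    have := hmin (B.erase β) ⟨fun x hx => hB1 (Finset.mem_of_mem_erase hx), hB2.trans hle⟩
    have := Finset.card_erase_lt_of_mem hβ
    omega
  have hno2 : ∀ β ∈ B, ∀ z ∈ Submodule.span ℝ≥0 ((B.erase β : Finset V) : Set V),
      0 < f z → ∀ r : ℝ, r • β = z → False := by
    intro β hβ z hz hfz r hr
    have hfβ := (hB1 hβ).2
    have hr0 : 0 < r := by
      by_contra! hc
      rw [← hr, map_smul, smul_eq_mul] at hfz
      nlinarith
    apply hno β hβ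
    have h1 : r⁻¹ • z ∈ Submodule.span ℝ≥0 ((B.erase β : Finset V) : Set V) :=
      Submodule.smul_mem _ (⟨r⁻¹, by positivity⟩ : ℝ≥0) hz
    rwa [← hr, smul_smul, inv_mul_cancel₀ hr0.ne', one_smul] at h1
  have hdec : ∀ β ∈ B, ∀ x ∈ Submodule.span ℝ≥0 (B : Set V),
      ∃ c : ℝ≥0, ∃ y ∈ Submodule.span ℝ≥0 ((B.erase β : Finset V) : Set V), x = c • β + y := by
    intro β hβ x hx
    rw [← Finset.insert_erase hβ, Finset.coe_insert] at hx
    exact Submodule.mem_span_insert.1 hx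
  have hob : ∀ α ∈ B, ∀ β ∈ B, α ≠ β → ⟪α, β⟫ ≤ 0 := by
    intro α hα β hβ hne
    by_contra! hc
    have hk : 0 < ⟪α, coroot β⟫ := by
      rw [inner_coroot]
      have := inner_self_pos' (h.ne0 _ (hB1 hβ).1)
      positivity
    have hγ := h.inv β (hB1 hβ).1 α (hB1 hα).1
    rw [reflLM_apply] at hγ
    set k := ⟪α, coroot β⟫
    rcases lt_or_gt_of_ne (hf _ hγ) with hlt | hgt
    · obtain ⟨c, y, hy, hxy⟩ := hdec β hβ _ (hB2 ⟨h.neg hγ, by rw [map_neg]; linarith⟩)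
      apply hno2 β hβ (α + y) (add_mem (Submodule.subset_span (by simp [hne, hα])) hy) ?_
        (k - c)
      · rw [NNReal.smul_def] at hxy
        have : y = -(α - k • β) - (c : ℝ) • β := by rw [hxy]; abel
        rw [this, sub_smul]; abel
      · have := (hB1 hα).2
        have := hnn _ (fun x hx => hB1 (Finset.mem_of_mem_erase hx)) y hy
        rw [map_add]; linarith
    · obtain ⟨c, y, hy, hxy⟩ := hdec α hα _ (hB2 ⟨hγ, hgt⟩)
      have hkβ : k • β ∈ Submodule.span ℝ≥0 ((B.erase α : Finset V) : Set V) := by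
        have : k • β = (⟨k, hk.le⟩ : ℝ≥0) • β := rfl
        rw [this]
        exact Submodule.smul_mem _ _ (Submodule.subset_span (by simp [hne.symm, hβ]))
      apply hno2 α hα (k • β + y) (add_mem hkβ hy) ?_ (1 - c)
      · rw [NNReal.smul_def] at hxy
        have : y = (α - k • β) - (c : ℝ) • α := by rw [hxy]; abel
        rw [this, sub_smul, one_smul]; abel
      · have h1 := (hB1 hβ).2
        have := hnn _ (fun x hx => hB1 (Finset.mem_of_mem_erase hx)) y hy
        rw [map_add, map_smul, smul_eq_mul]
        have := mul_pos hk h1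
        linarith
  have hli : LinearIndependent ℝ (fun i : B => (i : V)) := by
    rw [Fintype.linearIndependent_iff]
    intro g hg
    set x := ∑ i : B, max (g i) 0 • (i : V) with hx
    set y := ∑ i : B, max (-g i) 0 • (i : V) with hy
    have hxy : x = y := by
      rw [← sub_eq_zero, hx, hy, ← Finset.sum_sub_distrib, ← hg]
      apply Finset.sum_congr rfl
      intro i _
      rw [← sub_smul]
      congr 1
      rcases le_total 0 (g i) with h | h
      · rw [max_eq_left h, max_eq_right (by linarith)]; simp
      · rw [max_eq_right h, max_eq_left (by linarith)]; simp
    have hin : ⟪x, y⟫ ≤ 0 := by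
      rw [hx, hy, sum_inner]
      apply Finset.sum_nonpos
      intro i _
      rw [inner_sum]
      apply Finset.sum_nonpos
      intro j _
      rw [real_inner_smul_left, real_inner_smul_right, ← mul_assoc]
      by_cases hij : i = j
      · subst hij
        rcases le_total 0 (g i) with h | h
        · rw [max_eq_right (a := -g i) (by linarith)]; simp
        · rw [max_eq_right h]; simp
      · exact mul_nonpos_of_nonneg_of_nonpos (mul_nonneg (le_max_right _ _) (le_max_right _ _))
          (hob i i.2 j j.2 (fun e => hij (Subtype.ext e)))
    have hx0 : x = 0 := by
      by_contra hc
      have := inner_self_pos' hc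
      rw [← hxy] at hin
      linarith
    have hz : ∀ c : B → ℝ, (∀ i, 0 ≤ c i) → ∑ i : B, c i • (i : V) = 0 → ∀ i, c i = 0 := by
      intro c hc hs i
      have h1 : ∑ i : B, c i * f i = 0 := by
        have := congrArg f hs
        simpa using this
      have h2 := (Finset.sum_eq_zero_iff_of_nonneg
        (fun i _ => mul_nonneg (hc i) (hB1 i.2).2.le)).1 h1 i (Finset.mem_univ _)
      rcases mul_eq_zero.1 h2 with h | h
      · exact h
      · exact absurd h (hB1 i.2).2.ne'
    intro i
    have e1 := hz _ (fun i => le_max_right _ _) hx0 i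
    have e2 := hz _ (fun i => le_max_right _ _) (hxy ▸ hx0) i
    have := le_max_left (g i) 0
    have := le_max_left (-g i) 0
    linarith
  have hspB : ⊤ ≤ Submodule.span ℝ (Set.range (fun i : B => (i : V))) := by
    have hr : Set.range (fun i : B => (i : V)) = (B : Set V) := by simp
    rw [hr, ← hsp, Submodule.span_le]
    have hpos : ∀ x ∈ Pos, x ∈ Submodule.span ℝ (B : Set V) := by
      intro x hx
      exact Submodule.span_subset_span ℝ≥0 ℝ (B : Set V) (hB2 hx)
    intro x hx
    rcases lt_or_gt_of_ne (hf _ hx) with hlt | hgt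
    · have := hpos (-x) ⟨h.neg hx, by rw [map_neg]; linarith⟩
      simpa using this
    · exact hpos x ⟨hx, hgt⟩
  let b : Basis B ℝ V := Basis.mk hli hspB
  have hbi : ∀ i, b i = (i : V) := fun i => by simp [b]
  refine ⟨B, b, fun i => by rw [hbi]; exact (hB1 i.2).1, ?_⟩
  have hpos : ∀ x ∈ Pos, ∀ i, 0 ≤ b.repr x i := by
    intro x hx0
    have hx : x ∈ Submodule.span ℝ≥0 (B : Set V) := hB2 hx0
    clear hx0
    induction hx using Submodule.span_induction with
    | mem x hx =>
      intro i
      have : x = b ⟨x, hx⟩ := (hbi ⟨x, hx⟩).symm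
      rw [this, b.repr_self, Finsupp.single_apply]
      split_ifs <;> norm_num
    | zero => simp
    | add x y _ _ hx hy => intro i; simpa using add_nonneg (hx i) (hy i)
    | smul a x _ hx =>
      intro i
      rw [NNReal.smul_def, map_smul]
      exact mul_nonneg a.2 (hx i)
  intro α hα
  rcases lt_or_gt_of_ne (hf _ hα) with hlt | hgt
  · right
    intro i
    have := hpos (-α) ⟨h.neg hα, by rw [map_neg]; linarith⟩ i
    simpa using this
  · left
    exact hpos α ⟨hα, hgt⟩

/-! ### Lattices and determinants -/

lemma lattice_iff {n : ℕ} (D v : Fin n → V) (hD : LinearIndependent ℝ D)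
    (A : Matrix (Fin n) (Fin n) ℤ) (hA : ∀ i, v i = ∑ j, (A i j : ℝ) • D j) :
    IsUnit A.det ↔ ∀ j, D j ∈ AddSubgroup.closure (Set.range v) := by
  have hA' : ∀ i, v i = ∑ j, A i j • D j := by
    intro i; rw [hA]; simp only [Int.cast_smul_eq_zsmul]
  constructor
  · intro hu j
    have hC : A⁻¹ * A = 1 := Matrix.nonsing_inv_mul A hu
    have : D j = ∑ i, A⁻¹ j i • v i := by
      simp only [hA', Finset.smul_sum, smul_smul]
      rw [Finset.sum_comm]
      simp only [← Finset.sum_smul, ← Matrix.mul_apply, hC, Matrix.one_apply]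
      simp
    rw [this]
    exact sum_mem fun i _ => zsmul_mem (AddSubgroup.subset_closure (Set.mem_range_self i)) _
  · intro hm
    simp only [AddSubgroup.mem_closure_range_iff_of_fintype] at hm
    choose C hC using hm
    have : (Matrix.of C) * A = 1 := by
      ext i j
      have h1 : ∑ k, (((Matrix.of C) * A) i k : ℝ) • D k = ∑ k, (((1 : Matrix (Fin n) (Fin n) ℤ) i k : ℤ) : ℝ) • D k := by
        have e := hC i
        simp only [hA', Finset.smul_sum, smul_smul] at e
        rw [Finset.sum_comm] at e
        simp only [← Finset.sum_smul] at e
        simp only [Int.cast_smul_eq_zsmul, Matrix.mul_apply, Matrix.of_apply, Matrix.one_apply]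
        simpa using e.symm
      have h2 : ∑ k, ((((Matrix.of C) * A) i k : ℝ) - (((1 : Matrix (Fin n) (Fin n) ℤ) i k : ℤ) : ℝ)) • D k = 0 := by
        simp only [sub_smul, Finset.sum_sub_distrib, h1, sub_self]
      have h3 := Fintype.linearIndependent_iff.1 hD _ h2 j
      have h4 := sub_eq_zero.1 h3
      exact_mod_cast h4
    have hd := congrArg Matrix.det this
    rw [Matrix.det_mul, Matrix.det_one] at hd
    exact IsUnit.of_mul_eq_one_right _ hd

lemma pairingDet_ne_zero {n : ℕ} (D : Fin n → V) (hD : LinearIndependent ℝ D) :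
    pairingDet D ≠ 0 := by
  have h1 : (Matrix.of fun i j => ⟪D i, coroot (D j)⟫)
      = Matrix.gram ℝ D * Matrix.diagonal (fun j => 2 / ⟪D j, D j⟫) := by
    ext i j
    simp only [Matrix.mul_diagonal, Matrix.of_apply, Matrix.gram_apply, inner_coroot]
    ring
  rw [pairingDet, h1, Matrix.det_mul, Matrix.det_diagonal]
  apply mul_ne_zero
  · exact (Matrix.posDef_gram_of_linearIndependent hD).det_pos.ne'
  · rw [Finset.prod_ne_zero_iff]
    intro i _
    have := inner_self_pos' (hD.ne_zero i)
    positivity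

lemma pairingDet_eq {n : ℕ} (D v : Fin n → V) (A B : Matrix (Fin n) (Fin n) ℤ)
    (hA : ∀ i, v i = ∑ j, (A i j : ℝ) • D j)
    (hB : ∀ i, coroot (v i) = ∑ j, (B i j : ℝ) • coroot (D j)) :
    pairingDet v = (A.det * B.det : ℤ) * pairingDet D := by
  have h1 : (Matrix.of fun i j => ⟪v i, coroot (v j)⟫)
      = (A.map (Int.castRingHom ℝ)) * (Matrix.of fun i j => ⟪D i, coroot (D j)⟫)
        * (B.map (Int.castRingHom ℝ)).transpose := by
    ext i j
    simp only [Matrix.of_apply]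
    rw [hA, hB, inner_sum]
    simp only [Matrix.mul_apply, Matrix.transpose_apply, Matrix.map_apply, Matrix.of_apply]
    apply Finset.sum_congr rfl
    intro k _
    rw [sum_inner, Finset.sum_mul]
    apply Finset.sum_congr rfl
    intro l _
    rw [real_inner_smul_left, real_inner_smul_right]
    simp; ring
  rw [pairingDet, h1, Matrix.det_mul, Matrix.det_mul, Matrix.det_transpose, pairingDet]
  have e1 := (Int.castRingHom ℝ).map_det A
  have e2 := (Int.castRingHom ℝ).map_det B
  simp only [RingHom.mapMatrix_apply] at e1 e2
  rw [← e1, ← e2]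
  rw [Int.cast_mul, eq_intCast, eq_intCast]
  ring

lemma move_mem {n : ℕ} (t : Fin n → (V →ₗ[ℝ] V)ˣ) (x y : Fin n → V)
    (ht : ∀ i v, (t i : V →ₗ[ℝ] V) v = v - ⟪v, y i⟫ • x i) (htt : ∀ i, t i * t i = 1)
    (hxy : ∀ i j, ∃ z : ℤ, ⟪x i, y j⟫ = (z : ℝ)) {w : (V →ₗ[ℝ] V)ˣ}
    (hw : w ∈ Subgroup.closure (Set.range t)) {v : V} (hv : ∀ i, ∃ z : ℤ, ⟪v, y i⟫ = (z : ℝ)) :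
    (w : V →ₗ[ℝ] V) v - v ∈ AddSubgroup.closure (Set.range x) := by
  set L := AddSubgroup.closure (Set.range x) with hL
  have hLP : ∀ v ∈ L, ∀ i, ∃ z : ℤ, ⟪v, y i⟫ = (z : ℝ) := by
    intro v hv i
    induction hv using AddSubgroup.closure_induction with
    | mem v hv => obtain ⟨j, rfl⟩ := hv; exact hxy j i
    | zero => exact ⟨0, by simp⟩
    | add a b _ _ ha hb =>
      obtain ⟨p, hp⟩ := ha
      obtain ⟨q, hq⟩ := hb
      exact ⟨p + q, by rw [inner_add_left, hp, hq]; push_cast; rfl⟩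
    | neg a _ ha =>
      obtain ⟨p, hp⟩ := ha
      exact ⟨-p, by rw [inner_neg_left, hp]; push_cast; rfl⟩
  have hcomp : ∀ a b : (V →ₗ[ℝ] V)ˣ,
      (∀ v, (∀ i, ∃ z : ℤ, ⟪v, y i⟫ = (z : ℝ)) → (a : V →ₗ[ℝ] V) v - v ∈ L) →
      (∀ v, (∀ i, ∃ z : ℤ, ⟪v, y i⟫ = (z : ℝ)) → (b : V →ₗ[ℝ] V) v - v ∈ L) →
      (∀ v, (∀ i, ∃ z : ℤ, ⟪v, y i⟫ = (z : ℝ)) → ((a * b : (V →ₗ[ℝ] V)ˣ) : V →ₗ[ℝ] V) v - v ∈ L) := by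
    intro a b ha hb v hv
    have h1 := hb v hv
    have h2 := ha ((b : V →ₗ[ℝ] V) v) (fun i => by
      obtain ⟨p, hp⟩ := hv i
      obtain ⟨q, hq⟩ := hLP _ h1 i
      rw [inner_sub_left] at hq
      exact ⟨p + q, by push_cast; linarith⟩)
    have := add_mem h2 h1
    rw [sub_add_sub_cancel] at this
    exact this
  have hgen : ∀ i v, (∀ i, ∃ z : ℤ, ⟪v, y i⟫ = (z : ℝ)) → (t i : V →ₗ[ℝ] V) v - v ∈ L := by
    intro i v hv
    obtain ⟨z, hz⟩ := hv i
    rw [ht, hz, Int.cast_smul_eq_zsmul]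
    have : v - z • x i - v = -(z • x i) := by abel
    rw [this]
    exact neg_mem (zsmul_mem (AddSubgroup.subset_closure (Set.mem_range_self i)) _)
  have key : (∀ v, (∀ i, ∃ z : ℤ, ⟪v, y i⟫ = (z : ℝ)) → (w : V →ₗ[ℝ] V) v - v ∈ L) ∧
      (∀ v, (∀ i, ∃ z : ℤ, ⟪v, y i⟫ = (z : ℝ)) →
        ((w⁻¹ : (V →ₗ[ℝ] V)ˣ) : V →ₗ[ℝ] V) v - v ∈ L) := by
    induction hw using Subgroup.closure_induction with
    | mem w hw =>
      obtain ⟨i, rfl⟩ := hw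
      rw [inv_eq_of_mul_eq_one_left (htt i)]
      exact ⟨hgen i, hgen i⟩
    | one => simp
    | mul a b _ _ ha hb =>
      refine ⟨hcomp a b ha.1 hb.1, ?_⟩
      rw [mul_inv_rev]
      exact hcomp _ _ hb.2 ha.2
    | inv a _ ha => rw [inv_inv]; exact ⟨ha.2, ha.1⟩
  exact key.1 v hv

lemma exists_dual [FiniteDimensional ℝ V] {n : ℕ} (D : Fin n → V)
    (hD : LinearIndependent ℝ D) (hn : Module.finrank ℝ V = n) (i : Fin n) :
    ∃ ω : V, ⟪ω, D i⟫ = 1 ∧ ∀ j, ∃ z : ℤ, ⟪ω, D j⟫ = (z : ℝ) := by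
  classical
  let e : Basis (Fin n) ℝ V := basisOfLinearIndependentOfCardEqFinrank' D hD (by simp [hn])
  have he : ∀ j, e j = D j := fun j => by simp [e]
  let ω := (InnerProductSpace.toDual ℝ V).symm (LinearMap.toContinuousLinearMap (e.coord i))
  have hω : ∀ j, ⟪ω, D j⟫ = e.repr (D j) i := by
    intro j
    simp [ω, InnerProductSpace.toDual_symm_apply]
  refine ⟨ω, ?_, fun j => ?_⟩
  · rw [hω, ← he]; simp
  · refine ⟨if j = i then 1 else 0, ?_⟩
    rw [hω, ← he, e.repr_self, Finsupp.single_apply]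
    split_ifs <;> simp

lemma int_comb {n : ℕ} (D : Fin n → V) (ω : V) (hω : ∀ j, ∃ z : ℤ, ⟪ω, D j⟫ = (z : ℝ))
    (a : Fin n → ℤ) : ∃ z : ℤ, ⟪ω, ∑ j, (a j : ℝ) • D j⟫ = (z : ℝ) := by
  choose z hz using hω
  refine ⟨∑ j, a j * z j, ?_⟩
  rw [inner_sum]
  push_cast
  simp only [real_inner_smul_right, hz]

lemma coroot_expand {ι : Type*} [Fintype ι] (b : Basis ι ℝ V) (α : V) :
    coroot α = ∑ i, (b.repr α i * (⟪b i, b i⟫ / ⟪α, α⟫)) • coroot (b i) := by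
  have h1 : coroot α = (2 / ⟪α, α⟫) • ∑ i, b.repr α i • b i := by rw [b.sum_repr]; rfl
  rw [h1, Finset.smul_sum]
  apply Finset.sum_congr rfl
  intro i _
  have := (inner_self_pos' (b.ne_zero i)).ne'
  rw [coroot, smul_smul, smul_smul]
  congr 1
  field_simp

lemma int_closure {n : ℕ} (x : Fin n → V) (l : V →ₗ[ℝ] ℝ) (h : ∀ i, ∃ z : ℤ, l (x i) = z) :
    ∀ v ∈ AddSubgroup.closure (Set.range x), ∃ z : ℤ, l v = z := by
  intro v hv
  induction hv using AddSubgroup.closure_induction with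
  | mem v hv => obtain ⟨j, rfl⟩ := hv; exact h j
  | zero => exact ⟨0, by simp⟩
  | add a b _ _ ha hb =>
    obtain ⟨p, hp⟩ := ha
    obtain ⟨q, hq⟩ := hb
    exact ⟨p + q, by rw [map_add, hp, hq]; push_cast; rfl⟩
  | neg a _ ha =>
    obtain ⟨p, hp⟩ := ha
    exact ⟨-p, by rw [map_neg, hp]; push_cast; rfl⟩

lemma comb_mem {n : ℕ} {D : Fin n → V} {L : AddSubgroup V} (h : ∀ j, D j ∈ L)
    {c : Fin n → ℝ} (hc : ∀ j, ∃ z : ℤ, c j = z) : ∑ j, c j • D j ∈ L := by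
  apply sum_mem
  intro j _
  obtain ⟨z, hz⟩ := hc j
  rw [hz, Int.cast_smul_eq_zsmul]
  exact zsmul_mem (h j) _

lemma coroot_linearIndependent {n : ℕ} {D : Fin n → V} (hD : LinearIndependent ℝ D) :
    LinearIndependent ℝ (fun i => coroot (D i)) := by
  rw [Fintype.linearIndependent_iff] at hD ⊢
  have hne : ∀ i, D i ≠ 0 := (Fintype.linearIndependent_iff.2 hD).ne_zero
  intro g hg i
  have := hD (fun i => g i * (2 / ⟪D i, D i⟫)) (by
    rw [← hg]
    apply Finset.sum_congr rfl
    intro j _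
    rw [coroot, smul_smul]) i
  have h1 := inner_self_pos' (hne i)
  have h2 : (2 / ⟪D i, D i⟫) ≠ 0 := by positivity
  exact (mul_eq_zero.1 this).resolve_right h2

/-- If the subgroup of reflections has full root and coroot lattice then it contains all
reflections. -/
lemma subsystem_eq {n : ℕ} {Φ : Set V} (h : RS Φ) (D : Basis (Fin n) ℝ V) (hD : IsB Φ D)
    (t : Fin n → (V →ₗ[ℝ] V)ˣ) (ρ : Fin n → V)
    (hρ : ∀ i, ρ i ∈ Φ) (ht : ∀ i, (t i : V →ₗ[ℝ] V) = reflLM (ρ i))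
    (h1 : ∀ j, D j ∈ AddSubgroup.closure (Set.range ρ))
    (h2 : ∀ j, coroot (D j) ∈ AddSubgroup.closure (Set.range fun i => coroot (ρ i))) :
    ∀ α ∈ Φ, ∃ w ∈ Subgroup.closure (Set.range t), (w : V →ₗ[ℝ] V) = reflLM α := by
  classical
  set W := Subgroup.closure (Set.range t) with hW
  let Ψ : Set V := {α | α ∈ Φ ∧ ∃ w ∈ W, (w : V →ₗ[ℝ] V) = reflLM α}
  have hΨΦ : ∀ α ∈ Ψ, α ∈ Φ := fun α hα => hα.1
  have hρΨ : ∀ i, ρ i ∈ Ψ := fun i =>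
    ⟨hρ i, t i, Subgroup.subset_closure (Set.mem_range_self i), ht i⟩
  have hΨ : RS Ψ := by
    refine ⟨h.fin.subset hΨΦ, fun α hα => h.ne0 α hα.1, fun α hα c hc => h.red α hα.1 c hc.1,
      fun α hα β hβ => h.crys α hα.1 β hβ.1, ?_⟩
    rintro α ⟨hα, w, hw, hwα⟩ β ⟨hβ, u, hu, huβ⟩
    refine ⟨h.inv α hα β hβ, w * u * w, mul_mem (mul_mem hw hu) hw, ?_⟩
    ext v
    rw [reflLM_reflLM (h.ne0 α hα), ← hwα, ← huβ]
    rfl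
  have hsp : Submodule.span ℝ Ψ = ⊤ := by
    rw [eq_top_iff, ← D.span_eq, Submodule.span_le]
    rintro _ ⟨j, rfl⟩
    have hle : AddSubgroup.closure (Set.range ρ) ≤ (Submodule.span ℝ Ψ).toAddSubgroup := by
      rw [AddSubgroup.closure_le]
      rintro _ ⟨i, rfl⟩
      exact Submodule.subset_span (hρΨ i)
    exact hle (h1 j)
  let f : V →ₗ[ℝ] ℝ := ∑ i, D.coord i
  have hf : ∀ α ∈ Ψ, f α ≠ 0 := by
    intro α hα hz
    have hz' : ∑ i, D.repr α i = 0 := by simpa [f] using hz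
    apply h.ne0 α hα.1
    have hall : ∀ i, D.repr α i = 0 := by
      rcases hD.sgn α hα.1 with hs | hs
      · intro i
        exact (Finset.sum_eq_zero_iff_of_nonneg (fun i _ => hs i)).1 hz' i (Finset.mem_univ _)
      · intro i
        exact (Finset.sum_eq_zero_iff_of_nonpos (fun i _ => hs i)).1 hz' i (Finset.mem_univ _)
    rw [← D.sum_repr α]
    simp [hall]
  obtain ⟨B, b, hb⟩ := exists_base hΨ hsp f hf
  have hb0 : ∀ i, b i ≠ 0 := fun i => b.ne_zero i
  have hbΦ : IsB Φ b := by
    refine ⟨fun i => (hb.mem i).1, ?_⟩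
    intro α hα
    apply sgn_of_int b (fun i j => h.crys _ (hb.mem i).1 _ (hb.mem j).1)
      (fun i j hij => base_obtuse hΨ hb hij) (h.ne0 α hα)
    · intro i
      have hm : α ∈ AddSubgroup.closure (Set.range ρ) := by
        rw [← D.sum_repr α]
        exact comb_mem h1 (base_int h hD α hα)
      exact int_closure ρ (b.coord i) (fun j => base_int hΨ hb _ (hρΨ j) i) α hm
    · intro i
      have hm : coroot α ∈ AddSubgroup.closure (Set.range fun i => coroot (ρ i)) := by
        rw [coroot_expand D α]
        exact comb_mem h2 (base_int' h hD α hα)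
      have hl : ∀ γ : V, ((⟪b i, b i⟫ / 2) • b.coord i) (coroot γ)
          = b.repr γ i * (⟪b i, b i⟫ / ⟪γ, γ⟫) := by
        intro γ
        rw [coroot]
        simp only [LinearMap.smul_apply, map_smul, smul_eq_mul, Basis.coord_apply]
        ring
      have := int_closure (fun i => coroot (ρ i)) ((⟪b i, b i⟫ / 2) • b.coord i)
        (fun j => by rw [hl]; exact base_int' hΨ hb _ (hρΨ j) i) _ hm
      rwa [hl] at this
  have hall : ∀ α ∈ Φ, α ∈ Ψ := by
    apply base_induction h hbΦ
    · exact hb.mem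
    · intro α _ i hα
      exact hΨ.inv _ (hb.mem i) _ hα
  exact fun α hα => (hall α hα).2

end WRoot

open WRoot in
/-- for the Weyl group `W` of a reduced crystallographic root system `Φ`
of rank `n`, a set `{t_1, …, t_n}` of `n` reflections of `W` generates `W` if and only
if `det (⟪ρ_{t_i}, ρ̌_{t_j}⟫) = I(W)`, where `ρ_{t_i}` is a root associated to `t_i`
and `I(W)` is the determinant of the Cartan matrix of a system of simple roots. -/
theorem good_generating_set_iff_pairingDet_eq_connectionIndex
    {V : Type*} [NormedAddCommGroup V] [InnerProductSpace ℝ V]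
    [FiniteDimensional ℝ V] {n : ℕ} (hdim : Module.finrank ℝ V = n)
    (Φ : Finset V) (h0 : (0 : V) ∉ Φ)
    (hspan : Submodule.span ℝ (Φ : Set V) = ⊤)
    (hred : ∀ α ∈ Φ, ∀ c : ℝ, c • α ∈ Φ → c = 1 ∨ c = -1)
    (hcrys : ∀ α ∈ Φ, ∀ β ∈ Φ, ∃ z : ℤ, ⟪α, coroot β⟫ = (z : ℝ))
    (hinv : ∀ α ∈ Φ, ∀ β ∈ Φ, reflLM α β ∈ Φ)
    -- a system of simple roots for `Φ`
    (Δ : Fin n → V) (hΔ : ∀ i, Δ i ∈ Φ)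
    (hbase : ∀ α ∈ Φ, ∃ c : Fin n → ℤ,
        α = ∑ i, (c i : ℝ) • Δ i ∧ ((∀ i, 0 ≤ c i) ∨ (∀ i, c i ≤ 0)))
    -- a set of `n` reflections of `W`, with a choice of associated roots
    (t : Fin n → (V →ₗ[ℝ] V)ˣ) (ρ : Fin n → V)
    (hρ : ∀ i, ρ i ∈ Φ) (ht : ∀ i, (t i : V →ₗ[ℝ] V) = reflLM (ρ i)) :
    Subgroup.closure (Set.range t) = weylGroup Φ ↔
      pairingDet ρ = pairingDet Δ := by
  classical
  have hRS : RS (Φ : Set V) := ⟨Φ.finite_toSet, fun α hα h => h0 (h ▸ hα), hred, hcrys, hinv⟩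
  have hsp : ⊤ ≤ Submodule.span ℝ (Set.range Δ) := by
    rw [← hspan, Submodule.span_le]
    intro α hα
    obtain ⟨c, hc, -⟩ := hbase α hα
    rw [hc]
    exact sum_mem fun i _ => Submodule.smul_mem _ _ (Submodule.subset_span (Set.mem_range_self i))
  let D : Basis (Fin n) ℝ V := basisOfTopLeSpanOfCardEqFinrank Δ hsp (by simp [hdim])
  have hDi : ∀ i, D i = Δ i := fun i => by simp [D]
  have hli : LinearIndependent ℝ Δ := by
    have : (D : Fin n → V) = Δ := funext hDi
    rw [← this]; exact D.linearIndependent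
  have hD : IsB (Φ : Set V) D := by
    refine ⟨fun i => by rw [hDi]; exact hΔ i, ?_⟩
    intro α hα
    obtain ⟨c, hc, hs⟩ := hbase α hα
    have hr : ∀ i, D.repr α i = c i := by
      intro i
      simp only [← hDi] at hc
      rw [hc, D.repr_sum_self]
    simp only [hr]
    exact_mod_cast hs
  have hρ0 : ∀ i, ρ i ≠ 0 := fun i => hRS.ne0 _ (hρ i)
  have hΔ0 : ∀ i, Δ i ≠ 0 := fun i => hRS.ne0 _ (hΔ i)
  choose A hA using fun i => base_int hRS hD _ (hρ i)
  choose B hB using fun i => base_int' hRS hD _ (hρ i)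
  have hA' : ∀ i, ρ i = ∑ j, ((Matrix.of A) i j : ℝ) • Δ j := by
    intro i
    conv_lhs => rw [← D.sum_repr (ρ i)]
    simp only [hA, hDi, Matrix.of_apply]
  have hB' : ∀ i, coroot (ρ i) = ∑ j, ((Matrix.of B) i j : ℝ) • coroot (Δ j) := by
    intro i
    rw [coroot_expand D]
    simp only [hB, Matrix.of_apply]
    simp only [hDi]
  have hdet := pairingDet_eq Δ ρ (Matrix.of A) (Matrix.of B) hA' hB'
  have hiff : pairingDet ρ = pairingDet Δ ↔ (Matrix.of A).det * (Matrix.of B).det = 1 := by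
    rw [hdet]
    constructor
    · intro h
      have := mul_right_cancel₀ (pairingDet_ne_zero Δ hli) (h.trans (one_mul _).symm)
      exact_mod_cast this
    · intro h
      rw [h]; simp
  have hnonneg : 0 ≤ (Matrix.of A).det * (Matrix.of B).det := by
    have hm : (Matrix.of B).map (Int.castRingHom ℝ) =
        Matrix.diagonal (fun i => ⟪ρ i, ρ i⟫⁻¹) * (Matrix.of A).map (Int.castRingHom ℝ)
          * Matrix.diagonal (fun i => ⟪Δ i, Δ i⟫) := by
      ext i j
      simp only [Matrix.mul_diagonal, Matrix.diagonal_mul, Matrix.map_apply, Matrix.of_apply,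
        eq_intCast, ← hB, ← hA, hDi]
      ring
    have hd := congrArg Matrix.det hm
    rw [Matrix.det_mul, Matrix.det_mul, Matrix.det_diagonal, Matrix.det_diagonal] at hd
    have e1 := (Int.castRingHom ℝ).map_det (Matrix.of A)
    have e2 := (Int.castRingHom ℝ).map_det (Matrix.of B)
    simp only [RingHom.mapMatrix_apply] at e1 e2
    rw [← e1, ← e2, eq_intCast, eq_intCast] at hd
    have p1 : 0 ≤ ∏ i, ⟪ρ i, ρ i⟫⁻¹ :=
      Finset.prod_nonneg fun i _ => inv_nonneg.2 real_inner_self_nonneg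
    have p2 : 0 ≤ ∏ i, ⟪Δ i, Δ i⟫ := Finset.prod_nonneg fun i _ => real_inner_self_nonneg
    have : (0 : ℝ) ≤ ((Matrix.of A).det : ℝ) * ((Matrix.of B).det : ℝ) := by
      rw [hd]
      have := mul_nonneg (mul_nonneg p1 p2) (mul_self_nonneg ((Matrix.of A).det : ℝ))
      nlinarith
    exact_mod_cast this
  have hcl := coroot_linearIndependent hli
  have hLA := lattice_iff Δ ρ hli (Matrix.of A) hA'
  have hLB := lattice_iff (fun i => coroot (Δ i)) (fun i => coroot (ρ i)) hcl (Matrix.of B) hB'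
  rw [hiff]
  constructor
  · intro hgen
    have htt : ∀ i, t i * t i = 1 := by
      intro i
      ext v
      simp only [Units.val_mul, ht, Units.val_one]
      exact reflLM_invol (hρ0 i) v
    have hmem : ∀ j, reflU (Δ j) (hΔ0 j) ∈ Subgroup.closure (Set.range t) := by
      intro j
      rw [hgen]
      exact Subgroup.subset_closure ⟨Δ j, hΔ j, rfl⟩
    have hUA : IsUnit (Matrix.of A).det := by
      rw [hLA]
      intro j
      obtain ⟨ω, hω1, hω⟩ := exists_dual _ hcl hdim j
      have := move_mem t ρ (fun i => coroot (ρ i)) (fun i v => by rw [ht]; rfl) htt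
        (fun i k => hcrys _ (hρ i) _ (hρ k)) (hmem j) (v := ω)
        (fun i => by rw [hB']; exact int_comb _ ω hω _)
      change reflLM (Δ j) ω - ω ∈ _ at this
      rw [reflLM_apply, hω1, one_smul, sub_sub_cancel_left] at this
      exact neg_mem_iff.1 this
    have hUB : IsUnit (Matrix.of B).det := by
      rw [hLB]
      intro j
      obtain ⟨ω, hω1, hω⟩ := exists_dual _ hli hdim j
      have := move_mem t (fun i => coroot (ρ i)) ρ (fun i v => by rw [ht, reflLM_apply']) htt
        (fun i k => by rw [real_inner_comm]; exact hcrys _ (hρ k) _ (hρ i)) (hmem j) (v := ω)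
        (fun i => by rw [hA']; exact int_comb _ ω hω _)
      change reflLM (Δ j) ω - ω ∈ _ at this
      rw [reflLM_apply', hω1, one_smul, sub_sub_cancel_left] at this
      exact neg_mem_iff.1 this
    rcases Int.isUnit_iff.1 (hUA.mul hUB) with h | h
    · exact h
    · omega
  · intro h1
    have hUA : IsUnit (Matrix.of A).det := IsUnit.of_mul_eq_one _ h1
    have hUB : IsUnit (Matrix.of B).det := IsUnit.of_mul_eq_one_right _ h1
    have hsub := subsystem_eq hRS D hD t ρ hρ ht
      (fun j => by rw [hDi]; exact hLA.1 hUA j) (fun j => by rw [hDi]; exact hLB.1 hUB j)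
    apply le_antisymm
    · rw [Subgroup.closure_le]
      rintro _ ⟨i, rfl⟩
      exact Subgroup.subset_closure ⟨ρ i, hρ i, ht i⟩
    · rw [weylGroup, Subgroup.closure_le]
      rintro w ⟨α, hα, hw⟩
      obtain ⟨u, hu, hu'⟩ := hsub α hα
      have : w = u := Units.ext (hw.trans hu'.symm)
      rw [this]; exact hu
end

section
/- Let W ≤ GL(V) be the Weyl group of a reduced crystallographic root system Φ spanning the n-dimensional space V, and let g ∈ W. The following are equivalent: (i) g is a quasi-Coxeter element, i.e., g admits a factorization g = t_1⋯t_n into n reflections whose factors generate W and n = ℓ_R(g); (ii) there exists a reduced reflection factorization g = t_1⋯t_k such that the associated roots ρ_{t_1}, …, ρ_{t_k} form a ℤ-basis of the root lattice Q and the associated coroots ρ̌_{t_1}, …, ρ̌_{t_k} form a ℤ-basis of the coroot lattice Q̌; (iii) |det(g − I_V)| = I(W), where I_V is the identity on V; (iv) g does not belong to any proper reflection subgroup of W. -/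
open Module
open scoped RealInnerProductSpace

namespace WRoot

variable {V : Type*} [NormedAddCommGroup V] [InnerProductSpace ℝ V]

/-- Reflection length with respect to the reflections `s_α`, `α ∈ Φ`. -/
noncomputable def rLen (Φ : Finset V) (g : (V →ₗ[ℝ] V)ˣ) : ℕ :=
  sInf {k | ∃ l : List (V →ₗ[ℝ] V)ˣ,
    (∀ x ∈ l, x ∈ reflSet Φ) ∧ l.prod = g ∧ l.length = k}

end WRoot

namespace QCox

open WRoot

variable {V : Type*} [NormedAddCommGroup V] [InnerProductSpace ℝ V]

/-! ### Basic facts about reflections -/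

lemma reflLM_apply (α v : V) : reflLM α v = v - ⟪v, coroot α⟫ • α := rfl

lemma inner_coroot (v α : V) : ⟪v, coroot α⟫ = 2 * ⟪v, α⟫ / ⟪α, α⟫ := by
  simp only [coroot, real_inner_smul_right]; ring

lemma inner_self_pos {α : V} (h : α ≠ 0) : 0 < ⟪α, α⟫ := real_inner_self_pos.mpr h

lemma inner_coroot_self {α : V} (h : α ≠ 0) : ⟪α, coroot α⟫ = 2 := by
  rw [inner_coroot]; have := inner_self_pos h; field_simp

lemma reflLM_self (α : V) : reflLM α α = -α := by
  by_cases h : α = 0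
  · subst h; simp [reflLM_apply]
  · rw [reflLM_apply, inner_coroot_self h, two_smul]; abel

lemma reflLM_inner (α x y : V) : ⟪reflLM α x, reflLM α y⟫ = ⟪x, y⟫ := by
  by_cases h : α = 0
  · subst h; simp [reflLM_apply]
  · simp only [reflLM_apply, inner_sub_left, inner_sub_right, real_inner_smul_left,
      real_inner_smul_right, inner_coroot, real_inner_comm α]
    have := inner_self_pos h
    field_simp
    rw [real_inner_comm y α]
    ring

lemma reflLM_reflLM (α v : V) : reflLM α (reflLM α v) = v := by
  conv_lhs => rw [reflLM_apply α v]
  rw [map_sub, map_smul, reflLM_self, reflLM_apply α v, smul_neg]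
  abel

/-- The reflection as a unit. -/
noncomputable def rU (α : V) : (V →ₗ[ℝ] V)ˣ where
  val := reflLM α
  inv := reflLM α
  val_inv := by ext v; exact reflLM_reflLM α v
  inv_val := by ext v; exact reflLM_reflLM α v

@[simp] lemma rU_val (α : V) : ((rU α : (V →ₗ[ℝ] V)ˣ) : V →ₗ[ℝ] V) = reflLM α := rfl

lemma rU_inv (α : V) : (rU α)⁻¹ = rU α := by ext v; rfl

lemma rU_mul_self (α : V) : rU α * rU α = 1 := by
  ext v; exact reflLM_reflLM α v

lemma mem_reflSet {Φ : Finset V} {w : (V →ₗ[ℝ] V)ˣ} :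
    w ∈ reflSet Φ ↔ ∃ α ∈ Φ, w = rU α := by
  constructor
  · rintro ⟨α, h, e⟩; exact ⟨α, h, Units.ext e⟩
  · rintro ⟨α, h, e⟩; exact ⟨α, h, by rw [e]; rfl⟩

lemma rU_mem_weyl {Φ : Finset V} {α : V} (h : α ∈ Φ) : rU α ∈ weylGroup Φ :=
  Subgroup.subset_closure (mem_reflSet.mpr ⟨α, h, rfl⟩)

/-- isometries -/
def Isom (w : (V →ₗ[ℝ] V)ˣ) : Prop := ∀ x y : V, ⟪(w : V →ₗ[ℝ] V) x, (w : V →ₗ[ℝ] V) y⟫ = ⟪x, y⟫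

lemma mul_app (a b : (V →ₗ[ℝ] V)ˣ) (v : V) :
    ((a * b : (V →ₗ[ℝ] V)ˣ) : V →ₗ[ℝ] V) v = (a : V →ₗ[ℝ] V) ((b : V →ₗ[ℝ] V) v) := rfl

lemma inv_app (a : (V →ₗ[ℝ] V)ˣ) (v : V) :
    ((a⁻¹ : (V →ₗ[ℝ] V)ˣ) : V →ₗ[ℝ] V) ((a : V →ₗ[ℝ] V) v) = v := by
  rw [← mul_app, inv_mul_cancel]; rfl

lemma app_inv (a : (V →ₗ[ℝ] V)ˣ) (v : V) :
    (a : V →ₗ[ℝ] V) (((a⁻¹ : (V →ₗ[ℝ] V)ˣ) : V →ₗ[ℝ] V) v) = v := by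
  rw [← mul_app, mul_inv_cancel]; rfl

lemma one_app (v : V) : ((1 : (V →ₗ[ℝ] V)ˣ) : V →ₗ[ℝ] V) v = v := rfl

/-- the group of isometries -/
def isomGroup (V : Type*) [NormedAddCommGroup V] [InnerProductSpace ℝ V] :
    Subgroup (V →ₗ[ℝ] V)ˣ where
  carrier := {w | Isom w}
  mul_mem' := by
    intro a b ha hb x y
    rw [mul_app, mul_app, ha, hb]
  one_mem' := fun x y => rfl
  inv_mem' := by
    intro a ha x y
    rw [← ha, app_inv, app_inv]

lemma weyl_isom {Φ : Finset V} {w : (V →ₗ[ℝ] V)ˣ} (h : w ∈ weylGroup Φ) : Isom w := by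
  have : weylGroup Φ ≤ isomGroup V := by
    rw [weylGroup, Subgroup.closure_le]
    rintro w hw
    obtain ⟨α, -, rfl⟩ := mem_reflSet.mp hw
    exact reflLM_inner α
  exact this h

lemma coroot_map {w : (V →ₗ[ℝ] V)ˣ} (h : Isom w) (α : V) :
    coroot ((w : V →ₗ[ℝ] V) α) = (w : V →ₗ[ℝ] V) (coroot α) := by
  simp only [coroot, h α α, map_smul]

lemma rU_conj {w : (V →ₗ[ℝ] V)ˣ} (h : Isom w) (α : V) :
    rU ((w : V →ₗ[ℝ] V) α) = w * rU α * w⁻¹ := by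
  rw [eq_mul_inv_iff_mul_eq]
  ext v
  rw [mul_app, mul_app, rU_val, rU_val, reflLM_apply, reflLM_apply, coroot_map h, h, map_sub,
    map_smul]

/-- Root systems, not necessarily spanning. -/
structure RS (Φ : Finset V) : Prop where
  h0 : (0 : V) ∉ Φ
  hred : ∀ α ∈ Φ, ∀ c : ℝ, c • α ∈ Φ → c = 1 ∨ c = -1
  hcrys : ∀ α ∈ Φ, ∀ β ∈ Φ, ∃ z : ℤ, ⟪α, coroot β⟫ = (z : ℝ)
  hinv : ∀ α ∈ Φ, ∀ β ∈ Φ, reflLM α β ∈ Φ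

lemma RS.ne_zero {Φ : Finset V} (R : RS Φ) {α : V} (h : α ∈ Φ) : α ≠ 0 := by
  rintro rfl; exact R.h0 h

lemma RS.neg_mem {Φ : Finset V} (R : RS Φ) {α : V} (h : α ∈ Φ) : -α ∈ Φ := by
  rw [← reflLM_self]; exact R.hinv α h α h

lemma RS.weyl_mem {Φ : Finset V} (R : RS Φ) {w : (V →ₗ[ℝ] V)ˣ} (hw : w ∈ weylGroup Φ) :
    ∀ α ∈ Φ, (w : V →ₗ[ℝ] V) α ∈ Φ := by
  unfold weylGroup at hw
  induction hw using Subgroup.closure_induction'' with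
  | mem w hw => obtain ⟨α, h, rfl⟩ := mem_reflSet.mp hw; exact fun β hβ => R.hinv α h β hβ
  | inv_mem w hw =>
    obtain ⟨α, h, rfl⟩ := mem_reflSet.mp hw; rw [rU_inv]; exact fun β hβ => R.hinv α h β hβ
  | one => exact fun α h => h
  | mul a b _ _ ha hb => intro α h; rw [mul_app]; exact ha _ (hb _ h)

lemma rU_neg (α : V) : rU (-α) = rU α := by
  ext v
  simp only [rU_val, reflLM_apply, inner_coroot, inner_neg_right, inner_neg_left, neg_neg, smul_neg,
    ← neg_smul]
  congr 2; ring

lemma pair_big {α β : V} (ha : α ≠ 0) (hb : β ≠ 0) (hc : 2 ≤ ⟪α, coroot β⟫)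
    (hd : 2 ≤ ⟪β, coroot α⟫) : α = β := by
  rw [inner_coroot] at hc hd
  have h1 := inner_self_pos ha
  have h2 := inner_self_pos hb
  rw [le_div_iff₀ (by assumption)] at hc hd
  rw [real_inner_comm α β] at hd
  have : ⟪α - β, α - β⟫ ≤ 0 := by
    rw [real_inner_sub_sub_self]; linarith
  rw [← sub_eq_zero]
  exact real_inner_self_nonpos.mp this

lemma RS.sub_mem {Φ : Finset V} (R : RS Φ) {α β : V} (ha : α ∈ Φ) (hb : β ∈ Φ) (hne : α ≠ β)
    (hp : 0 < ⟪α, β⟫) : α - β ∈ Φ := by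
  obtain ⟨c, hc⟩ := R.hcrys α ha β hb
  obtain ⟨d, hd⟩ := R.hcrys β hb α ha
  have h1 := inner_self_pos (R.ne_zero ha)
  have h2 := inner_self_pos (R.ne_zero hb)
  have hc0 : (0 : ℝ) < c := by rw [← hc, inner_coroot]; positivity
  have hd0 : (0 : ℝ) < d := by rw [← hd, inner_coroot, real_inner_comm]; positivity
  have hc0' : 0 < c := by exact_mod_cast hc0
  have hd0' : 0 < d := by exact_mod_cast hd0
  by_cases hc1 : c = 1
  · have := R.hinv β hb α ha
    rwa [reflLM_apply, hc, hc1, Int.cast_one, one_smul] at this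
  by_cases hd1 : d = 1
  · have := R.neg_mem (R.hinv α ha β hb)
    rwa [reflLM_apply, hd, hd1, Int.cast_one, one_smul, neg_sub] at this
  exact absurd (pair_big (R.ne_zero ha) (R.ne_zero hb)
    (by rw [hc]; exact_mod_cast (by omega : 2 ≤ c)) (by rw [hd]; exact_mod_cast (by omega : 2 ≤ d))) hne

lemma generic (F : Submodule ℝ V) (A : Finset V) (h : ∀ α ∈ A, ∃ f ∈ F, ⟪f, α⟫ ≠ 0) :
    ∃ v ∈ F, ∀ α ∈ A, ⟪v, α⟫ ≠ 0 := by
  have := Module.Dual.exists_forall_mem_ne_zero_of_forall_exists (K := ℝ) F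
    (fun a : A => (innerₗ V (a : V))) ?_
  · obtain ⟨v, hv, h2⟩ := this
    refine ⟨v, hv, fun α ha => ?_⟩
    have := h2 ⟨α, ha⟩
    rwa [innerₗ_apply_apply, real_inner_comm] at this
  · rintro ⟨a, ha⟩
    obtain ⟨f, hf, h⟩ := h a ha
    exact ⟨f, hf, by rwa [innerₗ_apply_apply, real_inner_comm]⟩

/-! ### Bases -/

structure IsBase (Φ Δ : Finset V) (x : V) : Prop where
  sub : Δ ⊆ Φ
  pos : ∀ δ ∈ Δ, 0 < ⟪x, δ⟫
  reg : ∀ α ∈ Φ, ⟪x, α⟫ ≠ 0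
  gen : ∀ α ∈ Φ, 0 < ⟪x, α⟫ → ∃ n : V → ℕ, α = ∑ δ ∈ Δ, (n δ : ℝ) • δ
  obt : ∀ δ ∈ Δ, ∀ δ' ∈ Δ, δ ≠ δ' → ⟪δ, δ'⟫ ≤ 0

lemma exists_base {Φ : Finset V} (R : RS Φ) {x : V} (reg : ∀ α ∈ Φ, ⟪x, α⟫ ≠ 0) :
    ∃ Δ, IsBase Φ Δ x := by
  classical
  set D : Finset V := Φ.filter (fun α => 0 < ⟪x, α⟫ ∧ ¬ ∃ β ∈ Φ, ∃ γ ∈ Φ,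
    0 < ⟪x, β⟫ ∧ 0 < ⟪x, γ⟫ ∧ α = β + γ) with hD
  refine ⟨D, ⟨Finset.filter_subset _ _, fun δ h => (Finset.mem_filter.mp h).2.1, reg, ?_, ?_⟩⟩
  · by_contra hcon
    push Not at hcon
    obtain ⟨α, ha, hpos, hn⟩ := hcon
    set B := Φ.filter (fun α => 0 < ⟪x, α⟫ ∧ ∀ n : V → ℕ, α ≠ ∑ δ ∈ D, (n δ : ℝ) • δ) with hB
    obtain ⟨β, hβ, hmin⟩ := Finset.exists_min_image B (fun α => ⟪x, α⟫)
      ⟨α, Finset.mem_filter.mpr ⟨ha, hpos, hn⟩⟩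
    obtain ⟨hβΦ, hβp, hβn⟩ := Finset.mem_filter.mp hβ
    by_cases hβD : β ∈ D
    · refine hβn (fun v => if v = β then 1 else 0) ?_
      rw [Finset.sum_eq_single β]
      · simp
      · intro b _ hb; simp [hb]
      · intro h; exact absurd hβD h
    · have : ∃ β' ∈ Φ, ∃ γ ∈ Φ, 0 < ⟪x, β'⟫ ∧ 0 < ⟪x, γ⟫ ∧ β = β' + γ := by
        by_contra h
        exact hβD (Finset.mem_filter.mpr ⟨hβΦ, hβp, h⟩)
      obtain ⟨b, hb, c, hc, hbp, hcp, e⟩ := this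
      have key : ∀ d ∈ Φ, 0 < ⟪x, d⟫ → ⟪x, d⟫ < ⟪x, β⟫ → ∃ n : V → ℕ, d = ∑ δ ∈ D, (n δ : ℝ) • δ := by
        intro d hd hdp hlt
        by_contra h
        push Not at h
        exact absurd (hmin d (Finset.mem_filter.mpr ⟨hd, hdp, h⟩)) (not_le.mpr hlt)
      have he : ⟪x, β⟫ = ⟪x, b⟫ + ⟪x, c⟫ := by rw [e, inner_add_right]
      obtain ⟨n1, h1⟩ := key b hb hbp (by linarith)
      obtain ⟨n2, h2⟩ := key c hc hcp (by linarith)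
      refine hβn (fun v => n1 v + n2 v) ?_
      simp only [Nat.cast_add, add_smul, Finset.sum_add_distrib]
      rw [← h1, ← h2, e]
  · intro δ h δ' h' hne
    obtain ⟨h1, h2, h3⟩ := Finset.mem_filter.mp h
    obtain ⟨h1', h2', h3'⟩ := Finset.mem_filter.mp h'
    by_contra hcon
    push Not at hcon
    have hm := R.sub_mem h1 h1' hne hcon
    rcases lt_or_gt_of_ne (reg _ hm) with hl | hg
    · refine h3' ⟨δ, h1, -(δ - δ'), R.neg_mem hm, h2, ?_, by abel⟩
      rw [inner_neg_right]; linarith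
    · exact h3 ⟨δ', h1', δ - δ', hm, h2', hg, by abel⟩

lemma dom_nonneg {D : Finset V} {x : V} (pos : ∀ δ ∈ D, 0 < ⟪x, δ⟫)
    (obt : ∀ δ ∈ D, ∀ δ' ∈ D, δ ≠ δ' → ⟪δ, δ'⟫ ≤ 0) (c : V → ℝ)
    (hdom : ∀ δ ∈ D, 0 ≤ ⟪∑ d ∈ D, c d • d, δ⟫) : ∀ δ ∈ D, 0 ≤ c δ := by
  set y := ∑ d ∈ D, (max (-c d) 0) • d with hy
  set p := ∑ d ∈ D, (max (c d) 0) • d with hp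
  have hz : ∑ d ∈ D, c d • d = p - y := by
    rw [hp, hy, ← Finset.sum_sub_distrib]
    refine Finset.sum_congr rfl fun d _ => ?_
    rw [← sub_smul]
    congr 1
    rcases le_total (c d) 0 with h | h
    · rw [max_eq_right h, max_eq_left (by linarith)]; ring
    · rw [max_eq_left h, max_eq_right (by linarith)]; ring
  have h1 : 0 ≤ ⟪∑ d ∈ D, c d • d, y⟫ := by
    rw [hy, inner_sum]
    refine Finset.sum_nonneg fun d hd => ?_
    rw [real_inner_smul_right]
    exact mul_nonneg (le_max_right _ _) (hdom d hd)
  have h2 : ⟪p, y⟫ ≤ 0 := by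
    rw [hp, hy, sum_inner]
    refine Finset.sum_nonpos fun d hd => ?_
    rw [inner_sum]
    refine Finset.sum_nonpos fun d' hd' => ?_
    rw [real_inner_smul_left, real_inner_smul_right]
    by_cases hne : d = d'
    · subst hne
      rcases le_total (c d) 0 with h | h
      · rw [max_eq_right h]; simp
      · rw [max_eq_right (show -c d ≤ 0 by linarith)]; simp
    · exact mul_nonpos_of_nonneg_of_nonpos (le_max_right _ _)
        (mul_nonpos_of_nonneg_of_nonpos (le_max_right _ _) (obt d hd d' hd' hne))
  rw [hz, inner_sub_left] at h1
  have hy0 : y = 0 := real_inner_self_nonpos.mp (by linarith)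
  have h3 : ∑ d ∈ D, max (-c d) 0 * ⟪x, d⟫ = 0 := by
    have : ⟪x, y⟫ = 0 := by rw [hy0, inner_zero_right]
    rw [hy, inner_sum] at this
    simpa only [real_inner_smul_right] using this
  intro δ hδ
  have h4 := (Finset.sum_eq_zero_iff_of_nonneg (fun d hd =>
    mul_nonneg (le_max_right _ _) (pos d hd).le)).mp h3 δ hδ
  rcases mul_eq_zero.mp h4 with h | h
  · have := le_max_left (-c δ) 0
    linarith
  · exact absurd h (pos δ hδ).ne'

lemma IsBase.indep {Φ D : Finset V} {x : V} (B : IsBase Φ D x) (c c' : V → ℝ)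
    (h : ∑ d ∈ D, c d • d = ∑ d ∈ D, c' d • d) : ∀ δ ∈ D, c δ = c' δ := by
  have h1 : ∀ (a b : V → ℝ), ∑ d ∈ D, a d • d = ∑ d ∈ D, b d • d → ∀ δ ∈ D, b δ ≤ a δ := by
    intro a b hab δ hδ
    have := dom_nonneg B.pos B.obt (fun d => a d - b d) (by
      intro δ _
      simp only [sub_smul, Finset.sum_sub_distrib, hab, sub_self, inner_zero_left, le_refl]) δ hδ
    linarith
  intro δ hδ
  exact le_antisymm (h1 c' c h.symm δ hδ) (h1 c c' h δ hδ)


lemma IsBase.refl_pos {Φ D : Finset V} {x : V} (R : RS Φ) (B : IsBase Φ D x) {δ β : V}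
    (hδ : δ ∈ D) (hβ : β ∈ Φ) (hp : 0 < ⟪x, β⟫) (hne : β ≠ δ) : 0 < ⟪x, reflLM δ β⟫ := by
  classical
  have hm := R.hinv δ (B.sub hδ) β hβ
  rcases lt_or_gt_of_ne (B.reg _ hm) with hl | hg
  · exfalso
    obtain ⟨n, hn⟩ := B.gen β hβ hp
    obtain ⟨m, hm'⟩ := B.gen _ (R.neg_mem hm) (by rw [inner_neg_right]; linarith)
    set c := ⟪β, coroot δ⟫ with hc
    have e : ∑ d ∈ D, ((n d : ℝ) + m d) • d = ∑ d ∈ D, (if d = δ then c else 0) • d := by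
      simp only [add_smul, Finset.sum_add_distrib, ite_smul, zero_smul,
        Finset.sum_ite_eq', hδ, if_true]
      rw [← hn, ← hm', reflLM_apply]; abel
    have hi := B.indep _ _ e
    have : β = (n δ : ℝ) • δ := by
      rw [hn]
      conv_lhs => rw [Finset.sum_eq_single_of_mem δ hδ (by
        intro b hb hbd
        have := hi b hb
        simp only [hbd, if_false] at this
        have h1 : (0 : ℝ) ≤ n b := Nat.cast_nonneg _
        have h2 : (0 : ℝ) ≤ m b := Nat.cast_nonneg _
        have : (n b : ℝ) = 0 := by linarith
        rw [this, zero_smul])]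
    have hβ' := hβ
    rw [this] at hβ'
    rcases R.hred δ (B.sub hδ) _ hβ' with h | h
    · rw [h, one_smul] at this; exact hne this
    · have h1 : (0 : ℝ) ≤ n δ := Nat.cast_nonneg _
      linarith
  · exact hg

lemma IsBase.exists_conj {Φ D : Finset V} {x : V} (R : RS Φ) (B : IsBase Φ D x) :
    ∀ β ∈ Φ, ∃ w ∈ weylGroup D, ∃ δ ∈ D, β = (w : V →ₗ[ℝ] V) δ := by
  classical
  have hpos : ∀ β ∈ Φ, 0 < ⟪x, β⟫ → ∃ w ∈ weylGroup D, ∃ δ ∈ D, β = (w : V →ₗ[ℝ] V) δ := by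
    by_contra hcon
    push Not at hcon
    obtain ⟨α, ha, hap, hn⟩ := hcon
    obtain ⟨β, hβ, hmin⟩ := Finset.exists_min_image (Φ.filter (fun α => 0 < ⟪x, α⟫ ∧
      ∀ w ∈ weylGroup D, ∀ δ ∈ D, α ≠ (w : V →ₗ[ℝ] V) δ)) (fun α => ⟪x, α⟫)
      ⟨α, Finset.mem_filter.mpr ⟨ha, hap, hn⟩⟩
    obtain ⟨hβΦ, hβp, hβn⟩ := Finset.mem_filter.mp hβ
    have hβD : β ∉ D := fun h => hβn 1 (one_mem _) β h rfl
    obtain ⟨n, hn⟩ := B.gen β hβΦ hβp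
    have : ∃ δ ∈ D, 0 < ⟪β, δ⟫ := by
      by_contra h
      push Not at h
      have h1 := inner_self_pos (R.ne_zero hβΦ)
      nth_rw 2 [hn] at h1
      rw [inner_sum] at h1
      refine absurd h1 (not_lt.mpr (Finset.sum_nonpos fun d hd => ?_))
      rw [real_inner_smul_right]
      exact mul_nonpos_of_nonneg_of_nonpos (Nat.cast_nonneg _) (h d hd)
    obtain ⟨δ, hδ, hd⟩ := this
    have hp := B.refl_pos R hδ hβΦ hβp (fun h => hβD (h ▸ hδ))
    have hlt : ⟪x, reflLM δ β⟫ < ⟪x, β⟫ := by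
      rw [reflLM_apply, inner_sub_right, real_inner_smul_right, inner_coroot]
      have h1 := inner_self_pos (R.ne_zero (B.sub hδ))
      have h2 := B.pos δ hδ
      have : 0 < 2 * ⟪β, δ⟫ / ⟪δ, δ⟫ * ⟪x, δ⟫ := by positivity
      linarith
    have hin := R.hinv δ (B.sub hδ) β hβΦ
    have : ∃ w ∈ weylGroup D, ∃ δ' ∈ D, reflLM δ β = (w : V →ₗ[ℝ] V) δ' := by
      by_contra h
      push Not at h
      exact absurd (hmin _ (Finset.mem_filter.mpr ⟨hin, hp, h⟩)) (not_le.mpr hlt)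
    obtain ⟨w, hw, δ', hδ', e⟩ := this
    refine hβn (rU δ * w) (mul_mem (rU_mem_weyl hδ) hw) δ' hδ' ?_
    rw [mul_app, ← e, rU_val, reflLM_reflLM]
  intro β hβ
  rcases lt_or_gt_of_ne (B.reg _ hβ) with hl | hg
  · obtain ⟨w, hw, δ, hδ, e⟩ := hpos (-β) (R.neg_mem hβ) (by rw [inner_neg_right]; linarith)
    refine ⟨w * rU δ, mul_mem hw (rU_mem_weyl hδ), δ, hδ, ?_⟩
    rw [mul_app, rU_val, reflLM_self, map_neg, ← e, neg_neg]
  · exact hpos β hβ hg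

lemma weyl_mono {D Φ : Finset V} (h : D ⊆ Φ) : weylGroup D ≤ weylGroup Φ :=
  Subgroup.closure_mono fun w hw => by
    obtain ⟨α, ha, rfl⟩ := mem_reflSet.mp hw
    exact mem_reflSet.mpr ⟨α, h ha, rfl⟩

lemma IsBase.weyl_eq {Φ D : Finset V} {x : V} (R : RS Φ) (B : IsBase Φ D x) :
    weylGroup D = weylGroup Φ := by
  refine le_antisymm (weyl_mono B.sub) ?_
  conv_lhs => rw [weylGroup]
  rw [Subgroup.closure_le]
  intro w hw'
  obtain ⟨α, ha, rfl⟩ := mem_reflSet.mp hw'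
  obtain ⟨w, hw, δ, hδ, rfl⟩ := B.exists_conj R α ha
  rw [rU_conj (weyl_isom hw)]
  exact mul_mem (mul_mem hw (rU_mem_weyl hδ)) (inv_mem hw)

/-! ### Stabilizers -/

lemma exists_list {D : Finset V} {w : (V →ₗ[ℝ] V)ˣ} (hw : w ∈ weylGroup D) :
    ∃ l : List V, (∀ a ∈ l, a ∈ D) ∧ (l.map rU).prod = w := by
  unfold weylGroup at hw
  induction hw using Subgroup.closure_induction'' with
  | mem w hw => obtain ⟨α, h, rfl⟩ := mem_reflSet.mp hw; exact ⟨[α], by simpa using h, by simp⟩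
  | inv_mem w hw =>
    obtain ⟨α, h, rfl⟩ := mem_reflSet.mp hw; exact ⟨[α], by simpa using h, by simp [rU_inv]⟩
  | one => exact ⟨[], by simp, by simp⟩
  | mul a b _ _ ha hb =>
    obtain ⟨l, h1, rfl⟩ := ha
    obtain ⟨l', h2, rfl⟩ := hb
    refine ⟨l ++ l', ?_, by simp⟩
    intro c hc
    rcases List.mem_append.mp hc with h | h
    · exact h1 c h
    · exact h2 c h

lemma prod_mem {D : Finset V} {l : List V} (h : ∀ a ∈ l, a ∈ D) :
    (l.map rU).prod ∈ weylGroup D := by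
  refine Subgroup.list_prod_mem _ fun w hw => ?_
  obtain ⟨a, ha, rfl⟩ := List.mem_map.mp hw
  exact rU_mem_weyl (h a ha)

lemma IsBase.deletion {Φ D : Finset V} {x : V} (R : RS Φ) (B : IsBase Φ D x) {δ : V} (hδ : δ ∈ D) :
    ∀ l : List V, (∀ a ∈ l, a ∈ D) → ⟪x, ((l.map rU).prod : (V →ₗ[ℝ] V)ˣ).val δ⟫ < 0 →
    ∃ l' : List V, (∀ a ∈ l', a ∈ D) ∧ l'.length < l.length ∧
      (l.map rU).prod * rU δ = (l'.map rU).prod := by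
  intro l
  induction l with
  | nil =>
    intro _ h
    have := B.pos δ hδ
    simp only [List.map_nil, List.prod_nil, one_app] at h
    linarith
  | cons a l ih =>
    intro hl h
    have hl' : ∀ b ∈ l, b ∈ D := fun b hb => hl b (List.mem_cons_of_mem _ hb)
    have ha : a ∈ D := hl a List.mem_cons_self
    set P := (l.map rU).prod with hP
    have hPm : P ∈ weylGroup Φ := weyl_mono B.sub (prod_mem hl')
    have hγ : P.val δ ∈ Φ := R.weyl_mem hPm δ (B.sub hδ)
    simp only [List.map_cons, List.prod_cons] at h ⊢
    rw [← hP] at h ⊢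
    rcases lt_or_gt_of_ne (B.reg _ hγ) with hlt | hgt
    · obtain ⟨l', h1, h2, h3⟩ := ih hl' hlt
      refine ⟨a :: l', ?_, by simpa using h2, ?_⟩
      · intro b hb
        rcases List.mem_cons.mp hb with rfl | hb
        · exact ha
        · exact h1 b hb
      · rw [List.map_cons, List.prod_cons, ← h3, mul_assoc]
    · have e : P.val δ = a := by
        by_contra hne
        have := B.refl_pos R ha hγ hgt hne
        rw [mul_app, rU_val] at h
        linarith
      refine ⟨l, hl', by simp, ?_⟩
      rw [← e, rU_conj (weyl_isom hPm), inv_mul_cancel_right, mul_assoc, rU_mul_self, mul_one]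

open Classical in
/-- the roots orthogonal to `v` -/
noncomputable def perp (Φ : Finset V) (v : V) : Finset V := Φ.filter (fun α => ⟪v, α⟫ = 0)

lemma mem_perp {Φ : Finset V} {v α : V} : α ∈ perp Φ v ↔ α ∈ Φ ∧ ⟪v, α⟫ = 0 := by
  simp [perp]

lemma IsBase.stab {Φ D : Finset V} {x : V} (R : RS Φ) (B : IsBase Φ D x) {v : V}
    (hv : ∀ α ∈ Φ, 0 < ⟪x, α⟫ → 0 ≤ ⟪v, α⟫) :
    ∀ (k : ℕ) (l : List V), l.length = k → (∀ a ∈ l, a ∈ D) →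
      ((l.map rU).prod : (V →ₗ[ℝ] V)ˣ).val v = v → (l.map rU).prod ∈ weylGroup (perp Φ v) := by
  intro k
  induction k using Nat.strong_induction_on with
  | _ k ih =>
  intro l hk hl hfix
  rcases List.eq_nil_or_concat l with rfl | ⟨l0, δ, rfl⟩
  · simp
  · rw [List.concat_eq_append] at *
    have hl0 : ∀ a ∈ l0, a ∈ D := fun a ha => hl a (List.mem_append_left _ ha)
    have hδ : δ ∈ D := hl δ (by simp)
    have hk' : l0.length < k := by rw [← hk]; simp
    set P := (l0.map rU).prod with hP
    have hprod : ((l0 ++ [δ]).map rU).prod = P * rU δ := by simp [hP]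
    rw [hprod] at hfix ⊢
    have hPm : P ∈ weylGroup Φ := weyl_mono B.sub (prod_mem hl0)
    have hγ : P.val δ ∈ Φ := R.weyl_mem hPm δ (B.sub hδ)
    have hδm := rU_mem_weyl (B.sub hδ)
    rcases lt_or_gt_of_ne (B.reg _ hγ) with hlt | hgt
    · obtain ⟨l', h1, h2, h3⟩ := B.deletion R hδ l0 hl0 hlt
      rw [← hP] at h3
      rw [h3] at hfix ⊢
      exact ih _ (h2.trans hk') l' rfl h1 hfix
    · have h1 := hv _ hγ hgt
      have h2 := hv _ (B.sub hδ) (B.pos δ hδ)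
      have h3 : ⟪v, P.val δ⟫ = - ⟪v, δ⟫ := by
        have e : (P * rU δ).val δ = - P.val δ := by
          rw [mul_app, rU_val, reflLM_self, map_neg]
        have := weyl_isom (mul_mem hPm hδm) v δ
        rw [hfix, e, inner_neg_right] at this
        linarith
      have h4 : ⟪v, δ⟫ = 0 := by linarith
      have h5 : (rU δ).val v = v := by
        rw [rU_val, reflLM_apply, inner_coroot, h4]; simp
      rw [mul_app, h5] at hfix
      exact mul_mem (ih _ hk' l0 rfl hl0 hfix) (rU_mem_weyl (mem_perp.mpr ⟨B.sub hδ, h4⟩))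

lemma exists_reg {Φ : Finset V} (R : RS Φ) : ∃ u : V, ∀ α ∈ Φ, ⟪u, α⟫ ≠ 0 := by
  obtain ⟨v, -, h⟩ := generic (⊤ : Submodule ℝ V) Φ
    (fun α h => ⟨α, trivial, (inner_self_pos (R.ne_zero h)).ne'⟩)
  exact ⟨v, h⟩

/-- Steinberg: the stabilizer of a vector is generated by reflections. -/
lemma RS.stab {Φ : Finset V} (R : RS Φ) {w : (V →ₗ[ℝ] V)ˣ} (hw : w ∈ weylGroup Φ) {v : V}
    (hv : w.val v = v) : w ∈ weylGroup (perp Φ v) := by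
  obtain ⟨u, hu⟩ := exists_reg R
  have : ∀ᶠ e : ℝ in nhdsWithin 0 (Set.Ioi 0), ∀ α ∈ Φ,
      ⟪v + e • u, α⟫ ≠ 0 ∧ (0 < ⟪v + e • u, α⟫ → 0 ≤ ⟪v, α⟫) := by
    rw [Filter.eventually_all_finset]
    intro α ha
    have hc : Filter.Tendsto (fun e : ℝ => ⟪v + e • u, α⟫) (nhdsWithin 0 (Set.Ioi 0))
        (nhds ⟪v, α⟫) := by
      have : Continuous (fun e : ℝ => ⟪v + e • u, α⟫) := by fun_prop
      have h2 := (this.tendsto 0).mono_left (nhdsWithin_le_nhds (s := Set.Ioi 0))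
      simpa using h2
    rcases lt_trichotomy ⟪v, α⟫ 0 with h | h | h
    · filter_upwards [hc.eventually_lt_const h] with e he
      exact ⟨he.ne, fun h => by linarith⟩
    · filter_upwards [self_mem_nhdsWithin] with e he
      refine ⟨?_, fun _ => h.ge⟩
      rw [inner_add_left, h, zero_add, real_inner_smul_left]
      exact mul_ne_zero (ne_of_gt he) (hu α ha)
    · filter_upwards [hc.eventually_const_lt h] with e he
      exact ⟨he.ne', fun _ => h.le⟩
  obtain ⟨e, he⟩ := this.exists
  obtain ⟨D, B⟩ := exists_base R (fun α ha => (he α ha).1)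
  rw [← B.weyl_eq R] at hw
  obtain ⟨l, hl, rfl⟩ := exists_list hw
  exact B.stab R (fun α ha => (he α ha).2) _ l rfl hl hv

lemma weyl_empty {Φ : Finset V} (h : ∀ α, α ∉ Φ) : weylGroup Φ = ⊥ := by
  rw [weylGroup, Subgroup.closure_eq_bot_iff]
  intro w hw
  obtain ⟨α, ha, -⟩ := mem_reflSet.mp hw
  exact absurd ha (h α)

lemma mem_of_refl_mem {Φ Φ' : Finset V} (R : RS Φ) (R' : RS Φ') (hs : Φ' ⊆ Φ) {β : V} (hβ : β ∈ Φ)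
    (h : rU β ∈ weylGroup Φ') : β ∈ Φ' := by
  by_contra hn
  have hb := inner_self_pos (R.ne_zero hβ)
  obtain ⟨v, hv, hα⟩ := generic (LinearMap.ker (innerₗ V β)) Φ' (by
    intro α ha
    refine ⟨α - (⟪β, α⟫ / ⟪β, β⟫) • β, ?_, ?_⟩
    · rw [LinearMap.mem_ker, innerₗ_apply_apply, inner_sub_right, real_inner_smul_right]
      field_simp; ring
    · intro h0
      have h1 : ⟪α - (⟪β, α⟫ / ⟪β, β⟫) • β, β⟫ = 0 := by
        rw [inner_sub_left, real_inner_smul_left, real_inner_comm α β]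
        field_simp; ring
      have h2 : α - (⟪β, α⟫ / ⟪β, β⟫) • β = 0 := by
        rw [← inner_self_eq_zero (𝕜 := ℝ)]
        nth_rw 2 [sub_eq_add_neg]
        rw [inner_add_right, h0, inner_neg_right, real_inner_smul_right, h1]; simp
      have h3 := sub_eq_zero.mp h2
      have h4 := hs ha
      rw [h3] at h4
      rcases R.hred β hβ _ h4 with h | h
      · rw [h, one_smul] at h3; exact hn (h3 ▸ ha)
      · rw [h, neg_smul, one_smul] at h3
        have := R'.neg_mem ha
        rw [h3, neg_neg] at this
        exact hn this)
  rw [LinearMap.mem_ker, innerₗ_apply_apply, real_inner_comm] at hv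
  have h5 := R'.stab h (v := v) (by rw [rU_val, reflLM_apply, inner_coroot, hv]; simp)
  rw [weyl_empty (fun α ha => hα α (mem_perp.mp ha).1 (mem_perp.mp ha).2), Subgroup.mem_bot] at h5
  have h6 : reflLM β β = β := by rw [← rU_val, h5]; rfl
  rw [reflLM_self] at h6
  have h7 : ⟪-β, β⟫ = ⟪β, β⟫ := by rw [h6]
  rw [inner_neg_left] at h7
  linarith

/-! ### Carter lemma -/

lemma carter_step {Φ : Finset V} [FiniteDimensional ℝ V] (R : RS Φ) {g : (V →ₗ[ℝ] V)ˣ}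
    (hg : g ∈ weylGroup Φ) (h1 : g ≠ 1) : ∃ α ∈ Φ,
    LinearMap.ker (g.val - 1) < LinearMap.ker ((rU α * g).val - 1) := by
  have hk : ∀ (g : (V →ₗ[ℝ] V)ˣ) v, v ∈ LinearMap.ker (g.val - 1) ↔ g.val v = v := by
    intro g v; rw [LinearMap.mem_ker, LinearMap.sub_apply, sub_eq_zero]; rfl
  set F := LinearMap.ker (g.val - 1) with hF
  classical
  obtain ⟨v, hv, hgen⟩ := generic F (Φ.filter (fun α => ∃ f ∈ F, ⟪f, α⟫ ≠ 0))
    (fun α ha => (Finset.mem_filter.mp ha).2)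
  have hs := R.stab hg ((hk g v).mp hv)
  have : ∃ α ∈ Φ, ∀ f ∈ F, ⟪f, α⟫ = 0 := by
    by_contra hcon
    push Not at hcon
    rw [weyl_empty, Subgroup.mem_bot] at hs
    · exact h1 hs
    · intro α ha
      obtain ⟨h2, h3⟩ := mem_perp.mp ha
      exact hgen α (Finset.mem_filter.mpr ⟨h2, hcon α h2⟩) h3
  obtain ⟨α, ha, hperp⟩ := this
  refine ⟨α, ha, ?_⟩
  have hI := weyl_isom hg
  have hr : (LinearMap.range (g.val - 1))ᗮ ≤ F := by
    intro y hy
    rw [hk]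
    have h2 : ∀ z, ⟪z, g.val y - y⟫ = 0 := by
      intro z
      have h3 := (Submodule.mem_orthogonal _ _).mp hy _ (LinearMap.mem_range_self (g.val - 1) ((g⁻¹).val z))
      rw [LinearMap.sub_apply, app_inv, inner_sub_left] at h3
      have h4 := hI ((g⁻¹).val z) y
      rw [app_inv] at h4
      rw [inner_sub_right, h4]
      have h5 : ((1 : V →ₗ[ℝ] V)) ((g⁻¹).val z) = (g⁻¹).val z := rfl
      rw [h5] at h3
      linarith
    exact sub_eq_zero.mp (inner_self_eq_zero (𝕜 := ℝ) |>.mp (h2 _))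
  have hα : α ∈ LinearMap.range (g.val - 1) := by
    rw [← Submodule.orthogonal_orthogonal (LinearMap.range (g.val - 1))]
    exact Submodule.orthogonal_le hr ((Submodule.mem_orthogonal _ _).mpr hperp)
  obtain ⟨v, hv⟩ := hα
  have hv' : g.val v = v + α := by
    rw [← hv, LinearMap.sub_apply]; simp
  have ha0 := inner_self_pos (R.ne_zero ha)
  have hva : 2 * ⟪v + α, α⟫ = ⟪α, α⟫ := by
    have := hI v v
    rw [hv', real_inner_add_add_self] at this
    rw [inner_add_left]; linarith
  rw [SetLike.lt_iff_le_and_exists]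
  refine ⟨?_, v, ?_, ?_⟩
  · intro f hf
    rw [hk, mul_app, (hk g f).mp hf, rU_val, reflLM_apply, inner_coroot, hperp f hf]; simp
  · rw [hk, mul_app, hv', rU_val, reflLM_apply, inner_coroot, hva, div_self ha0.ne', one_smul]
    abel
  · intro h
    rw [hk, hv'] at h
    exact R.ne_zero ha (by simpa using h)

lemma carter {Φ : Finset V} [FiniteDimensional ℝ V] (R : RS Φ) : ∀ (m : ℕ) (g : (V →ₗ[ℝ] V)ˣ),
    g ∈ weylGroup Φ → Module.finrank ℝ V ≤ m + Module.finrank ℝ (LinearMap.ker (g.val - 1)) →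
    ∃ l : List V, (∀ a ∈ l, a ∈ Φ) ∧ (l.map rU).prod = g ∧ l.length ≤ m := by
  intro m
  induction m with
  | zero =>
    intro g hg hle
    have : LinearMap.ker (g.val - 1) = ⊤ :=
      Submodule.eq_top_of_finrank_eq (le_antisymm (Submodule.finrank_le _) (by simpa using hle))
    refine ⟨[], by simp, ?_, by simp⟩
    rw [LinearMap.ker_eq_top, sub_eq_zero] at this
    simp only [List.map_nil, List.prod_nil]
    exact (Units.ext this).symm
  | succ m ih =>
    intro g hg hle
    by_cases h1 : g = 1
    · exact ⟨[], by simp, by simp [h1], by simp⟩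
    obtain ⟨α, ha, hlt⟩ := carter_step R hg h1
    have := Submodule.finrank_lt_finrank_of_lt hlt
    obtain ⟨l, hl, hp, hlen⟩ := ih _ (mul_mem (rU_mem_weyl ha) hg) (by omega)
    refine ⟨α :: l, ?_, ?_, by simpa using hlen⟩
    · intro b hb
      rcases List.mem_cons.mp hb with rfl | hb
      · exact ha
      · exact hl b hb
    · rw [List.map_cons, List.prod_cons, hp, ← mul_assoc, rU_mul_self, one_mul]

lemma span_of_fix {l : List V} [FiniteDimensional ℝ V]
    (h : ∀ v, ((l.map rU).prod : (V →ₗ[ℝ] V)ˣ).val v = v → v = 0) :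
    Submodule.span ℝ {a | a ∈ l} = ⊤ := by
  rw [← Submodule.orthogonal_eq_bot_iff, Submodule.eq_bot_iff]
  intro v hv
  refine h v ?_
  have hv' : ∀ a ∈ l, ⟪v, a⟫ = 0 := fun a ha =>
    (Submodule.mem_orthogonal' _ _).mp hv a (Submodule.subset_span ha)
  clear hv h
  induction l with
  | nil => simp
  | cons a l ih =>
    rw [List.map_cons, List.prod_cons, mul_app, ih (fun b hb => hv' b (List.mem_cons_of_mem _ hb)),
      rU_val, reflLM_apply, inner_coroot, hv' a List.mem_cons_self]
    simp

lemma length_of_fix {l : List V} [FiniteDimensional ℝ V]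
    (h : ∀ v, ((l.map rU).prod : (V →ₗ[ℝ] V)ˣ).val v = v → v = 0) :
    Module.finrank ℝ V ≤ l.length := by
  classical
  have h1 := span_of_fix h
  have h2 : {a | a ∈ l} = (l.toFinset : Set V) := by ext; simp
  rw [h2] at h1
  have h3 := finrank_span_finset_le_card (R := ℝ) l.toFinset
  rw [Set.finrank, h1, finrank_top] at h3
  exact h3.trans (List.toFinset_card_le l)

/-! ### The determinant formula -/

lemma toNat_cast {c : ℤ} (h : 0 ≤ c) : ((c.toNat : ℕ) : ℝ) = c := by
  exact_mod_cast Int.toNat_of_nonneg h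


lemma tri_exists : ∀ (n : ℕ) (ρ : Fin n → V), ∃ U : Matrix (Fin n) (Fin n) ℝ,
    (∀ i, U i i = 1) ∧ (∀ i j, i < j → U i j = 0) ∧
    ∀ v, v - ((List.ofFn fun i => rU (ρ i)).prod : (V →ₗ[ℝ] V)ˣ).val v =
      ∑ i, ⟪v, coroot (ρ i)⟫ • ∑ j, U i j • ρ j := by
  intro n
  induction n with
  | zero => intro ρ; exact ⟨1, by simp, by simp, by simp⟩
  | succ n ih =>
    intro ρ
    obtain ⟨U, h1, h2, h3⟩ := ih (fun i => ρ i.succ)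
    refine ⟨Matrix.of (Fin.cons (Fin.cons 1 (fun _ => 0))
      (fun i => Fin.cons (-∑ j, U i j * ⟪ρ j.succ, coroot (ρ 0)⟫) (fun j => U i j))), ?_, ?_, ?_⟩
    · intro i
      refine Fin.cases ?_ (fun i => ?_) i
      · simp
      · simp [h1]
    · intro i j
      refine Fin.cases ?_ (fun i => ?_) i <;> refine Fin.cases ?_ (fun j => ?_) j
      · simp
      · simp
      · simp
      · simpa using h2 i j
    · intro v
      rw [List.ofFn_succ, List.prod_cons, mul_app, rU_val]
      set g := (List.ofFn fun i : Fin n => rU (ρ i.succ)).prod with hg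
      have e : v - reflLM (ρ 0) (g.val v) =
          (v - reflLM (ρ 0) v) + reflLM (ρ 0) (v - g.val v) := by
        rw [map_sub]; abel
      rw [e, h3, Fin.sum_univ_succ, map_sum]
      congr 1
      · rw [reflLM_apply, Fin.sum_univ_succ]
        simp
      · refine Finset.sum_congr rfl fun i _ => ?_
        rw [map_smul, map_sum, Fin.sum_univ_succ]
        congr 1
        simp only [map_smul, reflLM_apply, smul_sub, Finset.sum_sub_distrib, Matrix.of_apply,
          Fin.cons_succ, Fin.cons_zero, neg_smul, Finset.sum_smul, mul_smul]
        abel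

lemma det_formula {n : ℕ} [FiniteDimensional ℝ V] (b : Basis (Fin n) ℝ V) :
    |LinearMap.det (((List.ofFn fun i => rU (b i)).prod : (V →ₗ[ℝ] V)ˣ).val - LinearMap.id)| =
      |pairingDet b| := by
  obtain ⟨U, h1, h2, h3⟩ := tri_exists n (fun i => b i)
  set g := ((List.ofFn fun i => rU (b i)).prod : (V →ₗ[ℝ] V)ˣ) with hg
  have hU : U.det = 1 := by
    rw [Matrix.det_of_isLowerTriangular U (fun i j hij => h2 i j (by simpa using hij))]
    simp [h1]
  have hm : (LinearMap.toMatrix b b (LinearMap.id - g.val)) =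
      ((Matrix.of fun i j => ⟪b i, coroot (b j)⟫) * U).transpose := by
    ext j k
    rw [LinearMap.toMatrix_apply, LinearMap.sub_apply, LinearMap.id_apply, h3]
    simp [Matrix.mul_apply, Finsupp.single_apply]
  have hd : LinearMap.det (LinearMap.id - g.val) = pairingDet b := by
    rw [← LinearMap.det_toMatrix b, hm, Matrix.det_transpose, Matrix.det_mul, hU, mul_one]
    rfl
  have : g.val - LinearMap.id = -(LinearMap.id - g.val) := by abel
  rw [this, ← hd, ← neg_one_smul ℝ (LinearMap.id - g.val), LinearMap.det_smul, abs_mul, abs_pow]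
  simp

lemma pairing_trans {n : ℕ} {ρ σ : Fin n → V} {M M' : Matrix (Fin n) (Fin n) ℤ}
    (h : ∀ i, ρ i = ∑ j, M i j • σ j) (h' : ∀ i, coroot (ρ i) = ∑ j, M' i j • coroot (σ j)) :
    pairingDet ρ = M.det * M'.det * pairingDet σ := by
  have : (Matrix.of fun i j => ⟪ρ i, coroot (ρ j)⟫) =
      M.map (Int.castRingHom ℝ) * (Matrix.of fun i j => ⟪σ i, coroot (σ j)⟫) *
        (M'.map (Int.castRingHom ℝ)).transpose := by
    ext i j
    rw [Matrix.of_apply, h i, h' j]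
    simp only [← Int.cast_smul_eq_zsmul ℝ, inner_sum, sum_inner, real_inner_smul_left,
      real_inner_smul_right, Matrix.mul_apply, Matrix.map_apply, Matrix.transpose_apply,
      Matrix.of_apply, Finset.sum_mul]
    refine Finset.sum_congr rfl fun a _ => Finset.sum_congr rfl fun c _ => ?_
    simp; ring
  rw [pairingDet, this, Matrix.det_mul, Matrix.det_mul, Matrix.det_transpose, pairingDet,
    ← RingHom.mapMatrix_apply, ← RingHom.mapMatrix_apply, ← RingHom.map_det, ← RingHom.map_det]
  simp; ring

lemma exists_matrix {V : Type*} [AddCommGroup V] {n : ℕ} {ρ σ : Fin n → V} (h : ∀ i, ρ i ∈ Submodule.span ℤ (Set.range σ)) :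
    ∃ M : Matrix (Fin n) (Fin n) ℤ, ∀ i, ρ i = ∑ j, M i j • σ j := by
  choose c hc using fun i => (Submodule.mem_span_range_iff_exists_fun ℤ).mp (h i)
  exact ⟨Matrix.of c, fun i => (hc i).symm⟩

lemma span_of_unit {V : Type*} [AddCommGroup V] {n : ℕ} {ρ σ : Fin n → V} {M : Matrix (Fin n) (Fin n) ℤ}
    (h : ∀ i, ρ i = ∑ j, M i j • σ j) (hu : IsUnit M.det) (j : Fin n) :
    σ j ∈ Submodule.span ℤ (Set.range ρ) := by
  rw [Submodule.mem_span_range_iff_exists_fun]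
  refine ⟨fun i => M⁻¹ j i, ?_⟩
  simp only [h, Finset.smul_sum, smul_smul]
  rw [Finset.sum_comm]
  simp only [← Finset.sum_smul]
  have : ∀ k, ∑ i, M⁻¹ j i * M i k = (1 : Matrix (Fin n) (Fin n) ℤ) j k := by
    intro k; rw [← Matrix.nonsing_inv_mul M hu, Matrix.mul_apply]
  simp only [this, Matrix.one_apply]
  simp

lemma pairing_pos {n : ℕ} (σ : Fin n → V) (h : LinearIndependent ℝ σ) : 0 < pairingDet σ := by
  have e : (Matrix.of fun i j => ⟪σ i, coroot (σ j)⟫) =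
      Matrix.gram ℝ σ * Matrix.diagonal (fun j => 2 / ⟪σ j, σ j⟫) := by
    ext i j
    rw [Matrix.mul_diagonal, Matrix.of_apply, Matrix.gram_apply, inner_coroot]; ring
  rw [pairingDet, e, Matrix.det_mul, Matrix.det_diagonal]
  refine mul_pos (Matrix.posDef_gram_of_linearIndependent h).det_pos
    (Finset.prod_pos fun i _ => div_pos two_pos (inner_self_pos (h.ne_zero i)))

/-! ### Lattices -/

lemma stable {D : Finset V} {L : Submodule ℤ V} (h : ∀ δ ∈ D, ∀ v ∈ L, reflLM δ v ∈ L)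
    {w : (V →ₗ[ℝ] V)ˣ} (hw : w ∈ weylGroup D) {v : V} (hv : v ∈ L) : w.val v ∈ L := by
  obtain ⟨l, hl, rfl⟩ := exists_list hw
  clear hw
  induction l with
  | nil => simpa using hv
  | cons a l ih =>
    rw [List.map_cons, List.prod_cons, mul_app, rU_val]
    exact h a (hl a List.mem_cons_self) _ (ih fun b hb => hl b (List.mem_cons_of_mem _ hb))

lemma span_orbit {Φ D : Finset V} (R : RS Φ) (hD : D ⊆ Φ) {w : (V →ₗ[ℝ] V)ˣ}
    (hw : w ∈ weylGroup D) {δ : V} (hδ : δ ∈ D) :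
    w.val δ ∈ Submodule.span ℤ (D : Set V) ∧
      coroot (w.val δ) ∈ Submodule.span ℤ (coroot '' (D : Set V)) := by
  constructor
  · refine stable ?_ hw (Submodule.subset_span hδ)
    intro δ hδ v hv
    induction hv using Submodule.span_induction with
    | mem β hβ =>
      obtain ⟨z, hz⟩ := R.hcrys β (hD hβ) δ (hD hδ)
      rw [reflLM_apply, hz, Int.cast_smul_eq_zsmul]
      exact Submodule.sub_mem _ (Submodule.subset_span hβ)
        (Submodule.smul_mem _ _ (Submodule.subset_span hδ))
    | zero => simp
    | add x y _ _ hx hy => rw [map_add]; exact Submodule.add_mem _ hx hy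
    | smul a x _ hx => rw [map_zsmul]; exact Submodule.smul_mem _ _ hx
  · rw [coroot_map (weyl_isom hw)]
    refine stable ?_ hw (Submodule.subset_span ⟨δ, hδ, rfl⟩)
    intro δ hδ v hv
    induction hv using Submodule.span_induction with
    | mem β hβ =>
      obtain ⟨β, hβ, rfl⟩ := hβ
      obtain ⟨z, hz⟩ := R.hcrys δ (hD hδ) β (hD hβ)
      have : reflLM δ (coroot β) = coroot β - z • coroot δ := by
        rw [reflLM_apply, ← Int.cast_smul_eq_zsmul ℝ, ← hz, inner_coroot, coroot, coroot, smul_smul,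
          real_inner_smul_left, real_inner_smul_right, real_inner_comm β δ]
        congr 2; ring
      rw [this]
      exact Submodule.sub_mem _ (Submodule.subset_span ⟨β, hβ, rfl⟩)
        (Submodule.smul_mem _ _ (Submodule.subset_span ⟨δ, hδ, rfl⟩))
    | zero => simp
    | add x y _ _ hx hy => rw [map_add]; exact Submodule.add_mem _ hx hy
    | smul a x _ hx => rw [map_zsmul]; exact Submodule.smul_mem _ _ hx

/-- If reflections in `D` generate the Weyl group, then `D` generates both lattices. -/
lemma span_of_gen {Φ D : Finset V} (R : RS Φ) (hD : D ⊆ Φ) (hW : weylGroup D = weylGroup Φ)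
    {β : V} (hβ : β ∈ Φ) : β ∈ Submodule.span ℤ (D : Set V) ∧
      coroot β ∈ Submodule.span ℤ (coroot '' (D : Set V)) := by
  classical
  set Φ' := Φ.filter (fun α => ∃ w ∈ weylGroup D, ∃ δ ∈ D, α = w.val δ) with hΦ'
  have hsub : Φ' ⊆ Φ := Finset.filter_subset _ _
  have hDsub : D ⊆ Φ' := fun δ h =>
    Finset.mem_filter.mpr ⟨hD h, 1, one_mem _, δ, h, rfl⟩
  have R' : RS Φ' := by
    refine ⟨fun h => R.h0 (hsub h), fun α h c hc => R.hred α (hsub h) c (hsub hc),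
      fun α h β hβ => R.hcrys α (hsub h) β (hsub hβ), ?_⟩
    intro α ha β hb
    refine Finset.mem_filter.mpr ⟨R.hinv α (hsub ha) β (hsub hb), ?_⟩
    obtain ⟨-, w, hw, δ, hδ, rfl⟩ := Finset.mem_filter.mp ha
    obtain ⟨-, w', hw', δ', hδ', rfl⟩ := Finset.mem_filter.mp hb
    refine ⟨w * rU δ * w⁻¹ * w', mul_mem (mul_mem (mul_mem hw (rU_mem_weyl hδ)) (inv_mem hw)) hw',
      δ', hδ', ?_⟩
    rw [← rU_conj (weyl_isom hw), mul_app, rU_val]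
  have hm : β ∈ Φ' := mem_of_refl_mem R R' hsub hβ (by
    have := rU_mem_weyl hβ
    rw [← hW] at this
    exact weyl_mono hDsub this)
  obtain ⟨-, w, hw, δ, hδ, rfl⟩ := Finset.mem_filter.mp hm
  exact span_orbit R hD hw hδ

lemma coeff_of_span {D : Finset V} {f : V → V} {v : V} (h : v ∈ Submodule.span ℤ (f '' (D : Set V))) :
    ∃ n : V → ℤ, v = ∑ δ ∈ D, (n δ : ℝ) • f δ := by
  induction h using Submodule.span_induction with
  | mem x hx =>
    classical
    obtain ⟨δ, hδ, rfl⟩ := hx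
    refine ⟨fun v => if v = δ then 1 else 0, ?_⟩
    rw [Finset.sum_eq_single_of_mem δ hδ (by intro b _ hb; simp [hb])]
    simp
  | zero => exact ⟨0, by simp⟩
  | add x y _ _ hx hy =>
    obtain ⟨n, rfl⟩ := hx
    obtain ⟨m, rfl⟩ := hy
    exact ⟨n + m, by simp [add_smul, Finset.sum_add_distrib]⟩
  | smul a x _ hx =>
    obtain ⟨n, rfl⟩ := hx
    refine ⟨fun v => a * n v, ?_⟩
    rw [Finset.smul_sum]
    refine Finset.sum_congr rfl fun δ _ => ?_
    rw [← Int.cast_smul_eq_zsmul ℝ, smul_smul]; push_cast; rfl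

/-- A subsystem with the same root and coroot lattices is everything. -/
lemma eq_of_lattice {Φ Φ' : Finset V} (R : RS Φ) (R' : RS Φ') (hs : Φ' ⊆ Φ)
    (h1 : ∀ α ∈ Φ, α ∈ Submodule.span ℤ (Φ' : Set V))
    (h2 : ∀ α ∈ Φ, coroot α ∈ Submodule.span ℤ (coroot '' (Φ' : Set V))) : Φ ⊆ Φ' := by
  classical
  obtain ⟨x, hx⟩ := exists_reg R'
  obtain ⟨D, B⟩ := exists_base R' hx
  have s1 : Submodule.span ℤ (Φ' : Set V) ≤ Submodule.span ℤ (D : Set V) := by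
    rw [Submodule.span_le]
    intro α ha
    obtain ⟨w, hw, δ, hδ, rfl⟩ := B.exists_conj R' α ha
    exact (span_orbit R' B.sub hw hδ).1
  have s2 : Submodule.span ℤ (coroot '' (Φ' : Set V)) ≤ Submodule.span ℤ (coroot '' (D : Set V)) := by
    rw [Submodule.span_le]
    rintro _ ⟨α, ha, rfl⟩
    obtain ⟨w, hw, δ, hδ, rfl⟩ := B.exists_conj R' α ha
    exact (span_orbit R' B.sub hw hδ).2
  have hdesc : ∀ (N : ℕ) (β : V) (n : V → ℕ), β ∈ Φ → β = ∑ δ ∈ D, (n δ : ℝ) • δ →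
      ∑ δ ∈ D, n δ = N → β ∈ Φ' := by
    intro N
    induction N using Nat.strong_induction_on with
    | _ N ih =>
    intro β n hβ hn hN
    have hb0 := inner_self_pos (R.ne_zero hβ)
    have : ∃ δ ∈ D, 0 < (n δ : ℝ) * ⟪β, δ⟫ := by
      by_contra h
      push Not at h
      have h1 := hb0
      nth_rw 2 [hn] at h1
      rw [inner_sum] at h1
      refine absurd h1 (not_lt.mpr (Finset.sum_nonpos fun d hd => ?_))
      rw [real_inner_smul_right]
      exact h d hd
    obtain ⟨δ, hδ, hnd⟩ := this
    have hnn : (0 : ℝ) ≤ n δ := Nat.cast_nonneg _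
    have hip : 0 < ⟪β, δ⟫ := pos_of_mul_pos_right hnd hnn
    have hnp : 0 < (n δ : ℝ) := pos_of_mul_pos_left hnd hip.le
    have hδΦ := hs (B.sub hδ)
    have hd0 := inner_self_pos (R.ne_zero hδΦ)
    obtain ⟨c, hc⟩ := R.hcrys β hβ δ hδΦ
    obtain ⟨d, hd⟩ := R.hcrys δ hδΦ β hβ
    have hc0 : (0 : ℝ) < c := by rw [← hc, inner_coroot]; positivity
    have hc0' : 0 < c := by exact_mod_cast hc0
    by_cases hle : c ≤ n δ
    · -- reflect
      have hm := ih (∑ d ∈ D, (if d = δ then n δ - c.toNat else n d)) ?_ (reflLM δ β)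
        (fun d => if d = δ then n δ - c.toNat else n d) (R.hinv δ hδΦ β hβ) ?_ rfl
      · have := R'.hinv δ (B.sub hδ) _ hm
        rwa [reflLM_reflLM] at this
      · rw [← hN]
        refine Finset.sum_lt_sum ?_ ⟨δ, hδ, ?_⟩
        · intro d _
          split_ifs with h
          · subst h; omega
          · exact le_rfl
        · simp only [if_true]; omega
      · rw [reflLM_apply, hc, hn, ← Finset.add_sum_erase D _ hδ, ← Finset.add_sum_erase D _ hδ]
        simp only [if_true]
        have e1 : ((n δ - c.toNat : ℕ) : ℝ) = n δ - c := by
          rw [Nat.cast_sub (by omega)]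
          rw [toNat_cast hc0'.le]
        have e2 : ∑ x ∈ D.erase δ, ((if x = δ then n δ - c.toNat else n x : ℕ) : ℝ) • x =
            ∑ x ∈ D.erase δ, (n x : ℝ) • x := by
          refine Finset.sum_congr rfl fun y hy => ?_
          rw [if_neg (Finset.ne_of_mem_erase hy)]
        rw [e1, e2, sub_smul]; abel
    · obtain ⟨m, hm⟩ := coeff_of_span (s2 (h2 β hβ))
      have e : ∑ d ∈ D, ((2 / ⟪β, β⟫) * n d) • d = ∑ d ∈ D, ((m d : ℝ) * (2 / ⟪d, d⟫)) • d := by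
        simp only [mul_smul, ← Finset.smul_sum]
        rw [← hn]; exact hm
      have hi := B.indep _ _ e δ hδ
      have hmd : (m δ : ℝ) * c = n δ * d := by
        rw [← hc, ← hd, inner_coroot, inner_coroot, real_inner_comm β δ]
        field_simp at hi ⊢
        linear_combination - hi
      have hdp : (0 : ℝ) < d := by rw [← hd, inner_coroot, real_inner_comm]; positivity
      have hmpos : (0 : ℝ) < m δ := by
        by_contra h
        push Not at h
        have a1 : (m δ : ℝ) * c ≤ 0 := mul_nonpos_of_nonpos_of_nonneg h hc0.le
        have a2 : 0 < (n δ : ℝ) * d := mul_pos hnp hdp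
        linarith
      have hlt : (n δ : ℝ) < c := by exact_mod_cast (not_le.mp hle)
      have hmlt : (m δ : ℝ) < d := by
        by_contra h
        push Not at h
        have a1 : (d : ℝ) * c ≤ m δ * c := mul_le_mul_of_nonneg_right h hc0.le
        have a2 : (n δ : ℝ) * d < c * d := mul_lt_mul_of_pos_right hlt hdp
        linarith
      have i1 : 0 < n δ := by exact_mod_cast hnp
      have i2 : 0 < m δ := by exact_mod_cast hmpos
      have i3 : m δ < d := by exact_mod_cast hmlt
      have : β = δ := pair_big (R.ne_zero hβ) (R.ne_zero hδΦ)
        (by rw [hc]; exact_mod_cast (by omega : 2 ≤ c))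
        (by rw [hd]; exact_mod_cast (by omega : 2 ≤ d))
      rw [this]; exact B.sub hδ
  intro α ha
  -- dominant element in the orbit
  obtain ⟨β, hβ, hmax⟩ := Finset.exists_max_image (Φ.filter (fun β => ∃ w ∈ weylGroup Φ', β = w.val α))
    (fun β => ⟪x, β⟫) ⟨α, Finset.mem_filter.mpr ⟨ha, 1, one_mem _, rfl⟩⟩
  obtain ⟨hβΦ, w, hw, hwβ⟩ := Finset.mem_filter.mp hβ
  have hdom : ∀ δ ∈ D, 0 ≤ ⟪β, δ⟫ := by
    intro δ hδ
    by_contra h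
    push Not at h
    have hδΦ := hs (B.sub hδ)
    have h3 := hmax (reflLM δ β) (Finset.mem_filter.mpr ⟨R.hinv δ hδΦ β hβΦ, rU δ * w,
      mul_mem (rU_mem_weyl (B.sub hδ)) hw, by rw [mul_app, ← hwβ, rU_val]⟩)
    rw [reflLM_apply, inner_sub_right, real_inner_smul_right, inner_coroot] at h3
    have h4 := inner_self_pos (R.ne_zero hδΦ)
    have h5 := B.pos δ hδ
    have h6 : 2 * ⟪β, δ⟫ / ⟪δ, δ⟫ < 0 := div_neg_of_neg_of_pos (by linarith) h4
    have h7 := mul_neg_of_neg_of_pos h6 h5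
    linarith
  have hsp := s1 (h1 β hβΦ)
  rw [← Set.image_id (D : Set V)] at hsp
  obtain ⟨n, hn⟩ := coeff_of_span hsp
  simp only [id] at hn
  have hnn := dom_nonneg B.pos B.obt (fun d => (n d : ℝ)) (by rw [← hn]; exact hdom)
  have hβ' : β ∈ Φ' := by
    refine hdesc _ β (fun d => (n d).toNat) hβΦ ?_ rfl
    rw [hn]
    refine Finset.sum_congr rfl fun d hd => ?_
    have h8 : 0 ≤ n d := by exact_mod_cast hnn d hd
    rw [toNat_cast h8]
  have := R'.weyl_mem (inv_mem hw) β hβ'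
  rwa [hwβ, inv_app] at this

/-! ### Assembly -/

lemma base_facts [FiniteDimensional ℝ V] {n : ℕ} (hdim : Module.finrank ℝ V = n)
    {Φ : Finset V} (R : RS Φ) (hspan : Submodule.span ℝ (Φ : Set V) = ⊤)
    (Δ : Fin n → V) (hΔ : ∀ i, Δ i ∈ Φ)
    (hbase : ∀ α ∈ Φ, ∃ c : Fin n → ℤ,
        α = ∑ i, (c i : ℝ) • Δ i ∧ ((∀ i, 0 ≤ c i) ∨ (∀ i, c i ≤ 0))) :
    LinearIndependent ℝ Δ ∧ (∀ α ∈ Φ, α ∈ Submodule.span ℤ (Set.range Δ)) ∧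
      (∀ α ∈ Φ, coroot α ∈ Submodule.span ℤ (Set.range fun i => coroot (Δ i))) := by
  classical
  have htop : ⊤ ≤ Submodule.span ℝ (Set.range Δ) := by
    rw [← hspan, Submodule.span_le]
    intro α ha
    obtain ⟨c, hc, -⟩ := hbase α ha
    rw [hc]
    exact Submodule.sum_mem _ fun i _ => Submodule.smul_mem _ _ (Submodule.subset_span ⟨i, rfl⟩)
  have hli : LinearIndependent ℝ Δ :=
    linearIndependent_of_top_le_span_of_card_eq_finrank htop (by simp [hdim])
  set b : Basis (Fin n) ℝ V := Basis.mk hli htop with hb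
  have hbΔ : ∀ i, b i = Δ i := fun i => by rw [hb, Basis.mk_apply]
  set x : V := (InnerProductSpace.toDual ℝ V).symm
    (LinearMap.toContinuousLinearMap (b.constr ℝ (fun _ => (1 : ℝ)))) with hx
  have hx1 : ∀ i, ⟪x, Δ i⟫ = 1 := by
    intro i
    rw [hx, InnerProductSpace.toDual_symm_apply, ← hbΔ]
    simp [Basis.constr_basis]
  have hxs : ∀ c : Fin n → ℤ, ⟪x, ∑ i, (c i : ℝ) • Δ i⟫ = ((∑ i, c i : ℤ) : ℝ) := by
    intro c
    rw [inner_sum]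
    simp [real_inner_smul_right, hx1]
  have hinj := hli.injective
  have B : IsBase Φ (Finset.univ.image Δ) x := by
    refine ⟨?_, ?_, ?_, ?_, ?_⟩
    · intro α ha
      obtain ⟨i, -, rfl⟩ := Finset.mem_image.mp ha
      exact hΔ i
    · intro α ha
      obtain ⟨i, -, rfl⟩ := Finset.mem_image.mp ha
      rw [hx1]; exact one_pos
    · intro α ha h0
      obtain ⟨c, hc, hs⟩ := hbase α ha
      rw [hc, hxs] at h0
      have h1 : ∑ i, c i = 0 := by exact_mod_cast h0
      have h2 : ∀ i, c i = 0 := by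
        rcases hs with hs | hs
        · intro i
          exact (Finset.sum_eq_zero_iff_of_nonneg (fun i _ => hs i)).mp h1 i (Finset.mem_univ _)
        · intro i
          exact (Finset.sum_eq_zero_iff_of_nonpos (fun i _ => hs i)).mp h1 i (Finset.mem_univ _)
      exact R.ne_zero ha (by rw [hc]; simp [h2])
    · intro α ha hp
      obtain ⟨c, hc, hs⟩ := hbase α ha
      rw [hc, hxs] at hp
      have h1 : 0 < ∑ i, c i := by exact_mod_cast hp
      have h2 : ∀ i, 0 ≤ c i := by
        rcases hs with hs | hs
        · exact hs
        · exact absurd h1 (not_lt.mpr (Finset.sum_nonpos fun i _ => hs i))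
      refine ⟨Function.extend Δ (fun i => (c i).toNat) 0, ?_⟩
      rw [Finset.sum_image (fun i _ j _ h => hinj h), hc]
      refine Finset.sum_congr rfl fun i _ => ?_
      rw [hinj.extend_apply, toNat_cast (h2 i)]
    · intro α ha β hβ hne
      obtain ⟨i, -, rfl⟩ := Finset.mem_image.mp ha
      obtain ⟨j, -, rfl⟩ := Finset.mem_image.mp hβ
      have hij : i ≠ j := fun h => hne (by rw [h])
      obtain ⟨c, hc, hs⟩ := hbase _ (R.hinv _ (hΔ j) _ (hΔ i))
      rw [reflLM_apply] at hc
      have hr : ∀ k, b.repr (Δ i - ⟪Δ i, coroot (Δ j)⟫ • Δ j) k = c k := by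
        intro k
        rw [hc]
        simp only [← hbΔ, map_sum, map_smul, Basis.repr_self]
        simp [Finsupp.single_apply]
      have h1 := hr i
      have h2 := hr j
      simp only [← hbΔ, map_sub, map_smul, Basis.repr_self, Finsupp.sub_apply,
        Finsupp.smul_apply, Finsupp.single_eq_same, Finsupp.single_apply, hij, hij.symm, if_false,
        if_true, smul_eq_mul, mul_zero, mul_one, sub_zero, zero_sub] at h1 h2
      have h3 : c i = 1 := by exact_mod_cast h1.symm
      have h4 : 0 ≤ c j := by
        rcases hs with hs | hs
        · exact hs j
        · have := hs i; omega
      have h5 : (0 : ℝ) ≤ c j := by exact_mod_cast h4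
      rw [← h2, hbΔ, hbΔ, inner_coroot] at h5
      by_contra hcon
      push Not at hcon
      have := inner_self_pos (R.ne_zero (hΔ j))
      have : 0 < 2 * ⟪Δ i, Δ j⟫ / ⟪Δ j, Δ j⟫ := by positivity
      linarith
  have himg : ((Finset.univ.image Δ : Finset V) : Set V) = Set.range Δ := by simp
  have himg' : coroot '' ((Finset.univ.image Δ : Finset V) : Set V) =
      Set.range fun i => coroot (Δ i) := by
    rw [himg, ← Set.range_comp]; rfl
  refine ⟨hli, ?_, ?_⟩
  · intro α ha
    obtain ⟨w, hw, δ, hδ, rfl⟩ := B.exists_conj R α ha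
    rw [← himg]
    exact (span_orbit R B.sub hw hδ).1
  · intro α ha
    obtain ⟨w, hw, δ, hδ, rfl⟩ := B.exists_conj R α ha
    rw [← himg']
    exact (span_orbit R B.sub hw hδ).2

open Classical in
/-- the roots whose reflection lies in `H` -/
noncomputable def filt (Φ : Finset V) (H : Subgroup (V →ₗ[ℝ] V)ˣ) : Finset V :=
  Φ.filter (fun α => rU α ∈ H)

lemma mem_filt {Φ : Finset V} {H : Subgroup (V →ₗ[ℝ] V)ˣ} {α : V} :
    α ∈ filt Φ H ↔ α ∈ Φ ∧ rU α ∈ H := by simp [filt]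

lemma filt_sub {Φ : Finset V} {H : Subgroup (V →ₗ[ℝ] V)ˣ} : filt Φ H ⊆ Φ :=
  fun _ h => (mem_filt.mp h).1

lemma weyl_filt_le {Φ : Finset V} {H : Subgroup (V →ₗ[ℝ] V)ˣ} : weylGroup (filt Φ H) ≤ H := by
  rw [weylGroup, Subgroup.closure_le]
  intro w hw
  obtain ⟨α, ha, rfl⟩ := mem_reflSet.mp hw
  exact (mem_filt.mp ha).2

lemma filt_RS {Φ : Finset V} (R : RS Φ) (H : Subgroup (V →ₗ[ℝ] V)ˣ) : RS (filt Φ H) := by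
  refine ⟨fun h => R.h0 (filt_sub h), fun α h c hc => R.hred α (filt_sub h) c (filt_sub hc),
      fun α h β hβ => R.hcrys α (filt_sub h) β (filt_sub hβ), ?_⟩
  intro α ha β hb
  refine mem_filt.mpr ⟨R.hinv α (filt_sub ha) β (filt_sub hb), ?_⟩
  have hI : Isom (rU α) := reflLM_inner α
  have := rU_conj hI β
  rw [rU_val] at this
  rw [this]
  exact mul_mem (mul_mem (mem_filt.mp ha).2 (mem_filt.mp hb).2) (inv_mem (mem_filt.mp ha).2)

lemma gen_of_span {Φ : Finset V} (R : RS Φ) {n : ℕ} {ρ : Fin n → V} (hρ : ∀ i, ρ i ∈ Φ)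
    (h1 : ∀ α ∈ Φ, α ∈ Submodule.span ℤ (Set.range ρ))
    (h2 : ∀ α ∈ Φ, coroot α ∈ Submodule.span ℤ (Set.range fun i => coroot (ρ i))) :
    Subgroup.closure (Set.range fun i => rU (ρ i)) = weylGroup Φ := by
  set H := Subgroup.closure (Set.range fun i => rU (ρ i)) with hH
  have hρ' : ∀ i, ρ i ∈ filt Φ H := fun i =>
    mem_filt.mpr ⟨hρ i, Subgroup.subset_closure ⟨i, rfl⟩⟩
  have hsub := eq_of_lattice R (filt_RS R H) filt_sub
    (fun α ha => Submodule.span_mono (by rintro _ ⟨i, rfl⟩; exact hρ' i) (h1 α ha))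
    (fun α ha => Submodule.span_mono (by rintro _ ⟨i, rfl⟩; exact ⟨ρ i, hρ' i, rfl⟩) (h2 α ha))
  refine le_antisymm ?_ ((weyl_mono hsub).trans weyl_filt_le)
  rw [hH, Subgroup.closure_le]
  rintro _ ⟨i, rfl⟩
  exact rU_mem_weyl (hρ i)

lemma det_rho [FiniteDimensional ℝ V] {n : ℕ} (hdim : Module.finrank ℝ V = n) {ρ : Fin n → V}
    (htop : Submodule.span ℝ (Set.range ρ) = ⊤) :
    |LinearMap.det (((List.ofFn fun i => rU (ρ i)).prod : (V →ₗ[ℝ] V)ˣ).val - LinearMap.id)| =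
      |pairingDet ρ| := by
  have hli : LinearIndependent ℝ ρ :=
    linearIndependent_of_top_le_span_of_card_eq_finrank htop.ge (by simp [hdim])
  have := det_formula (Basis.mk hli htop.ge)
  simpa only [Basis.coe_mk] using this

lemma rLen_eq [FiniteDimensional ℝ V] {n : ℕ} (hdim : Module.finrank ℝ V = n) {Φ : Finset V}
    {g : (V →ₗ[ℝ] V)ˣ} {ρ : Fin n → V} (hρ : ∀ i, ρ i ∈ Φ)
    (hp : (List.ofFn fun i => rU (ρ i)).prod = g) (hfix : ∀ v, g.val v = v → v = 0) :
    rLen Φ g = n := by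
  have hmem : n ∈ {k | ∃ l : List (V →ₗ[ℝ] V)ˣ,
    (∀ x ∈ l, x ∈ reflSet Φ) ∧ l.prod = g ∧ l.length = k} := by
    refine ⟨_, ?_, hp, by simp⟩
    intro x hx
    obtain ⟨i, rfl⟩ := (List.mem_ofFn' _ _).mp hx
    exact mem_reflSet.mpr ⟨ρ i, hρ i, rfl⟩
  refine le_antisymm (Nat.sInf_le hmem) (le_csInf ⟨n, hmem⟩ ?_)
  rintro k ⟨l, hl, rfl, rfl⟩
  have : ∃ l' : List V, l'.map rU = l := by
    clear hp hfix hmem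
    induction l with
    | nil => exact ⟨[], rfl⟩
    | cons a l ih =>
      obtain ⟨l', h⟩ := ih (fun x hx => hl x (List.mem_cons_of_mem _ hx))
      obtain ⟨α, -, e⟩ := mem_reflSet.mp (hl a List.mem_cons_self)
      exact ⟨α :: l', by rw [List.map_cons, h, e]⟩
  obtain ⟨l', rfl⟩ := this
  have := length_of_fix hfix
  rw [List.length_map]
  omega

lemma exists_rho [FiniteDimensional ℝ V] {n : ℕ} (hdim : Module.finrank ℝ V = n) {Φ : Finset V}
    (R : RS Φ) {g : (V →ₗ[ℝ] V)ˣ} (hg : g ∈ weylGroup Φ) (hfix : ∀ v, g.val v = v → v = 0) :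
    ∃ ρ : Fin n → V, (∀ i, ρ i ∈ Φ) ∧ (List.ofFn fun i => rU (ρ i)).prod = g ∧
      Submodule.span ℝ (Set.range ρ) = ⊤ := by
  obtain ⟨l, hl, rfl, hlen⟩ := carter R n g hg (by omega)
  have h1 := length_of_fix hfix
  have h2 := span_of_fix hfix
  have h3 : l.length = n := by omega
  subst h3
  refine ⟨l.get, fun i => hl _ (List.get_mem l i), ?_, ?_⟩
  · congr 1
    conv_rhs => rw [← List.ofFn_get l]
    rw [List.map_ofFn]; rfl
  · rw [← h2]
    congr 1
    ext a
    simp [List.mem_iff_get]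

lemma fix_of_det [FiniteDimensional ℝ V] {g : (V →ₗ[ℝ] V)ˣ}
    (h : LinearMap.det (g.val - LinearMap.id) ≠ 0) : ∀ v, g.val v = v → v = 0 := by
  intro v hv
  have := (LinearMap.equivOfDetNeZero _ h).injective
  apply this
  rw [map_zero]
  change (g.val - (LinearMap.id : V →ₗ[ℝ] V)) v = 0
  rw [LinearMap.sub_apply, hv]; simp

lemma span_top_of_int {Φ : Finset V} (hspan : Submodule.span ℝ (Φ : Set V) = ⊤) {k : ℕ}
    {ρ : Fin k → V} (h : ∀ α ∈ Φ, α ∈ Submodule.span ℤ (Set.range ρ)) :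
    Submodule.span ℝ (Set.range ρ) = ⊤ := by
  rw [eq_top_iff, ← hspan, Submodule.span_le]
  intro α ha
  have := h α ha
  rw [Submodule.mem_span_range_iff_exists_fun] at this
  obtain ⟨c, rfl⟩ := this
  exact Submodule.sum_mem _ fun i _ => by
    rw [← Int.cast_smul_eq_zsmul ℝ]
    exact Submodule.smul_mem _ _ (Submodule.subset_span ⟨i, rfl⟩)

/-- The core: (iii) implies everything, also relative to a subsystem. -/
lemma core [FiniteDimensional ℝ V] {n : ℕ} (hdim : Module.finrank ℝ V = n)
    {Φ Φ' : Finset V} (R : RS Φ) (R' : RS Φ') (hs : Φ' ⊆ Φ) {Δ : Fin n → V}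
    (hpos : 0 < pairingDet Δ)
    (hQ : ∀ α ∈ Φ, α ∈ Submodule.span ℤ (Set.range Δ))
    (hQ' : ∀ α ∈ Φ, coroot α ∈ Submodule.span ℤ (Set.range fun i => coroot (Δ i)))
    {g : (V →ₗ[ℝ] V)ˣ} (hg : g ∈ weylGroup Φ')
    (hdet : |LinearMap.det (g.val - LinearMap.id)| = pairingDet Δ) :
    ∃ ρ : Fin n → V, (∀ i, ρ i ∈ Φ') ∧ (List.ofFn fun i => rU (ρ i)).prod = g ∧
      Subgroup.closure (Set.range fun i => rU (ρ i)) = weylGroup Φ ∧ rLen Φ g = n := by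
  have hfix := fix_of_det (g := g) (by
    intro h; rw [h, abs_zero] at hdet; linarith)
  obtain ⟨ρ, hρ, hp, htop⟩ := exists_rho hdim R' hg hfix
  refine ⟨ρ, hρ, hp, ?_, rLen_eq hdim (fun i => hs (hρ i)) hp hfix⟩
  have hd := det_rho hdim htop
  rw [hp, hdet] at hd
  obtain ⟨M, hM⟩ := exists_matrix (fun i => hQ _ (hs (hρ i)))
  obtain ⟨M', hM'⟩ := exists_matrix (ρ := fun i => coroot (ρ i)) (fun i => hQ' _ (hs (hρ i)))
  rw [pairing_trans hM hM', abs_mul, abs_of_pos hpos] at hd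
  have h1 : |(M.det : ℝ) * M'.det| = 1 := by
    have := mul_right_cancel₀ hpos.ne' (show 1 * pairingDet Δ = |(M.det : ℝ) * M'.det| * pairingDet Δ by rw [one_mul]; exact hd)
    exact this.symm
  have h2 : |M.det * M'.det| = 1 := by exact_mod_cast h1
  have h3 : IsUnit (M.det * M'.det) := Int.isUnit_iff_abs_eq.mpr h2
  have u1 := isUnit_of_mul_isUnit_left h3
  have u2 := isUnit_of_mul_isUnit_right h3
  refine gen_of_span R (fun i => hs (hρ i)) ?_ ?_
  · intro α ha
    refine (Submodule.span_le.mpr ?_) (hQ α ha)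
    rintro _ ⟨j, rfl⟩
    exact span_of_unit hM u1 j
  · intro α ha
    refine (Submodule.span_le.mpr ?_) (hQ' α ha)
    rintro _ ⟨j, rfl⟩
    exact span_of_unit hM' u2 j

lemma det_of_span [FiniteDimensional ℝ V] {n : ℕ} (hdim : Module.finrank ℝ V = n)
    {Φ : Finset V} (hspan : Submodule.span ℝ (Φ : Set V) = ⊤) {Δ : Fin n → V}
    (hΔ : ∀ i, Δ i ∈ Φ) (hpos : 0 < pairingDet Δ)
    (hQ : ∀ α ∈ Φ, α ∈ Submodule.span ℤ (Set.range Δ))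
    (hQ' : ∀ α ∈ Φ, coroot α ∈ Submodule.span ℤ (Set.range fun i => coroot (Δ i)))
    {ρ : Fin n → V} (hρ : ∀ i, ρ i ∈ Φ)
    (h1 : ∀ α ∈ Φ, α ∈ Submodule.span ℤ (Set.range ρ))
    (h2 : ∀ α ∈ Φ, coroot α ∈ Submodule.span ℤ (Set.range fun i => coroot (ρ i))) :
    |LinearMap.det (((List.ofFn fun i => rU (ρ i)).prod : (V →ₗ[ℝ] V)ˣ).val - LinearMap.id)| =
      pairingDet Δ := by
  rw [det_rho hdim (span_top_of_int hspan h1)]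
  obtain ⟨M, hM⟩ := exists_matrix (fun i => hQ _ (hρ i))
  obtain ⟨M', hM'⟩ := exists_matrix (ρ := fun i => coroot (ρ i)) (fun i => hQ' _ (hρ i))
  obtain ⟨N, hN⟩ := exists_matrix (fun i => h1 _ (hΔ i))
  obtain ⟨N', hN'⟩ := exists_matrix (ρ := fun i => coroot (Δ i)) (fun i => h2 _ (hΔ i))
  have e1 := pairing_trans hM hM'
  have e2 := pairing_trans hN hN'
  rw [e1, ← mul_assoc] at e2
  have e3 : (1 : ℝ) = N.det * N'.det * (M.det * M'.det) :=
    mul_right_cancel₀ hpos.ne' (by rw [one_mul]; exact e2)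
  have e4 : N.det * N'.det * (M.det * M'.det) = 1 := by exact_mod_cast e3.symm
  have u : IsUnit (M.det * M'.det) := IsUnit.of_mul_eq_one_right _ e4
  have e5 : |(M.det : ℝ) * M'.det| = 1 := by exact_mod_cast Int.isUnit_iff_abs_eq.mp u
  rw [e1, abs_mul, e5, one_mul, abs_of_pos hpos]

lemma mkBasis {k : ℕ} {L : Submodule ℤ V} {ρ : Fin k → V} (hli : LinearIndependent ℝ ρ)
    (hL : Submodule.span ℤ (Set.range ρ) = L) :
    ∃ b : Basis (Fin k) ℤ L, ∀ i, (b i : V) = ρ i := by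
  subst hL
  have h : LinearIndependent ℤ ρ := hli.restrict_scalars' ℤ
  exact ⟨Basis.span h, fun i => congrArg Subtype.val (Basis.span_apply h i)⟩

lemma span_of_basis {k : ℕ} {L : Submodule ℤ V} {ρ : Fin k → V} (b : Basis (Fin k) ℤ L)
    (hb : ∀ i, (b i : V) = ρ i) {v : V} (hv : v ∈ L) : v ∈ Submodule.span ℤ (Set.range ρ) := by
  have h1 := congrArg (Submodule.map L.subtype) b.span_eq
  rw [Submodule.map_span, ← Set.range_comp, Submodule.map_top, Submodule.range_subtype] at h1
  rw [← h1] at hv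
  have : (L.subtype ∘ b : Fin k → V) = ρ := funext hb
  rwa [this] at hv

lemma coroot_li {k : ℕ} {ρ : Fin k → V} (hli : LinearIndependent ℝ ρ) :
    LinearIndependent ℝ (fun i => coroot (ρ i)) :=
  hli.units_smul (fun i => Units.mk0 (2 / ⟪ρ i, ρ i⟫)
    (div_pos two_pos (inner_self_pos (hli.ne_zero i))).ne')

end QCox

open WRoot in
/-- for the Weyl group `W` of a reduced crystallographic root system `Φ`
of rank `n` and `g ∈ W`, the following are equivalent: (i) `g` is a quasi-Coxeter
element; (ii) some reduced reflection factorization of `g` has associated roots a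
`ℤ`-basis of the root lattice and associated coroots a `ℤ`-basis of the coroot
lattice; (iii) `|det (g - 1)| = I(W)`; (iv) `g` lies in no proper reflection subgroup
of `W`. -/
theorem quasiCoxeter_characterization_weyl
    {V : Type*} [NormedAddCommGroup V] [InnerProductSpace ℝ V]
    [FiniteDimensional ℝ V] {n : ℕ} (hdim : Module.finrank ℝ V = n)
    (Φ : Finset V) (h0 : (0 : V) ∉ Φ)
    (hspan : Submodule.span ℝ (Φ : Set V) = ⊤)
    (hred : ∀ α ∈ Φ, ∀ c : ℝ, c • α ∈ Φ → c = 1 ∨ c = -1)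
    (hcrys : ∀ α ∈ Φ, ∀ β ∈ Φ, ∃ z : ℤ, ⟪α, coroot β⟫ = (z : ℝ))
    (hinv : ∀ α ∈ Φ, ∀ β ∈ Φ, reflLM α β ∈ Φ)
    (Δ : Fin n → V) (hΔ : ∀ i, Δ i ∈ Φ)
    (hbase : ∀ α ∈ Φ, ∃ c : Fin n → ℤ,
        α = ∑ i, (c i : ℝ) • Δ i ∧ ((∀ i, 0 ≤ c i) ∨ (∀ i, c i ≤ 0)))
    (g : (V →ₗ[ℝ] V)ˣ) (hg : g ∈ weylGroup Φ) :
    -- (i): `g` is a quasi-Coxeter element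
    ((∃ t : Fin n → (V →ₗ[ℝ] V)ˣ, (∀ i, t i ∈ reflSet Φ) ∧
        (List.ofFn t).prod = g ∧
        Subgroup.closure (Set.range t) = weylGroup Φ ∧ rLen Φ g = n) ↔
    -- (ii): roots/coroots of a reduced factorization give lattice bases
      (∃ (k : ℕ) (t : Fin k → (V →ₗ[ℝ] V)ˣ) (ρ : Fin k → V),
        k = rLen Φ g ∧ (∀ i, ρ i ∈ Φ) ∧
        (∀ i, (t i : V →ₗ[ℝ] V) = reflLM (ρ i)) ∧ (List.ofFn t).prod = g ∧
        (∃ b : Basis (Fin k) ℤ (Submodule.span ℤ (Φ : Set V)),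
          ∀ i, (b i : V) = ρ i) ∧
        (∃ b : Basis (Fin k) ℤ (Submodule.span ℤ (coroot '' (Φ : Set V))),
          ∀ i, (b i : V) = coroot (ρ i)))) ∧
    -- (i) ↔ (iii): `|det (g - I_V)| = I(W)`
    ((∃ t : Fin n → (V →ₗ[ℝ] V)ˣ, (∀ i, t i ∈ reflSet Φ) ∧
        (List.ofFn t).prod = g ∧
        Subgroup.closure (Set.range t) = weylGroup Φ ∧ rLen Φ g = n) ↔
      |LinearMap.det ((g : V →ₗ[ℝ] V) - LinearMap.id)| = pairingDet Δ) ∧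
    -- (i) ↔ (iv): `g` lies in no proper reflection subgroup of `W`
    ((∃ t : Fin n → (V →ₗ[ℝ] V)ˣ, (∀ i, t i ∈ reflSet Φ) ∧
        (List.ofFn t).prod = g ∧
        Subgroup.closure (Set.range t) = weylGroup Φ ∧ rLen Φ g = n) ↔
      ∀ S ⊆ reflSet Φ, g ∈ Subgroup.closure S →
        Subgroup.closure S = weylGroup Φ) := by
  classical
  have R : QCox.RS Φ := ⟨h0, hred, hcrys, hinv⟩
  obtain ⟨hliΔ, hQ, hQ'⟩ := QCox.base_facts hdim R hspan Δ hΔ hbase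
  have hpos := QCox.pairing_pos Δ hliΔ
  -- (iii) → (i)
  have h31 : |LinearMap.det ((g : V →ₗ[ℝ] V) - LinearMap.id)| = pairingDet Δ →
      ∃ t : Fin n → (V →ₗ[ℝ] V)ˣ, (∀ i, t i ∈ reflSet Φ) ∧
        (List.ofFn t).prod = g ∧
        Subgroup.closure (Set.range t) = weylGroup Φ ∧ rLen Φ g = n := by
    intro h
    obtain ⟨ρ, hρ, hp, hc, hr⟩ := QCox.core hdim R R (Finset.Subset.refl _) hpos hQ hQ' hg h
    exact ⟨fun i => QCox.rU (ρ i), fun i => QCox.mem_reflSet.mpr ⟨ρ i, hρ i, rfl⟩, hp, hc, hr⟩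
  -- (i) → (ii)
  have h12 : (∃ t : Fin n → (V →ₗ[ℝ] V)ˣ, (∀ i, t i ∈ reflSet Φ) ∧
        (List.ofFn t).prod = g ∧
        Subgroup.closure (Set.range t) = weylGroup Φ ∧ rLen Φ g = n) →
      (∃ (k : ℕ) (t : Fin k → (V →ₗ[ℝ] V)ˣ) (ρ : Fin k → V),
        k = rLen Φ g ∧ (∀ i, ρ i ∈ Φ) ∧
        (∀ i, (t i : V →ₗ[ℝ] V) = reflLM (ρ i)) ∧ (List.ofFn t).prod = g ∧
        (∃ b : Basis (Fin k) ℤ (Submodule.span ℤ (Φ : Set V)),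
          ∀ i, (b i : V) = ρ i) ∧
        (∃ b : Basis (Fin k) ℤ (Submodule.span ℤ (coroot '' (Φ : Set V))),
          ∀ i, (b i : V) = coroot (ρ i))) := by
    rintro ⟨t, ht, hp, hc, hr⟩
    choose ρ hρ htρ using fun i => QCox.mem_reflSet.mp (ht i)
    have hD : (Finset.univ.image ρ : Finset V) ⊆ Φ := by
      intro a ha
      obtain ⟨i, -, rfl⟩ := Finset.mem_image.mp ha
      exact hρ i
    have hW : weylGroup (Finset.univ.image ρ : Finset V) = weylGroup Φ := by
      rw [← hc, weylGroup]
      congr 1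
      ext w
      rw [QCox.mem_reflSet]
      constructor
      · rintro ⟨a, ha, rfl⟩
        obtain ⟨i, -, rfl⟩ := Finset.mem_image.mp ha
        exact ⟨i, htρ i⟩
      · rintro ⟨i, rfl⟩
        exact ⟨ρ i, Finset.mem_image_of_mem _ (Finset.mem_univ _), htρ i⟩
    have himg : ((Finset.univ.image ρ : Finset V) : Set V) = Set.range ρ := by simp
    have himg' : coroot '' ((Finset.univ.image ρ : Finset V) : Set V) =
        Set.range fun i => coroot (ρ i) := by
      rw [himg, ← Set.range_comp]; rfl
    have s1 : ∀ α ∈ Φ, α ∈ Submodule.span ℤ (Set.range ρ) := by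
      intro α ha
      rw [← himg]; exact (QCox.span_of_gen R hD hW ha).1
    have s2 : ∀ α ∈ Φ, coroot α ∈ Submodule.span ℤ (Set.range fun i => coroot (ρ i)) := by
      intro α ha
      rw [← himg']; exact (QCox.span_of_gen R hD hW ha).2
    have hli : LinearIndependent ℝ ρ :=
      linearIndependent_of_top_le_span_of_card_eq_finrank (QCox.span_top_of_int hspan s1).ge
        (by simp [hdim])
    refine ⟨n, t, ρ, hr.symm, hρ, fun i => by rw [htρ i]; rfl, hp,
      QCox.mkBasis hli ?_, QCox.mkBasis (QCox.coroot_li hli) ?_⟩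
    · refine le_antisymm (Submodule.span_mono ?_) (Submodule.span_le.mpr s1)
      rintro _ ⟨i, rfl⟩; exact hρ i
    · refine le_antisymm (Submodule.span_mono ?_) (Submodule.span_le.mpr ?_)
      · rintro _ ⟨i, rfl⟩; exact ⟨ρ i, hρ i, rfl⟩
      · rintro _ ⟨α, ha, rfl⟩; exact s2 α ha
  -- (ii) → (iii)
  have h23 : (∃ (k : ℕ) (t : Fin k → (V →ₗ[ℝ] V)ˣ) (ρ : Fin k → V),
        k = rLen Φ g ∧ (∀ i, ρ i ∈ Φ) ∧
        (∀ i, (t i : V →ₗ[ℝ] V) = reflLM (ρ i)) ∧ (List.ofFn t).prod = g ∧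
        (∃ b : Basis (Fin k) ℤ (Submodule.span ℤ (Φ : Set V)),
          ∀ i, (b i : V) = ρ i) ∧
        (∃ b : Basis (Fin k) ℤ (Submodule.span ℤ (coroot '' (Φ : Set V))),
          ∀ i, (b i : V) = coroot (ρ i))) →
      |LinearMap.det ((g : V →ₗ[ℝ] V) - LinearMap.id)| = pairingDet Δ := by
    rintro ⟨k, t, ρ, -, hρ, ht, hp, ⟨b, hb⟩, ⟨b', hb'⟩⟩
    obtain ⟨bΔ, -⟩ := QCox.mkBasis (L := Submodule.span ℤ (Φ : Set V)) hliΔ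
      (le_antisymm (Submodule.span_mono (by rintro _ ⟨i, rfl⟩; exact hΔ i))
        (Submodule.span_le.mpr hQ))
    have hk : k = n := by
      have e1 := Module.finrank_eq_card_basis b
      have e2 := Module.finrank_eq_card_basis bΔ
      rw [Fintype.card_fin] at e1 e2
      omega
    subst hk
    have hte : t = fun i => QCox.rU (ρ i) := funext fun i => Units.ext (ht i)
    rw [← hp, hte]
    exact QCox.det_of_span hdim hspan hΔ hpos hQ hQ' hρ
      (fun α ha => QCox.span_of_basis b hb (Submodule.subset_span ha))
      (fun α ha => QCox.span_of_basis b' hb' (Submodule.subset_span ⟨α, ha, rfl⟩))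
  refine ⟨⟨h12, fun h => h31 (h23 h)⟩, ⟨fun h => h23 (h12 h), h31⟩, ⟨?_, ?_⟩⟩
  · -- (i) → (iv)
    intro h S hS hgS
    have hle : Subgroup.closure S ≤ weylGroup Φ := Subgroup.closure_mono hS
    have hgF : g ∈ weylGroup (QCox.filt Φ (Subgroup.closure S)) := by
      have : Subgroup.closure S ≤ weylGroup (QCox.filt Φ (Subgroup.closure S)) := by
        rw [Subgroup.closure_le]
        intro w hw
        obtain ⟨α, ha, rfl⟩ := QCox.mem_reflSet.mp (hS hw)
        exact QCox.rU_mem_weyl (QCox.mem_filt.mpr ⟨ha, Subgroup.subset_closure hw⟩)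
      exact this hgS
    obtain ⟨ρ, hρ, -, hc, -⟩ := QCox.core hdim R (QCox.filt_RS R (Subgroup.closure S))
      QCox.filt_sub hpos hQ hQ' hgF (h23 (h12 h))
    refine le_antisymm hle ?_
    rw [← hc, Subgroup.closure_le]
    rintro _ ⟨i, rfl⟩
    exact (QCox.mem_filt.mp (hρ i)).2
  · -- (iv) → (i)
    intro h
    have hfix : ∀ v, (g : V →ₗ[ℝ] V) v = v → v = 0 := by
      intro v hv
      have hs := R.stab hg hv
      have hW := h (reflSet (QCox.perp Φ v)) (by
        intro w hw
        obtain ⟨α, ha, rfl⟩ := QCox.mem_reflSet.mp hw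
        exact QCox.mem_reflSet.mpr ⟨α, (QCox.mem_perp.mp ha).1, rfl⟩) hs
      have hall : ∀ w ∈ weylGroup Φ, (w : V →ₗ[ℝ] V) v = v := by
        intro w hw
        rw [← hW] at hw
        obtain ⟨l, hl, rfl⟩ := QCox.exists_list hw
        clear hw
        induction l with
        | nil => simp
        | cons a l ih =>
          rw [List.map_cons, List.prod_cons, QCox.mul_app,
            ih (fun b hb => hl b (List.mem_cons_of_mem _ hb)), QCox.rU_val, QCox.reflLM_apply,
            QCox.inner_coroot, (QCox.mem_perp.mp (hl a List.mem_cons_self)).2]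
          simp
      have hperp : ∀ α ∈ Φ, ⟪v, α⟫ = 0 := by
        intro α ha
        have h1 := hall _ (QCox.rU_mem_weyl ha)
        rw [QCox.rU_val, QCox.reflLM_apply, QCox.inner_coroot, sub_eq_self] at h1
        have h2 := QCox.inner_self_pos (R.ne_zero ha)
        rcases smul_eq_zero.mp h1 with h3 | h3
        · rcases div_eq_zero_iff.mp h3 with h4 | h4
          · linarith
          · linarith
        · exact absurd h3 (R.ne_zero ha)
      have hbot : v ∈ (Submodule.span ℝ (Φ : Set V))ᗮ := by
        rw [Submodule.mem_orthogonal']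
        intro u hu
        induction hu using Submodule.span_induction with
        | mem x hx => exact hperp x hx
        | zero => simp
        | add x y _ _ hx hy => rw [inner_add_right, hx, hy, add_zero]
        | smul a x _ hx => rw [real_inner_smul_right, hx, mul_zero]
      rw [hspan, Submodule.top_orthogonal_eq_bot] at hbot
      simpa using hbot
    obtain ⟨ρ, hρ, hp, -⟩ := QCox.exists_rho hdim R hg hfix
    have hm : ∀ i, QCox.rU (ρ i) ∈ reflSet Φ := fun i => QCox.mem_reflSet.mpr ⟨ρ i, hρ i, rfl⟩
    refine ⟨fun i => QCox.rU (ρ i), hm, hp, ?_, QCox.rLen_eq hdim hρ hp hfix⟩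
    refine h _ (by rintro _ ⟨i, rfl⟩; exact hm i) ?_
    rw [← hp]
    refine Subgroup.list_prod_mem _ fun w hw => ?_
    obtain ⟨i, rfl⟩ := (List.mem_ofFn' _ _).mp hw
    exact Subgroup.subset_closure ⟨i, rfl⟩
end

section
/- Let g be a permutation in the symmetric group S_n with k cycles (fixed points included) of lengths λ_1, …, λ_k. Then the number of generating sets for S_n relative to g — sets T of k − 1 transpositions such that, for some reduced factorization of g into n − k transpositions, T together with the factors of that factorization generates S_n — equals n^{k−2} · λ_1 λ_2 ⋯ λ_k (an integer, equal to 1 when k = 1). -/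
open scoped Classical

namespace Comb

variable {G : Type*} [Group G]

/-- Reflection length of `g` with respect to a set `R` of "reflections". -/
noncomputable def rLen (R : Set G) (g : G) : ℕ :=
  sInf {k | ∃ l : List G, (∀ x ∈ l, x ∈ R) ∧ l.prod = g ∧ l.length = k}

/-- Reduced reflection factorizations of `g` with respect to `R`. -/
def Red (R : Set G) (g : G) : Set (List G) :=
  {l | (∀ x ∈ l, x ∈ R) ∧ l.prod = g ∧ l.length = rLen R g}

/-- Relative generating sets of `g` with respect to the reflections `R` of a group
`H` of rank `rk`: sets of `rk - ℓ_R(g)` reflections which together with the factors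
of some reduced reflection factorization of `g` generate `H`. -/
def RGS (R : Set G) (H : Subgroup G) (rk : ℕ) (g : G) : Set (Finset G) :=
  {S | ↑S ⊆ R ∧ S.card = rk - rLen R g ∧
    ∃ l ∈ Red R g, Subgroup.closure (↑S ∪ {x | x ∈ l}) = H}

end Comb

namespace Comb
variable {n : ℕ}

def merge (f : Fin n → Fin n) (u v : Fin n) : Fin n → Fin n :=
  fun x => if f x = f v then f u else f x

def Conn (f : Fin n → Fin n) (S : Set (Equiv.Perm (Fin n))) : Prop :=
  ∀ A : Set (Fin n), (∀ x y, f x = f y → x ∈ A → y ∈ A) →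
    (∀ t ∈ S, ∀ x, x ∈ A → t x ∈ A) → ∀ x y, x ∈ A → y ∈ A

lemma conn_merge (f : Fin n → Fin n) (u v : Fin n) (S : Set (Equiv.Perm (Fin n))) :
    Conn (merge f u v) S ↔ Conn f (insert (Equiv.swap u v) S) := by
  constructor
  · intro h A hA hS
    refine h A ?_ (fun t ht => hS t (Set.mem_insert_of_mem _ ht))
    have h1 := hS _ (Set.mem_insert _ _) u
    have h2 := hS _ (Set.mem_insert _ _) v
    simp only [Equiv.swap_apply_left, Equiv.swap_apply_right] at h1 h2
    intro x y hxy hx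
    unfold merge at hxy
    split_ifs at hxy with a b b
    · exact hA _ _ (a.trans b.symm) hx
    · exact hA _ _ hxy (h2 (hA _ _ a hx))
    · exact hA _ _ b.symm (h1 (hA _ _ hxy hx))
    · exact hA _ _ hxy hx
  · intro h A hA hS
    refine h A ?_ ?_
    · intro x y hxy hx
      refine hA x y ?_ hx
      simp [merge, hxy]
    · intro t ht x hx
      rcases ht with rfl | ht
      · have huv : merge f u v u = merge f u v v := by simp [merge]
        by_cases hu : x = u
        · subst hu; simpa using hA _ _ huv hx
        · by_cases hv : x = v
          · subst hv; simpa using hA _ _ huv.symm hx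
          · rwa [Equiv.swap_apply_of_ne_of_ne hu hv]
      · exact hS t ht x hx

def im (f : Fin n → Fin n) : Finset (Fin n) := Finset.univ.image f
def fib (f : Fin n → Fin n) (a : Fin n) : ℕ := (Finset.univ.filter (fun x => f x = a)).card
def P (f : Fin n → Fin n) : ℕ := ∏ a ∈ im f, fib f a

lemma im_merge (f : Fin n → Fin n) {u v : Fin n} (h : f u ≠ f v) :
    im (merge f u v) = (im f).erase (f v) := by
  ext a
  simp only [im, merge, Finset.mem_image, Finset.mem_univ, true_and, Finset.mem_erase]
  constructor
  · rintro ⟨x, rfl⟩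
    split_ifs with hx
    · exact ⟨h, u, rfl⟩
    · exact ⟨hx, x, rfl⟩
  · rintro ⟨h1, x, rfl⟩
    exact ⟨x, by simp [h1]⟩

lemma mem_im (f : Fin n → Fin n) (u : Fin n) : f u ∈ im f := by simp [im]

lemma card_im_merge (f : Fin n → Fin n) {u v : Fin n} (h : f u ≠ f v) :
    (im (merge f u v)).card + 1 = (im f).card := by
  rw [im_merge f h, Finset.card_erase_add_one (mem_im f v)]

lemma merge_eq (f : Fin n → Fin n) {u v : Fin n} (h : f u = f v) : merge f u v = f := by
  funext x; unfold merge; split_ifs with hx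
  · rw [h, hx]
  · rfl

lemma card_im_merge_le (f : Fin n → Fin n) (u v : Fin n) :
    (im f).card ≤ (im (merge f u v)).card + 1 := by
  by_cases h : f u = f v
  · rw [merge_eq f h]; omega
  · rw [card_im_merge f h]

lemma P_merge (f : Fin n → Fin n) {u v : Fin n} (h : f u ≠ f v) :
    P (merge f u v) * (fib f (f u) * fib f (f v)) = P f * (fib f (f u) + fib f (f v)) := by
  have hu : f u ∈ (im f).erase (f v) := Finset.mem_erase.2 ⟨h, mem_im f u⟩
  unfold P
  rw [im_merge f h, ← Finset.mul_prod_erase _ _ hu,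
    ← Finset.mul_prod_erase (im f) _ (mem_im f v), ← Finset.mul_prod_erase _ _ hu]
  have h1 : fib (merge f u v) (f u) = fib f (f u) + fib f (f v) := by
    unfold fib
    rw [← Finset.card_union_of_disjoint]
    · congr 1
      ext x
      simp only [Finset.mem_filter, Finset.mem_univ, true_and, Finset.mem_union]
      unfold merge
      split_ifs with hx <;> simp [hx]
    · rw [Finset.disjoint_filter]
      intro x _ h1 h2
      exact h (h1.symm.trans h2)
  have h2 : ∀ a ∈ ((im f).erase (f v)).erase (f u), fib (merge f u v) a = fib f a := by
    intro a ha
    simp only [Finset.mem_erase] at ha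
    unfold fib
    congr 1
    ext x
    simp only [Finset.mem_filter, Finset.mem_univ, true_and]
    unfold merge
    split_ifs with hx
    · rw [hx]; exact ⟨fun h => absurd h.symm ha.1, fun h => absurd h.symm ha.2.1⟩
    · rfl
  rw [Finset.prod_congr rfl h2, h1]
  ring

lemma conn_card (_hn : 0 < n) (S : Finset (Equiv.Perm (Fin n))) :
    ∀ f : Fin n → Fin n, (∀ t ∈ S, t.IsSwap) → Conn f S → (im f).card ≤ S.card + 1 := by
  induction S using Finset.induction_on with
  | empty =>
    intro f _ h
    simp only [Finset.card_empty, zero_add]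
    rw [Finset.card_le_one]
    intro a ha b hb
    simp only [im, Finset.mem_image, Finset.mem_univ, true_and] at ha hb
    obtain ⟨x, rfl⟩ := ha
    obtain ⟨y, rfl⟩ := hb
    exact (h {z | f x = f z} (fun p q hpq hp => by simp_all) (by simp) x y rfl)
  | insert e S he ih =>
    intro f hS h
    obtain ⟨u, v, huv, rfl⟩ := hS e (Finset.mem_insert_self _ _)
    rw [Finset.coe_insert, ← conn_merge] at h
    have := ih _ (fun t ht => hS t (Finset.mem_insert_of_mem ht)) h
    have := card_im_merge_le f u v
    rw [Finset.card_insert_of_notMem he]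
    omega

noncomputable def Tr (f : Fin n → Fin n) : Finset (Finset (Equiv.Perm (Fin n))) :=
  Finset.univ.filter (fun S => (∀ t ∈ S, t.IsSwap) ∧ S.card + 1 = (im f).card ∧ Conn f S)

lemma mem_Tr {f : Fin n → Fin n} {S} : S ∈ Tr f ↔
  (∀ t ∈ S, t.IsSwap) ∧ S.card + 1 = (im f).card ∧ Conn f S := by simp [Tr]

lemma conn_of_le {f : Fin n → Fin n} {u v : Fin n} (h : f u = f v) {S : Set (Equiv.Perm (Fin n))}
    : Conn f (insert (Equiv.swap u v) S) ↔ Conn f S := by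
  rw [← conn_merge, merge_eq f h]

lemma ne_of_mem_Tr (hn : 0 < n) {f : Fin n → Fin n} {S} (hS : S ∈ Tr f) {u v : Fin n}
    (h : Equiv.swap u v ∈ S) : f u ≠ f v := by
  intro he
  obtain ⟨h1, h2, h3⟩ := mem_Tr.1 hS
  rw [← Finset.insert_erase h, Finset.coe_insert, conn_of_le he] at h3
  have := conn_card hn _ f (fun t ht => h1 t (Finset.mem_of_mem_erase ht)) h3
  have := Finset.card_erase_add_one h
  omega

lemma count_edge (hn : 0 < n) (f : Fin n → Fin n) {u v : Fin n} (h : f u ≠ f v) :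
    ((Tr f).filter (fun S => Equiv.swap u v ∈ S)).card = (Tr (merge f u v)).card := by
  have huv : u ≠ v := fun e => h (by rw [e])
  have hnot : ∀ S ∈ Tr (merge f u v), Equiv.swap u v ∉ S := by
    intro S hS hm
    exact ne_of_mem_Tr hn hS hm (by simp [merge])
  refine Finset.card_bij' (fun S _ => S.erase (Equiv.swap u v))
    (fun S _ => insert (Equiv.swap u v) S) ?_ ?_ ?_ ?_
  · intro S hS
    obtain ⟨hS, hm⟩ := Finset.mem_filter.1 hS
    obtain ⟨h1, h2, h3⟩ := mem_Tr.1 hS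
    refine mem_Tr.2 ⟨fun t ht => h1 t (Finset.mem_of_mem_erase ht), ?_, ?_⟩
    · have := Finset.card_erase_add_one hm
      have := card_im_merge f h
      omega
    · rwa [conn_merge, ← Finset.coe_insert, Finset.insert_erase hm]
  · intro S hS
    have hm := hnot S hS
    obtain ⟨h1, h2, h3⟩ := mem_Tr.1 hS
    refine Finset.mem_filter.2 ⟨mem_Tr.2 ⟨?_, ?_, ?_⟩, Finset.mem_insert_self _ _⟩
    · intro t ht
      rcases Finset.mem_insert.1 ht with rfl | ht
      · exact ⟨u, v, huv, rfl⟩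
      · exact h1 t ht
    · have := card_im_merge f h
      rw [Finset.card_insert_of_notMem hm]
      omega
    · rwa [Finset.coe_insert, ← conn_merge]
  · intro S hS
    exact Finset.insert_erase (Finset.mem_filter.1 hS).2
  · intro S hS
    exact Finset.erase_insert (hnot S hS)

lemma count_pairs (S : Finset (Equiv.Perm (Fin n))) (hS : ∀ t ∈ S, t.IsSwap) :
    ((Finset.univ : Finset (Fin n × Fin n)).filter
      (fun p => p.1 ≠ p.2 ∧ Equiv.swap p.1 p.2 ∈ S)).card = 2 * S.card := by
  rw [Finset.card_eq_sum_card_fiberwise (f := fun p => Equiv.swap p.1 p.2) (t := S)]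
  · rw [Finset.sum_congr rfl (g := fun _ => 2)]
    · simp [mul_comm]
    · intro t ht
      obtain ⟨u, v, huv, rfl⟩ := hS t ht
      have : ({(u, v), (v, u)} : Finset (Fin n × Fin n)).card = 2 :=
        Finset.card_pair (by simp [huv])
      rw [← this]
      congr 1
      ext ⟨a, b⟩
      simp only [Finset.mem_filter, Finset.mem_univ, true_and, Finset.mem_insert,
        Finset.mem_singleton, Prod.mk.injEq]
      constructor
      · rintro ⟨⟨hab, _⟩, h⟩
        have h1 : Equiv.swap a b u = v := by rw [h]; simp
        rw [Equiv.swap_apply_def] at h1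
        split_ifs at h1 with c d
        · left; exact ⟨c.symm, h1⟩
        · right; exact ⟨h1, d.symm⟩
        · exact absurd h1 huv
      · rintro (⟨rfl, rfl⟩ | ⟨rfl, rfl⟩)
        · exact ⟨⟨huv, ht⟩, rfl⟩
        · exact ⟨⟨huv.symm, by rwa [Equiv.swap_comm]⟩, Equiv.swap_comm _ _⟩
  · intro p hp
    simp only [Finset.coe_filter, Set.mem_ofPred_eq, Finset.mem_univ, true_and] at hp
    exact hp.2

lemma double_count (hn : 0 < n) (f : Fin n → Fin n) {j : ℕ} (hj : (im f).card = j + 1) :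
    2 * j * (Tr f).card = ∑ p : Fin n × Fin n with f p.1 ≠ f p.2, (Tr (merge f p.1 p.2)).card := by
  have h1 : ∑ S ∈ Tr f, ((Finset.univ : Finset (Fin n × Fin n)).filter
      (fun p => f p.1 ≠ f p.2 ∧ Equiv.swap p.1 p.2 ∈ S)).card = 2 * j * (Tr f).card := by
    rw [Finset.sum_congr rfl (g := fun _ => 2 * j)]
    · simp [mul_comm]
    · intro S hS
      obtain ⟨a, b, c⟩ := mem_Tr.1 hS
      have : j = S.card := by omega
      rw [this, ← count_pairs S a]
      congr 1
      ext p
      simp only [Finset.mem_filter, Finset.mem_univ, true_and]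
      constructor
      · rintro ⟨h, h'⟩
        exact ⟨fun e => h (by rw [e]), h'⟩
      · rintro ⟨h, h'⟩
        exact ⟨ne_of_mem_Tr hn hS h', h'⟩
  rw [← h1]
  have h2 : ∀ p ∈ (Finset.univ : Finset (Fin n × Fin n)).filter (fun p => f p.1 ≠ f p.2),
      (Tr (merge f p.1 p.2)).card = ((Tr f).filter (fun S => Equiv.swap p.1 p.2 ∈ S)).card := by
    intro p hp
    rw [count_edge hn f (Finset.mem_filter.1 hp).2]
  rw [Finset.sum_congr rfl h2]
  simp only [← Finset.filter_filter]
  exact Finset.sum_card_bipartiteAbove_eq_sum_card_bipartiteBelow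
    (fun (S : Finset (Equiv.Perm (Fin n))) (p : Fin n × Fin n) => Equiv.swap p.1 p.2 ∈ S)

lemma fib_pos (f : Fin n → Fin n) (u : Fin n) : 0 < fib f (f u) :=
  Finset.card_pos.2 ⟨u, by simp⟩

lemma sum_inv (f : Fin n → Fin n) : ∑ u, (1 / (fib f (f u) : ℚ)) = (im f).card := by
  rw [← Finset.sum_fiberwise_of_maps_to (t := im f) (g := f) (fun u _ => mem_im f u)]
  rw [Finset.sum_congr rfl (g := fun _ => (1 : ℚ))]
  · simp
  · intro a ha
    rw [Finset.sum_congr rfl (g := fun _ => 1 / (fib f a : ℚ))]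
    · simp only [im, Finset.mem_image, Finset.mem_univ, true_and] at ha
      obtain ⟨u, rfl⟩ := ha
      have : (fib f (f u) : ℚ) ≠ 0 := by exact_mod_cast (fib_pos f u).ne'
      rw [Finset.sum_const, nsmul_eq_mul]
      change (fib f (f u) : ℚ) * _ = 1
      field_simp
    · intro x hx
      rw [(Finset.mem_filter.1 hx).2]

lemma card_ne (f : Fin n → Fin n) (u : Fin n) :
    ((Finset.univ.filter (fun v => f u ≠ f v)).card : ℚ) = n - fib f (f u) := by
  have := Finset.card_filter_add_card_filter_not (s := (Finset.univ : Finset (Fin n))) (fun v => f v = f u)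
  rw [Finset.card_univ, Fintype.card_fin] at this
  simp only [ne_comm (a := f u), ne_eq]
  have h2 : (fib f (f u) : ℚ) + ((Finset.univ.filter (fun v => ¬ f v = f u)).card : ℚ) = n := by
    exact_mod_cast this
  linarith

lemma sum_half (f : Fin n → Fin n) :
    ∑ u, ∑ v with f u ≠ f v, (1 / (fib f (f u) : ℚ)) = n * ((im f).card - 1) := by
  have : ∀ u, ∑ v with f u ≠ f v, (1 / (fib f (f u) : ℚ)) = n * (1 / (fib f (f u) : ℚ)) - 1 := by
    intro u
    have : (fib f (f u) : ℚ) ≠ 0 := by exact_mod_cast (fib_pos f u).ne'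
    rw [Finset.sum_const, nsmul_eq_mul, card_ne]
    field_simp
  rw [Finset.sum_congr rfl (fun u _ => this u), Finset.sum_sub_distrib, ← Finset.mul_sum, sum_inv]
  simp
  ring

lemma sum_pairs (f : Fin n → Fin n) :
    ∑ p : Fin n × Fin n with f p.1 ≠ f p.2, (1 / (fib f (f p.1) : ℚ) + 1 / fib f (f p.2)) =
      2 * n * ((im f).card - 1) := by
  have e1 : ∑ p : Fin n × Fin n with f p.1 ≠ f p.2, (1 / (fib f (f p.1) : ℚ)) = n * ((im f).card - 1) := by
    rw [← sum_half, Finset.sum_filter, Fintype.sum_prod_type]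
    simp only [Finset.sum_filter]
  have e2 : ∑ p : Fin n × Fin n with f p.1 ≠ f p.2, (1 / (fib f (f p.2) : ℚ)) = n * ((im f).card - 1) := by
    rw [← sum_half, Finset.sum_filter, Fintype.sum_prod_type_right]
    simp only [Finset.sum_filter, ne_comm]
  rw [Finset.sum_add_distrib, e1, e2]
  ring

theorem card_Tr (hn : 0 < n) (j : ℕ) : ∀ f : Fin n → Fin n, (im f).card = j + 1 →
    ((Tr f).card : ℚ) * n = n ^ j * P f := by
  induction j with
  | zero =>
    intro f hf
    obtain ⟨a, ha⟩ := Finset.card_eq_one.1 hf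
    have hfa : ∀ x, f x = a := fun x => by
      have := mem_im f x
      rw [ha] at this
      simpa using this
    have hT : Tr f = {∅} := by
      ext S
      rw [mem_Tr, hf, Finset.mem_singleton]
      constructor
      · rintro ⟨_, h, _⟩
        exact Finset.card_eq_zero.1 (by omega)
      · rintro rfl
        refine ⟨by simp, by simp, ?_⟩
        intro A hA _ x y hx
        exact hA x y (by rw [hfa, hfa]) hx
    rw [hT]
    simp [P, ha, fib, hfa]
  | succ j ih =>
    intro f hf
    have hd := double_count hn f hf
    have hd' : (2 * (j + 1 : ℚ) * (Tr f).card) * n =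
        ∑ p : Fin n × Fin n with f p.1 ≠ f p.2, ((Tr (merge f p.1 p.2)).card : ℚ) * n := by
      rw [← Finset.sum_mul]
      congr 1
      exact_mod_cast hd
    have : ∀ p ∈ (Finset.univ : Finset (Fin n × Fin n)).filter (fun p => f p.1 ≠ f p.2),
        ((Tr (merge f p.1 p.2)).card : ℚ) * n =
        n ^ j * P f * (1 / (fib f (f p.1) : ℚ) + 1 / fib f (f p.2)) := by
      intro p hp
      have hne := (Finset.mem_filter.1 hp).2
      have h1 := card_im_merge f hne
      rw [ih _ (by omega), mul_assoc]
      have h2 : (P (merge f p.1 p.2) : ℚ) * (fib f (f p.1) * fib f (f p.2)) =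
        P f * (fib f (f p.1) + fib f (f p.2)) := by exact_mod_cast P_merge f hne
      have a : (fib f (f p.1) : ℚ) ≠ 0 := by exact_mod_cast (fib_pos f p.1).ne'
      have b : (fib f (f p.2) : ℚ) ≠ 0 := by exact_mod_cast (fib_pos f p.2).ne'
      congr 1
      field_simp
      linarith
    rw [Finset.sum_congr rfl this, ← Finset.mul_sum, sum_pairs, hf] at hd'
    push_cast at hd'
    have hj : (2 * (j + 1 : ℚ)) ≠ 0 := by positivity
    apply mul_left_cancel₀ hj
    rw [pow_succ]
    linarith

lemma spread (l : List (Equiv.Perm (Fin n))) : ∀ f : Fin n → Fin n, (∀ t ∈ l, t.IsSwap) →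
    ∃ f' : Fin n → Fin n, (im f).card ≤ (im f').card + l.length ∧
      (∀ x y, f x = f y → f' x = f' y) ∧ ∀ t ∈ l, ∀ x, f' (t x) = f' x := by
  induction l with
  | nil => intro f _; exact ⟨f, by simp, fun _ _ h => h, by simp⟩
  | cons e l ih =>
    intro f hl
    obtain ⟨u, v, huv, rfl⟩ := hl e (by simp)
    obtain ⟨f', h1, h2, h3⟩ := ih (merge f u v) (fun t ht => hl t (by simp [ht]))
    refine ⟨f', ?_, ?_, ?_⟩
    · have := card_im_merge_le f u v
      simp only [List.length_cons]
      omega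
    · intro x y hxy
      exact h2 x y (by simp [merge, hxy])
    · intro t ht x
      rcases List.mem_cons.1 ht with rfl | ht
      · have huv : f' u = f' v := h2 _ _ (by simp [merge])
        by_cases hu : x = u
        · subst hu; simp [huv]
        · by_cases hv : x = v
          · subst hv; simp [huv]
          · rw [Equiv.swap_apply_of_ne_of_ne hu hv]
      · exact h3 t ht x

noncomputable def cyc (g : Equiv.Perm (Fin n)) : Fin n → Fin n :=
  fun x => (Quotient.mk (Equiv.Perm.SameCycle.setoid g) x).out

lemma cyc_eq (g : Equiv.Perm (Fin n)) (x y : Fin n) : cyc g x = cyc g y ↔ g.SameCycle x y := by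
  unfold cyc
  rw [Quotient.out_inj, Quotient.eq]
  rfl

lemma same_cyc (g : Equiv.Perm (Fin n)) (x : Fin n) : g.SameCycle (cyc g x) x :=
  Quotient.mk_out (s := Equiv.Perm.SameCycle.setoid g) x

lemma cyc_self (g : Equiv.Perm (Fin n)) {a : Fin n} (ha : a ∈ im (cyc g)) : cyc g a = a := by
  simp only [im, Finset.mem_image, Finset.mem_univ, true_and] at ha
  obtain ⟨x, rfl⟩ := ha
  rw [cyc_eq]
  exact same_cyc g x

lemma inv_prod {α : Type*} (l : List (Equiv.Perm (Fin n))) (f : Fin n → α)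
    (h : ∀ t ∈ l, ∀ x, f (t x) = f x) : ∀ x, f (l.prod x) = f x := by
  induction l with
  | nil => simp
  | cons e l ih =>
    intro x
    rw [List.prod_cons, Equiv.Perm.mul_apply, h e (by simp), ih (fun t ht => h t (by simp [ht]))]

lemma inv_cycle {α : Type*} (g : Equiv.Perm (Fin n)) (f : Fin n → α)
    (h : ∀ x, f (g x) = f x) {x y} (hxy : g.SameCycle x y) : f x = f y := by
  obtain ⟨i, _, rfl⟩ := hxy.exists_pow_eq'
  generalize i = i
  induction i with
  | zero => simp
  | succ i ih => rw [pow_succ', Equiv.Perm.mul_apply, h]; exact ih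

lemma im_eq_image (g : Equiv.Perm (Fin n)) (f' : Fin n → Fin n)
    (h : ∀ x, f' (g x) = f' x) : im f' = (im (cyc g)).image f' := by
  ext a
  simp only [im, Finset.mem_image, Finset.mem_univ, true_and, exists_exists_eq_and]
  constructor
  · rintro ⟨x, rfl⟩
    exact ⟨x, inv_cycle g f' h (same_cyc g x)⟩
  · rintro ⟨x, rfl⟩
    exact ⟨_, rfl⟩

lemma im_id : im (id : Fin n → Fin n) = Finset.univ := by simp [im]

lemma len_lower (g : Equiv.Perm (Fin n)) (l : List (Equiv.Perm (Fin n)))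
    (hl : ∀ t ∈ l, t.IsSwap) (hg : l.prod = g) : n ≤ (im (cyc g)).card + l.length := by
  obtain ⟨f', h1, h2, h3⟩ := spread l id hl
  have h4 := inv_prod l f' h3
  rw [hg] at h4
  have h5 : (im f').card ≤ (im (cyc g)).card := by
    rw [im_eq_image g f' h4]; exact Finset.card_image_le
  rw [im_id, Finset.card_univ, Fintype.card_fin] at h1
  omega

lemma red_inv (g : Equiv.Perm (Fin n)) (l : List (Equiv.Perm (Fin n)))
    (hl : ∀ t ∈ l, t.IsSwap) (hg : l.prod = g) (hlen : (im (cyc g)).card + l.length = n) :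
    ∀ t ∈ l, ∀ x, cyc g (t x) = cyc g x := by
  obtain ⟨f', h1, h2, h3⟩ := spread l id hl
  have h4 := inv_prod l f' h3
  rw [hg] at h4
  rw [im_id, Finset.card_univ, Fintype.card_fin] at h1
  have h5 := im_eq_image g f' h4
  have h6 : Set.InjOn f' (im (cyc g)) := by
    apply Finset.injOn_of_card_image_eq
    apply le_antisymm Finset.card_image_le
    rw [← h5]; omega
  intro t ht x
  apply h6 (mem_im _ _) (mem_im _ _)
  rw [inv_cycle g f' h4 (same_cyc g _), inv_cycle g f' h4 (same_cyc g x)]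
  exact h3 t ht x

lemma formPerm_fact (l : List (Fin n)) (hl : l.Nodup) : ∃ m : List (Equiv.Perm (Fin n)),
    (∀ t ∈ m, t.IsSwap) ∧ m.prod = l.formPerm ∧ m.length = l.length - 1 := by
  induction l with
  | nil => exact ⟨[], by simp, by simp, by simp⟩
  | cons x l ih =>
    cases l with
    | nil => exact ⟨[], by simp, by simp, by simp⟩
    | cons y l =>
      obtain ⟨m, h1, h2, h3⟩ := ih hl.of_cons
      refine ⟨Equiv.swap x y :: m, ?_, ?_, ?_⟩
      · intro t ht
        rcases List.mem_cons.1 ht with rfl | ht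
        · refine ⟨x, y, ?_, rfl⟩
          rintro rfl
          simp at hl
        · exact h1 t ht
      · rw [List.prod_cons, h2, List.formPerm_cons_cons]
      · simp only [List.length_cons] at h3 ⊢
        omega

lemma fact_exists (g : Equiv.Perm (Fin n)) : ∃ l : List (Equiv.Perm (Fin n)),
    (∀ t ∈ l, t.IsSwap) ∧ l.prod = g ∧ l.length + Multiset.card g.cycleType = g.support.card := by
  induction g using Equiv.Perm.cycle_induction_on with
  | base_one => exact ⟨[], by simp, by simp, by simp⟩
  | base_cycles σ hσ =>
    obtain ⟨x, hx, _⟩ := id hσ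
    obtain ⟨m, h1, h2, h3⟩ := formPerm_fact (σ.toList x) (Equiv.Perm.nodup_toList σ x)
    refine ⟨m, h1, ?_, ?_⟩
    · rw [h2, Equiv.Perm.formPerm_toList, hσ.cycleOf_eq hx]
    · have := hσ.two_le_card_support
      rw [h3, Equiv.Perm.length_toList, hσ.cycleOf_eq hx, hσ.cycleType]
      simp only [Multiset.card_singleton]
      omega
  | induction_disjoint σ τ hd _ h1 h2 =>
    obtain ⟨l, a, b, c⟩ := h1
    obtain ⟨l', a', b', c'⟩ := h2
    refine ⟨l ++ l', ?_, ?_, ?_⟩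
    · intro t ht
      rcases List.mem_append.1 ht with ht | ht
      · exact a t ht
      · exact a' t ht
    · rw [List.prod_append, b, b']
    · rw [hd.cycleType_mul, hd.card_support_mul, Multiset.card_add, List.length_append]
      omega

lemma cyc_multiset (g : Equiv.Perm (Fin n)) :
    (im (cyc g)).val.map (fib (cyc g)) =
      g.cycleType + Multiset.replicate (n - g.support.card) 1 := by
  have hfix : ∀ a, g a = a → ∀ x, g.SameCycle x a → x = a := by
    intro a ha x hx
    exact ((Equiv.Perm.sameCycle_comm.1 hx).eq_of_left ha).symm
  rw [← Multiset.filter_add_not (fun a => g a ≠ a) (im (cyc g)).val, Multiset.map_add]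
  congr 1
  · have h1 : g.cycleFactorsFinset = ((im (cyc g)).filter (fun a => g a ≠ a)).image g.cycleOf := by
      ext c
      simp only [Finset.mem_image, Finset.mem_filter]
      constructor
      · intro hc
        obtain ⟨hc1, hc2⟩ := Equiv.Perm.mem_cycleFactorsFinset_iff.1 hc
        obtain ⟨x, hx, _⟩ := id hc1
        have hxs : x ∈ c.support := by simpa using hx
        have hxg : g x ≠ x := by rw [← hc2 x hxs]; exact hx
        refine ⟨cyc g x, ⟨mem_im _ _, ?_⟩, ?_⟩
        · intro hf
          have := hfix _ hf x (same_cyc g x).symm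
          rw [← this] at hf
          exact hxg hf
        · rw [(same_cyc g x).cycleOf_eq]
          exact (Equiv.Perm.cycle_is_cycleOf hxs hc).symm
      · rintro ⟨a, ⟨_, ha⟩, rfl⟩
        rw [Equiv.Perm.cycleOf_mem_cycleFactorsFinset_iff]
        simpa using ha
    have hinj : Set.InjOn g.cycleOf ((im (cyc g)).filter (fun a => g a ≠ a)) := by
      intro a ha b hb hab
      simp only [Finset.coe_filter, Set.mem_ofPred_eq] at ha hb
      have := (Equiv.Perm.sameCycle_iff_cycleOf_eq_of_mem_support
        (by simpa using ha.2) (by simpa using hb.2)).2 hab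
      rw [← cyc_eq, cyc_self g ha.1, cyc_self g hb.1] at this
      exact this
    rw [Equiv.Perm.cycleType_def, h1, Finset.image_val_of_injOn hinj, Multiset.map_map,
      Finset.filter_val]
    apply Multiset.map_congr rfl
    intro a ha
    obtain ⟨ha1, ha2⟩ := Multiset.mem_filter.1 ha
    simp only [Function.comp, fib]
    congr 1
    ext x
    rw [Equiv.Perm.mem_support_cycleOf_iff' ha2]
    simp only [Finset.mem_filter, Finset.mem_univ, true_and]
    rw [← cyc_eq, cyc_self g ha1]
    exact eq_comm
  · rw [Multiset.eq_replicate]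
    have hset : (im (cyc g)).filter (fun a => ¬ g a ≠ a) = g.supportᶜ := by
      ext a
      simp only [Finset.mem_filter, Finset.mem_compl, Equiv.Perm.mem_support]
      constructor
      · exact fun h => h.2
      · intro h
        refine ⟨?_, h⟩
        have := hfix a (not_not.1 h) _ (same_cyc g a)
        rw [← this]
        exact mem_im _ _
    constructor
    · rw [Multiset.card_map, ← Finset.filter_val, Finset.card_val, hset, Finset.card_compl,
        Fintype.card_fin]
    · intro b hb
      obtain ⟨a, ha, rfl⟩ := Multiset.mem_map.1 hb
      obtain ⟨ha1, ha2⟩ := Multiset.mem_filter.1 ha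
      unfold fib
      rw [Finset.card_eq_one]
      refine ⟨a, ?_⟩
      ext x
      simp only [Finset.mem_filter, Finset.mem_univ, true_and, Finset.mem_singleton]
      constructor
      · intro h
        rw [← cyc_self g ha1, cyc_eq] at h
        exact hfix a (not_not.1 ha2) x h
      · rintro rfl
        exact cyc_self g ha1

lemma rLen_eq (g : Equiv.Perm (Fin n)) :
    rLen {t : Equiv.Perm (Fin n) | t.IsSwap} g + (im (cyc g)).card = n := by
  obtain ⟨l, h1, h2, h3⟩ := fact_exists g
  have hc : (im (cyc g)).card = Multiset.card g.cycleType + (n - g.support.card) := by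
    have := congrArg Multiset.card (cyc_multiset g)
    simpa using this
  have hs : g.support.card ≤ n := by simpa using Finset.card_le_univ g.support
  have hlen : l.length = n - (im (cyc g)).card := by omega
  have : rLen {t : Equiv.Perm (Fin n) | t.IsSwap} g = n - (im (cyc g)).card := by
    unfold rLen
    apply le_antisymm
    · exact Nat.sInf_le ⟨l, h1, h2, hlen⟩
    · refine le_csInf ⟨l.length, l, h1, h2, rfl⟩ ?_
      rintro b ⟨l', a', b', rfl⟩
      have := len_lower g l' a' b'
      omega
  have : (im (cyc g)).card ≤ n := by simpa using Finset.card_le_univ (im (cyc g))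
  omega

lemma red_exists (g : Equiv.Perm (Fin n)) : ∃ l, l ∈ Red {t : Equiv.Perm (Fin n) | t.IsSwap} g := by
  obtain ⟨l, h1, h2, h3⟩ := fact_exists g
  have hc : (im (cyc g)).card = Multiset.card g.cycleType + (n - g.support.card) := by
    have := congrArg Multiset.card (cyc_multiset g)
    simpa using this
  have hs : g.support.card ≤ n := by simpa using Finset.card_le_univ g.support
  have := rLen_eq g
  exact ⟨l, h1, h2, by omega⟩

lemma closure_iff (g : Equiv.Perm (Fin n)) (S : Set (Equiv.Perm (Fin n)))
    (hS : ∀ t ∈ S, t.IsSwap) (l : List (Equiv.Perm (Fin n)))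
    (hl : l ∈ Red {t : Equiv.Perm (Fin n) | t.IsSwap} g) :
    Subgroup.closure (S ∪ {x | x ∈ l}) = ⊤ ↔ Conn (cyc g) S := by
  obtain ⟨h1, h2, h3⟩ := hl
  have hlen := rLen_eq g
  have hr := red_inv g l h1 h2 (by omega)
  have hsw : ∀ t ∈ S ∪ {x | x ∈ l}, t.IsSwap := by
    rintro t (ht | ht)
    · exact hS t ht
    · exact h1 t ht
  constructor
  · intro htop A hA hSA x y hx
    have key : ∀ σ ∈ Subgroup.closure (S ∪ {x | x ∈ l}), ∀ z, z ∈ A ↔ σ z ∈ A := by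
      intro σ hσ
      induction hσ using Subgroup.closure_induction with
      | mem t ht =>
        have h : ∀ z, z ∈ A → t z ∈ A := by
          intro z hz
          rcases ht with ht | ht
          · exact hSA t ht z hz
          · exact hA _ _ (hr t ht z).symm hz
        intro z
        refine ⟨h z, fun h' => ?_⟩
        have := h _ h'
        obtain ⟨u, v, _, rfl⟩ := hsw t ht
        simpa using this
      | one => simp
      | mul a b _ _ ha hb => intro z; rw [Equiv.Perm.mul_apply, ← ha, ← hb]
      | inv a _ ha => intro z; rw [ha (a⁻¹ z)]; simp
    have := (key (Equiv.swap x y) (by rw [htop]; trivial) x).1 hx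
    simpa using this
  · intro hc
    have : MulAction.IsPretransitive (Subgroup.closure (S ∪ {x | x ∈ l})) (Fin n) := by
      refine ⟨fun x y => ?_⟩
      have hmem : ∀ t ∈ Subgroup.closure (S ∪ {x | x ∈ l}),
          ∀ z ∈ MulAction.orbit (Subgroup.closure (S ∪ {x | x ∈ l})) x,
          t z ∈ MulAction.orbit (Subgroup.closure (S ∪ {x | x ∈ l})) x := by
        rintro t ht z ⟨σ, rfl⟩
        exact ⟨⟨t, ht⟩ * σ, rfl⟩
      have hg : g ∈ Subgroup.closure (S ∪ {x | x ∈ l}) := by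
        rw [← h2]
        exact Subgroup.list_prod_mem _ fun t ht => Subgroup.subset_closure (Or.inr ht)
      have := hc (MulAction.orbit (Subgroup.closure (S ∪ {x | x ∈ l})) x) ?_ ?_ x y
        (MulAction.mem_orbit_self x)
      · exact this
      · intro p q hpq hp
        obtain ⟨i, rfl⟩ := (cyc_eq g p q).1 hpq
        exact hmem _ (Subgroup.zpow_mem _ hg i) _ hp
      · intro t ht z hz
        exact hmem t (Subgroup.subset_closure (Or.inl ht)) z hz
    exact closure_of_isSwap_of_isPretransitive hsw

lemma RGS_eq (hn : 0 < n) (g : Equiv.Perm (Fin n)) :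
    RGS {t : Equiv.Perm (Fin n) | t.IsSwap} ⊤ (n - 1) g = ↑(Tr (cyc g)) := by
  have hr := rLen_eq g
  have hpos : 0 < (im (cyc g)).card := Finset.card_pos.2 ⟨_, mem_im _ ⟨0, hn⟩⟩
  ext S
  rw [Finset.mem_coe, mem_Tr]
  constructor
  · rintro ⟨h1, h2, l, hl, h3⟩
    have h1' : ∀ t ∈ S, t.IsSwap := fun t ht => h1 ht
    exact ⟨h1', by omega, (closure_iff g S h1' l hl).1 h3⟩
  · rintro ⟨h1, h2, h3⟩
    obtain ⟨l, hl⟩ := red_exists g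
    exact ⟨fun t ht => h1 t ht, by omega, l, hl, (closure_iff g S h1 l hl).2 h3⟩

end Comb

open Comb in
/-- for a permutation `g ∈ S_n` with `k` cycles (fixed points included)
of lengths `λ_1, …, λ_k`, the number of generating sets for `S_n` relative to `g`
equals `n^{k-2} · λ_1 ⋯ λ_k`. -/
theorem card_RGS_symmetric_group {n k : ℕ} (hn : 0 < n)
    (g : Equiv.Perm (Fin n)) (lam : Fin k → ℕ)
    (hlam : (↑(List.ofFn lam) : Multiset ℕ)
      = g.cycleType + Multiset.replicate (n - g.support.card) 1) :
    ((RGS {t : Equiv.Perm (Fin n) | t.IsSwap} ⊤ (n - 1) g).ncard : ℚ)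
      = (n : ℚ) ^ ((k : ℤ) - 2) * ∏ i, (lam i : ℚ) := by
  have hm := (cyc_multiset g).trans hlam.symm
  have hk : (im (cyc g)).card = k := by
    have := congrArg Multiset.card hm
    simpa using this
  have hP : P (cyc g) = ∏ i, lam i := by
    have := congrArg Multiset.prod hm
    rw [Multiset.prod_coe, List.prod_ofFn] at this
    exact this
  have hpos : 0 < (im (cyc g)).card := Finset.card_pos.2 ⟨_, mem_im _ ⟨0, hn⟩⟩
  obtain ⟨j, rfl⟩ : ∃ j, k = j + 1 := ⟨k - 1, by omega⟩
  have h := card_Tr hn j (cyc g) hk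
  rw [RGS_eq hn, Set.ncard_coe_finset]
  have hn' : (n : ℚ) ≠ 0 := by exact_mod_cast hn.ne'
  apply mul_right_cancel₀ hn'
  rw [h, hP]
  have e : ((j + 1 : ℕ) : ℤ) - 2 = (j : ℤ) - 1 := by push_cast; ring
  rw [e, zpow_sub₀ hn', zpow_natCast, zpow_one]
  push_cast
  field_simp
end
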